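/- Let α > 0, κ₀, κ_∞ ∈ ℝ, and let σ_*(λ) = κ_∞ |log λ|^{−α} χ₀(λ) + κ₀ |log λ|^{−α} χ_∞(λ), with cut-off functions χ₀, χ_∞ ∈ C^∞((0,∞)) satisfying χ₀(t) = 1 for t ≤ 1/4, χ₀(t) = 0 for t ≥ 1/2, χ_∞(t) = 0 for t ≤ 2, χ_∞(t) = 1 for t ≥ 4. Let H_* be the Hankel operator with kernel h_*(t) = ∫₀^∞ e^{−tλ} σ_*(λ) dλ. Then the eigenvalues of H_* obey λ_n^±(H_*) = a^± n^{−α} + o(n^{−α}) as n → ∞, where a^± = τ(α) ((κ₀)_±^{1/α} + (κ_∞)_±^{1/α})^α. -/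

import Mathlib

noncomputable section
open MeasureTheory Filter Asymptotics Set

/-- Lebesgue measure restricted to `(0, ∞)`. -/
abbrev muP : Measure ℝ := volume.restrict (Set.Ioi (0:ℝ))

/-- The Hilbert space `L²((0,∞))`. -/
abbrev HSp := Lp ℂ 2 muP

/-- The Hilbert space `L²(ℝ)`. -/
abbrev HLine := Lp ℂ 2 (volume : Measure ℝ)

/-- The Hilbert space `ℓ²(ℤ₊)`. -/
abbrev ellTwo := lp (fun _ : ℕ => ℂ) 2

/-- `H` is the Hankel operator with kernel `h` : `(Hu)(t) = ∫₀^∞ h(t+s) u(s) ds`. -/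
def IsHankel (h : ℝ → ℂ) (H : HSp →L[ℂ] HSp) : Prop :=
  ∀ u : HSp, ∀ᵐ t ∂muP, (H u : ℝ → ℂ) t = ∫ s in Set.Ioi (0:ℝ), h (t + s) * (u : ℝ → ℂ) s

/-- `G` is the discrete Hankel operator with matrix elements `g` :
`(Gu)(j) = ∑ₖ g(j+k) u(k)`. -/
def IsHankelD (g : ℕ → ℂ) (G : ellTwo →L[ℂ] ellTwo) : Prop :=
  ∀ u : ellTwo, ∀ j : ℕ, (G u : ℕ → ℂ) j = ∑' k : ℕ, g (j + k) * (u : ℕ → ℂ) k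

/-- `λₙ⁺(K)`, the `n`-th positive eigenvalue (non-increasing, with multiplicity) of a compact
self-adjoint operator `K`, expressed through the Courant–Fischer max-min principle
(the value is `0` if `K` has fewer than `n` positive eigenvalues). -/
def posEig {E : Type*} [NormedAddCommGroup E] [InnerProductSpace ℂ E]
    (K : E →L[ℂ] E) (n : ℕ) : ℝ :=
  ⨆ V : {V : Submodule ℂ E // Module.finrank ℂ V = n},
    ⨅ x : {x : E // x ∈ V.1 ∧ ‖x‖ = 1}, (@inner ℂ E _ (K x.1) x.1).re

/-- `λₙ⁻(K) = λₙ⁺(-K)`. -/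
def negEig {E : Type*} [NormedAddCommGroup E] [InnerProductSpace ℂ E]
    (K : E →L[ℂ] E) (n : ℕ) : ℝ := posEig (-K) n

/-- `sₙ(K)`, the `n`-th singular value of a compact operator `K`, via the max–min principle. -/
def singVal {E : Type*} [NormedAddCommGroup E] [InnerProductSpace ℂ E]
    (K : E →L[ℂ] E) (n : ℕ) : ℝ :=
  ⨆ V : {V : Submodule ℂ E // Module.finrank ℂ V = n},
    ⨅ x : {x : E // x ∈ V.1 ∧ ‖x‖ = 1}, ‖K x.1‖

/-- `N(α) = [α] + 1` if `α ≥ 1/2`, and `N(α) = 0` if `α < 1/2`. -/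
def Nal (α : ℝ) : ℕ := if α < 1/2 then 0 else Nat.floor α + 1

/-- The constant `τ(α) = 2^{-α} π^{1-2α} B(1/(2α), 1/2)^α`. -/
def tauC (α : ℝ) : ℝ :=
  (2:ℝ) ^ (-α) * Real.pi ^ (1 - 2*α) *
    (Real.Gamma (1/(2*α)) * Real.Gamma (1/2) / Real.Gamma (1/(2*α) + 1/2)) ^ α

/-- Iterated differences of a sequence: `g⁽⁰⁾ = g`, `g⁽ᵐ⁾(j) = g⁽ᵐ⁻¹⁾(j+1) - g⁽ᵐ⁻¹⁾(j)`. -/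
def iterDiff {E : Type*} [Sub E] (g : ℕ → E) : ℕ → ℕ → E
  | 0 => g
  | m + 1 => fun j => iterDiff g m (j + 1) - iterDiff g m j

/-- The standard function `v(x) = √π / √(cosh πx)`. -/
def vStd (x : ℝ) : ℝ := Real.sqrt Real.pi / Real.sqrt (Real.cosh (Real.pi * x))

/-- The Fourier transform `(Φw)(ξ) = (2π)^{-1/2} ∫ e^{-ixξ} w(x) dx`. -/
def fou (w : ℝ → ℂ) (ξ : ℝ) : ℂ :=
  (((2 * Real.pi) ^ (-(1:ℝ)/2) : ℝ) : ℂ) * ∫ x : ℝ, Complex.exp (-(Complex.I * x * ξ)) * w x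

/-- `h ∈ L^∞_loc((0,∞))`. -/
def LinftyLoc {E : Type*} [NormedAddCommGroup E] (h : ℝ → E) : Prop :=
  AEStronglyMeasurable h muP ∧
    ∀ K : Set ℝ, IsCompact K → K ⊆ Set.Ioi 0 → ∃ C, ∀ᵐ t ∂muP, t ∈ K → ‖h t‖ ≤ C

/-- The quadratic-form characterization of the pseudodifferential operator
`A = v(X) s(D) v(X)` on `L²(ℝ)`:  `⟪g, A f⟫ = ∫ conj((Φ(v·g))(ξ)) s(ξ) (Φ(v·f))(ξ) dξ`
for all `f, g` represented by smooth compactly supported functions. -/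
def IsVSDV (v : ℝ → ℝ) (s : ℝ → ℂ) (A : HLine →L[ℂ] HLine) : Prop :=
  ∀ (f g : HLine) (F G : ℝ → ℂ),
    ContDiff ℝ (⊤ : ℕ∞) F → HasCompactSupport F → ContDiff ℝ (⊤ : ℕ∞) G → HasCompactSupport G →
    (f : ℝ → ℂ) =ᵐ[volume] F → (g : ℝ → ℂ) =ᵐ[volume] G →
    (@inner ℂ HLine _ g (A f)) =
      ∫ ξ : ℝ, (starRingEnd ℂ) (fou (fun x => (v x : ℂ) * G x) ξ) * s ξ *
        fou (fun x => (v x : ℂ) * F x) ξ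

/-- The form `q` is bounded by `c * ‖f‖ ^ 2` on the orthogonal complement of a subspace of
dimension at most `r`. -/
def SmallOffDim {E : Type*} [NormedAddCommGroup E] [InnerProductSpace ℂ E]
    (q : E → ℝ) (c r : ℝ) : Prop :=
  ∃ Z : Submodule ℂ E, FiniteDimensional ℂ Z ∧ (Module.finrank ℂ Z : ℝ) ≤ r ∧
    ∀ f ∈ Zᗮ, q f ≤ c * ‖f‖ ^ 2

section Forms

variable {E : Type*} [NormedAddCommGroup E] [InnerProductSpace ℂ E]

/-- A nonnegative quadratic form of trace at most `B` is at most `δ` off a subspace of dimension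
at most `B / δ`. -/
theorem smallOffDim_of_sum_le (q : E → ℝ)
    (hq : ∀ (c : ℂ) f, q (c • f) = ‖c‖ ^ 2 * q f) {B δ : ℝ} (hδ : 0 < δ)
    (hB : ∀ n (e : Fin n → E), Orthonormal ℂ e → ∑ i, q (e i) ≤ B) :
    SmallOffDim q δ (B / δ) := by
  classical
  set P : ℕ → Prop := fun n => ∃ e : Fin n → E, Orthonormal ℂ e ∧ ∀ i, δ < q (e i) with hP
  have hPle : ∀ n, P n → (n : ℝ) ≤ B / δ := by
    rintro n ⟨e, he, hqe⟩
    rw [le_div_iff₀ hδ]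
    calc (n : ℝ) * δ = ∑ _i : Fin n, δ := by simp
      _ ≤ ∑ i, q (e i) := Finset.sum_le_sum fun i _ => (hqe i).le
      _ ≤ B := hB n e he
  have hP0 : P 0 := ⟨Fin.elim0, ⟨fun i => i.elim0, fun i => i.elim0⟩, fun i => i.elim0⟩
  set n := Nat.findGreatest P ⌊B / δ⌋₊ with hn
  have hPn : P n := Nat.findGreatest_spec (P := P) (Nat.zero_le _) hP0
  have hPn1 : ¬ P (n + 1) := by
    intro h
    have h1 : n + 1 ≤ ⌊B / δ⌋₊ := Nat.le_floor (hPle _ h)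
    have h2 : n + 1 ≤ n := Nat.le_findGreatest h1 h
    omega
  have hnB := hPle n hPn
  obtain ⟨e, he, hqe⟩ := hPn
  refine ⟨Submodule.span ℂ (range e), FiniteDimensional.span_of_finite ℂ (finite_range e), ?_, ?_⟩
  · refine le_trans ?_ hnB
    have := finrank_range_le_card (R := ℂ) e
    simp only [Set.finrank, Fintype.card_fin] at this
    exact_mod_cast this
  · intro f hf
    by_contra! hlt
    have hf0 : f ≠ 0 := by
      rintro rfl
      have : q 0 = 0 := by simpa using hq 0 0
      simp [this] at hlt
    have hnf : 0 < ‖f‖ := norm_pos_iff.2 hf0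
    have horth : ∀ i, inner ℂ (e i) f = 0 := fun i =>
      (Submodule.mem_orthogonal _ _).1 hf _ (Submodule.subset_span (mem_range_self i))
    set g : E := ((‖f‖⁻¹ : ℝ) : ℂ) • f with hg
    have hg1 : ‖g‖ = 1 := by
      rw [hg, norm_smul]; simp [hnf.ne']
    have hqg : δ < q g := by
      rw [hg, hq]
      simp only [Complex.norm_real, norm_inv, norm_norm]
      rw [inv_pow, ← div_eq_inv_mul, lt_div_iff₀ (by positivity)]
      exact hlt
    have horthg : ∀ i, inner ℂ (e i) g = 0 := fun i => by rw [hg, inner_smul_right, horth, mul_zero]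
    have horthg' : ∀ i, inner ℂ g (e i) = 0 := fun i => by
      rw [← inner_conj_symm, horthg, map_zero]
    apply hPn1
    refine ⟨Fin.cons g e, ⟨?_, ?_⟩, ?_⟩
    · intro i
      refine Fin.cases ?_ (fun j => ?_) i
      · simpa using hg1
      · simpa using he.1 j
    · intro i j hij
      induction i using Fin.cases with
      | zero =>
        induction j using Fin.cases with
        | zero => exact absurd rfl hij
        | succ j => simpa using horthg' j
      | succ i =>
        induction j using Fin.cases with
        | zero => simpa using horthg i
        | succ j => simpa using he.2 (fun h => hij (by rw [h]))
    · intro i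
      refine Fin.cases ?_ (fun j => ?_) i
      · simpa using hqg
      · simpa using hqe j

theorem SmallOffDim.add {q₁ q₂ : E → ℝ} {c₁ c₂ r₁ r₂ : ℝ} (h₁ : SmallOffDim q₁ c₁ r₁)
    (h₂ : SmallOffDim q₂ c₂ r₂) :
    SmallOffDim (fun f => q₁ f + q₂ f) (c₁ + c₂) (r₁ + r₂) := by
  obtain ⟨Z₁, i₁, d₁, b₁⟩ := h₁
  obtain ⟨Z₂, i₂, d₂, b₂⟩ := h₂
  refine ⟨Z₁ ⊔ Z₂, inferInstance, ?_, fun f hf => ?_⟩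
  · have h := Submodule.finrank_add_le_finrank_add_finrank Z₁ Z₂
    have h' : (Module.finrank ℂ ↥(Z₁ ⊔ Z₂) : ℝ) ≤ Module.finrank ℂ Z₁ + Module.finrank ℂ Z₂ := by
      exact_mod_cast h
    linarith
  · have e₁ := b₁ f (Submodule.orthogonal_le le_sup_left hf)
    have e₂ := b₂ f (Submodule.orthogonal_le le_sup_right hf)
    linarith

theorem SmallOffDim.mono {q₁ q₂ : E → ℝ} {c₁ c₂ r₁ r₂ : ℝ} (h : SmallOffDim q₁ c₁ r₁)
    (hq : ∀ f, q₂ f ≤ q₁ f) (hc : c₁ ≤ c₂) (hr : r₁ ≤ r₂) : SmallOffDim q₂ c₂ r₂ := by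
  obtain ⟨Z, i, d, b⟩ := h
  exact ⟨Z, i, d.trans hr, fun f hf => (hq f).trans ((b f hf).trans (by gcongr))⟩

/-- Finitely many linear constraints give a `SmallOffDim` bound. -/
theorem smallOffDim_of_inner_eq_zero {ι : Type*} [Fintype ι] (v : ι → E) {q : E → ℝ} {c : ℝ}
    (h : ∀ f, (∀ i, inner ℂ (v i) f = 0) → q f ≤ c * ‖f‖ ^ 2) :
    SmallOffDim q c (Fintype.card ι) := by
  refine ⟨Submodule.span ℂ (range v), FiniteDimensional.span_of_finite ℂ (finite_range v), ?_,
    fun f hf => h f fun i => ?_⟩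
  · have := finrank_range_le_card (R := ℂ) v
    simp only [Set.finrank] at this
    exact_mod_cast this
  · exact (Submodule.mem_orthogonal _ _).1 hf _ (Submodule.subset_span (mem_range_self i))

theorem re_inner_map_le (K : E →L[ℂ] E) {x : E} (hx : ‖x‖ = 1) :
    |(inner ℂ (K x) x).re| ≤ ‖K‖ := by
  calc |(inner ℂ (K x) x).re| ≤ ‖inner ℂ (K x) x‖ := Complex.abs_re_le_norm _
    _ ≤ ‖K x‖ * ‖x‖ := norm_inner_le_norm _ _
    _ ≤ ‖K‖ * ‖x‖ * ‖x‖ := by gcongr; exact K.le_opNorm x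
    _ = ‖K‖ := by rw [hx]; ring

theorem bddBelow_re_inner (K : E →L[ℂ] E) (V : Submodule ℂ E) :
    BddBelow (range fun x : {x : E // x ∈ V ∧ ‖x‖ = 1} => (inner ℂ (K x.1) x.1).re) := by
  refine ⟨-‖K‖, ?_⟩
  rintro _ ⟨x, rfl⟩
  exact (abs_le.1 (re_inner_map_le K x.2.2)).1

theorem exists_unit_of_finrank_pos {V : Submodule ℂ E} (h : 0 < Module.finrank ℂ V) :
    ∃ x ∈ V, ‖x‖ = 1 := by
  have : V ≠ ⊥ := by rintro rfl; simp at h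
  obtain ⟨x, hxV, hx⟩ := Submodule.exists_mem_ne_zero_of_ne_bot this
  exact ⟨((‖x‖⁻¹ : ℝ) : ℂ) • x, V.smul_mem _ hxV, by
    rw [norm_smul]; simp [norm_ne_zero_iff.2 hx]⟩

theorem finrank_inf_orthogonal_ge (V Z : Submodule ℂ E) [FiniteDimensional ℂ V]
    [FiniteDimensional ℂ Z] :
    Module.finrank ℂ V ≤ Module.finrank ℂ ↥(V ⊓ Zᗮ) + Module.finrank ℂ Z := by
  set P : V →ₗ[ℂ] Z := (Z.orthogonalProjectionOnto : E →ₗ[ℂ] Z) ∘ₗ V.subtype with hP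
  have h1 := LinearMap.finrank_range_add_finrank_ker P
  have h2 : Module.finrank ℂ (LinearMap.range P) ≤ Module.finrank ℂ Z := Submodule.finrank_le _
  have h3 : Submodule.map V.subtype (LinearMap.ker P) ≤ V ⊓ Zᗮ := by
    rintro _ ⟨x, hx, rfl⟩
    refine ⟨x.2, ?_⟩
    have : Z.orthogonalProjectionOnto (x : E) = 0 := hx
    exact Submodule.orthogonalProjectionOnto_eq_zero_iff.1 this
  have h4 : Module.finrank ℂ (Submodule.map V.subtype (LinearMap.ker P)) =
      Module.finrank ℂ (LinearMap.ker P) :=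
    Submodule.finrank_map_subtype_eq V _
  have : FiniteDimensional ℂ ↥(V ⊓ Zᗮ) := Submodule.finiteDimensional_inf_left _ _
  have h5 := Submodule.finrank_mono h3
  omega

theorem posEig_le_of_smallOffDim (K : E →L[ℂ] E) {c r : ℝ} (hc : 0 ≤ c)
    (h : SmallOffDim (fun f => (inner ℂ (K f) f).re) c r) {n : ℕ} (hn : r < n) :
    posEig K n ≤ c := by
  obtain ⟨Z, hZ, hr, hb⟩ := h
  refine Real.iSup_le (fun V => ?_) hc
  have hn0 : Module.finrank ℂ Z < n := by exact_mod_cast hr.trans_lt hn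
  have : FiniteDimensional ℂ V.1 := FiniteDimensional.of_finrank_pos (by rw [V.2]; omega)
  have h1 := finrank_inf_orthogonal_ge V.1 Z
  rw [V.2] at h1
  obtain ⟨x, hx, hx1⟩ := exists_unit_of_finrank_pos (V := V.1 ⊓ Zᗮ) (by omega)
  refine (ciInf_le (bddBelow_re_inner K V.1) ⟨x, hx.1, hx1⟩).trans ?_
  simpa [hx1] using hb x hx.2

theorem le_posEig_of_finrank_eq (K : E →L[ℂ] E) {c : ℝ} {n : ℕ} (hn : 0 < n) {V : Submodule ℂ E}
    (hV : Module.finrank ℂ V = n) (h : ∀ f ∈ V, c * ‖f‖ ^ 2 ≤ (inner ℂ (K f) f).re) :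
    c ≤ posEig K n := by
  have hbdd : BddAbove (range fun V : {V : Submodule ℂ E // Module.finrank ℂ V = n} =>
      ⨅ x : {x : E // x ∈ V.1 ∧ ‖x‖ = 1}, (@inner ℂ E _ (K x.1) x.1).re) := by
    refine ⟨‖K‖, ?_⟩
    rintro _ ⟨W, rfl⟩
    obtain ⟨x, hx, hx1⟩ := exists_unit_of_finrank_pos (V := W.1) (by rw [W.2]; exact hn)
    exact (ciInf_le (bddBelow_re_inner K W.1) ⟨x, hx, hx1⟩).trans
      (abs_le.1 (re_inner_map_le K hx1)).2
  refine le_trans ?_ (le_ciSup hbdd ⟨V, hV⟩)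
  obtain ⟨x, hx, hx1⟩ := exists_unit_of_finrank_pos (V := V) (by rw [hV]; exact hn)
  have : Nonempty {x : E // x ∈ V ∧ ‖x‖ = 1} := ⟨⟨x, hx, hx1⟩⟩
  refine le_ciInf fun y => ?_
  simpa [y.2.2] using h y.1 y.2.1

theorem exists_le_finrank_eq {V : Submodule ℂ E} [FiniteDimensional ℂ V] {n : ℕ}
    (hn : n ≤ Module.finrank ℂ V) : ∃ W ≤ V, Module.finrank ℂ W = n := by
  obtain ⟨f, hf⟩ := exists_linearIndependent_of_le_finrank hn
  refine ⟨(Submodule.span ℂ (range f)).map V.subtype, Submodule.map_subtype_le V _, ?_⟩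
  rw [Submodule.finrank_map_subtype_eq, finrank_span_eq_card hf, Fintype.card_fin]

/-- If the negative part of `K` is small off a finite-dimensional subspace, then the positive
eigenvalues are bounded below. -/
theorem eventually_neg_le_posEig (K : E →L[ℂ] E) :
    ∀ᶠ n in atTop, ∀ c r : ℝ, 0 ≤ c → SmallOffDim (fun f => (inner ℂ ((-K) f) f).re) c r →
      -c ≤ posEig K n := by
  by_cases hE : Module.Finite ℂ E
  · filter_upwards [eventually_gt_atTop (Module.finrank ℂ E)] with n hn c r hc _
    have : IsEmpty {V : Submodule ℂ E // Module.finrank ℂ V = n} :=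
      ⟨fun V => absurd (Submodule.finrank_le V.1) (by rw [V.2]; omega)⟩
    rw [posEig, Real.iSup_of_isEmpty]
    linarith
  · filter_upwards [eventually_gt_atTop 0] with n hn c r hc h
    obtain ⟨Z, hZ, -, hb⟩ := h
    have hrank : ((n + Module.finrank ℂ Z : ℕ) : Cardinal) ≤ Module.rank ℂ E := by
      rw [← Module.rank_lt_aleph0_iff, not_lt] at hE
      exact (Cardinal.natCast_lt_aleph0 (n := _)).le.trans hE
    obtain ⟨f, hf⟩ := exists_linearIndependent_of_le_rank hrank
    set V := Submodule.span ℂ (range f) with hV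
    have : FiniteDimensional ℂ V := FiniteDimensional.span_of_finite ℂ (finite_range f)
    have hVn : Module.finrank ℂ V = n + Module.finrank ℂ Z := by
      rw [hV, finrank_span_eq_card hf, Fintype.card_fin]
    have h1 := finrank_inf_orthogonal_ge V Z
    have : FiniteDimensional ℂ ↥(V ⊓ Zᗮ) := Submodule.finiteDimensional_inf_left _ _
    obtain ⟨W, hW, hWn⟩ := exists_le_finrank_eq (V := V ⊓ Zᗮ) (n := n) (by omega)
    refine le_posEig_of_finrank_eq K hn hWn fun g hg => ?_
    have := hb g (hW hg).2
    simp only [neg_apply, inner_neg_left, Complex.neg_re] at this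
    linarith

end Forms

section Gram

variable {E : Type*} [NormedAddCommGroup E] [InnerProductSpace ℂ E]
  {K : Type*} [Fintype K] [DecidableEq K]

/-- The deviation of the Gram matrix of `v` from the diagonal matrix with entries `D`. -/
def gramDefect (v : K → E) (D : K → ℝ) (c c' : K) : ℂ :=
  inner ℂ (v c) (v c') - if c = c' then (D c : ℂ) else 0

theorem smallOffDim_gramDefect (v : K → E) (D : K → ℝ) {B δ : ℝ} (hδ : 0 < δ)
    (hB : ∑ c, ∑ c', ‖gramDefect v D c c'‖ ^ 2 ≤ B) :
    SmallOffDim (fun x : EuclideanSpace ℂ K => ∑ c, ‖∑ c', gramDefect v D c c' * x c'‖ ^ 2)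
      (δ ^ 2) (B / δ ^ 2) := by
  refine smallOffDim_of_sum_le _ (fun a x => ?_) (by positivity) (fun n e he => ?_)
  · rw [Finset.mul_sum]
    refine Finset.sum_congr rfl fun c _ => ?_
    rw [← mul_pow, ← norm_mul, Finset.mul_sum]
    congr 2
    refine Finset.sum_congr rfl fun c' _ => ?_
    simp only [PiLp.smul_apply, smul_eq_mul]
    ring
  · rw [Finset.sum_comm]
    refine le_trans (Finset.sum_le_sum fun c _ => ?_) hB
    set y : EuclideanSpace ℂ K := WithLp.toLp 2 fun c' => (starRingEnd ℂ) (gramDefect v D c c')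
    have h1 := he.sum_inner_products_le (s := Finset.univ) y
    have h2 : ‖y‖ ^ 2 = ∑ c', ‖gramDefect v D c c'‖ ^ 2 := by
      rw [EuclideanSpace.norm_sq_eq]
      simp [y]
    rw [← h2]
    refine le_trans (le_of_eq (Finset.sum_congr rfl fun i _ => ?_)) h1
    rw [norm_inner_symm, PiLp.inner_apply]
    simp [y, mul_comm]

theorem abs_norm_sq_sum_sub_le (v : K → E) (D : K → ℝ) {δ : ℝ} (hδ : 0 ≤ δ)
    (x : EuclideanSpace ℂ K)
    (hx : ∑ c, ‖∑ c', gramDefect v D c c' * x c'‖ ^ 2 ≤ δ ^ 2 * ‖x‖ ^ 2) :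
    |‖∑ c, x c • v c‖ ^ 2 - ∑ c, D c * ‖x c‖ ^ 2| ≤ δ * ‖x‖ ^ 2 := by
  set y : EuclideanSpace ℂ K := WithLp.toLp 2 fun c => ∑ c', gramDefect v D c c' * x c' with hy
  have hy2 : ‖y‖ ≤ δ * ‖x‖ := by
    rw [← abs_of_nonneg (norm_nonneg y), ← abs_of_nonneg (mul_nonneg hδ (norm_nonneg x))]
    rw [← sq_le_sq, mul_pow, EuclideanSpace.norm_sq_eq]
    exact hx
  have h1 : (((‖∑ c, x c • v c‖ ^ 2 - ∑ c, D c * ‖x c‖ ^ 2 : ℝ)) : ℂ) = inner ℂ x y := by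
    push_cast
    have := inner_self_eq_norm_sq_to_K (𝕜 := ℂ) (∑ c, x c • v c)
    simp only [Complex.coe_algebraMap] at this
    rw [← this, sum_inner, PiLp.inner_apply, ← Finset.sum_sub_distrib]
    refine Finset.sum_congr rfl fun c _ => ?_
    rw [inner_sum]
    have e1 : ∀ c', inner ℂ (x c • v c) (x c' • v c') =
        (starRingEnd ℂ) (x c) * (gramDefect v D c c' * x c') +
          (if c = c' then (D c : ℂ) * ((starRingEnd ℂ) (x c) * x c) else 0) := by
      intro c'
      rw [inner_smul_left, inner_smul_right, gramDefect]
      split_ifs with h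
      · subst h; ring
      · ring
    simp only [e1, Finset.sum_add_distrib, Finset.sum_ite_eq, Finset.mem_univ, if_true]
    have e2 : (starRingEnd ℂ) (x c) * x c = (‖x c‖ : ℂ) ^ 2 := by
      rw [mul_comm, Complex.mul_conj, Complex.normSq_eq_norm_sq]; push_cast; rfl
    rw [e2, add_sub_cancel_right, ← Finset.mul_sum]
    simp [hy, mul_comm]
  have h2 : |‖∑ c, x c • v c‖ ^ 2 - ∑ c, D c * ‖x c‖ ^ 2| = ‖inner ℂ x y‖ := by
    rw [← h1, Complex.norm_real, Real.norm_eq_abs]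
  rw [h2]
  calc ‖inner ℂ x y‖ ≤ ‖x‖ * ‖y‖ := norm_inner_le_norm _ _
    _ ≤ ‖x‖ * (δ * ‖x‖) := by gcongr
    _ = δ * ‖x‖ ^ 2 := by ring

theorem smallOffDim_sum_inner (v : K → E) (D : K → ℝ) {B δ l : ℝ} (hδ : 0 < δ) (hl : 0 ≤ l)
    (hB : ∑ c, ∑ c', ‖gramDefect v D c c'‖ ^ 2 ≤ B) :
    SmallOffDim (fun f => ∑ c, ‖inner ℂ (v c) f‖ ^ 2) (l + δ)
      ((Finset.univ.filter fun c => l < D c).card + B / δ ^ 2) := by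
  obtain ⟨Z, hZ, hdim, hb⟩ := smallOffDim_gramDefect v D hδ hB
  set z := Module.finBasis ℂ Z
  set u : {c // l < D c} ⊕ Fin (Module.finrank ℂ Z) → E :=
    Sum.elim (fun c => v c) (fun i => ∑ c, (z i : EuclideanSpace ℂ K) c • v c) with hu
  have key : SmallOffDim (fun f => ∑ c, ‖inner ℂ (v c) f‖ ^ 2) (l + δ)
      (Fintype.card ({c // l < D c} ⊕ Fin (Module.finrank ℂ Z))) := by
    refine smallOffDim_of_inner_eq_zero u fun f hf => ?_
    set a : EuclideanSpace ℂ K := WithLp.toLp 2 fun c => inner ℂ (v c) f with ha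
    have haD : ∀ c, l < D c → a c = 0 := fun c hc => hf (Sum.inl ⟨c, hc⟩)
    have haZ : a ∈ Zᗮ := by
      have hle : Z ≤ (Submodule.span ℂ {a})ᗮ := by
        intro w hw
        rw [Submodule.mem_orthogonal_singleton_iff_inner_left]
        have e1 : ∀ w : Z, inner ℂ (w : EuclideanSpace ℂ K) a = 0 := by
          intro w
          rw [← z.sum_repr w]
          simp only [Submodule.coe_sum, Submodule.coe_smul, sum_inner, inner_smul_left]
          refine Finset.sum_eq_zero fun i _ => ?_
          have := hf (Sum.inr i)
          simp only [hu, Sum.elim_inr, sum_inner, inner_smul_left] at this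
          rw [PiLp.inner_apply]
          simp only [ha, RCLike.inner_apply]
          rw [mul_eq_zero]; right
          rw [← this]
          exact Finset.sum_congr rfl fun c _ => mul_comm _ _
        exact e1 ⟨w, hw⟩
      rw [Submodule.mem_orthogonal]
      intro w hw
      exact (Submodule.mem_orthogonal_singleton_iff_inner_left).1 (hle hw)
    have ha2 : ∑ c, ‖inner ℂ (v c) f‖ ^ 2 = ‖a‖ ^ 2 := by
      rw [EuclideanSpace.norm_sq_eq]
    have h1 : ‖a‖ ^ 2 ≤ ‖∑ c, a c • v c‖ * ‖f‖ := by
      have e : ((‖a‖ ^ 2 : ℝ) : ℂ) = inner ℂ (∑ c, a c • v c) f := by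
        rw [sum_inner, ← ha2]
        push_cast
        refine Finset.sum_congr rfl fun c _ => ?_
        rw [inner_smul_left, mul_comm]
        simp only [ha]
        rw [Complex.mul_conj, Complex.normSq_eq_norm_sq]; push_cast; rfl
      have e' : ‖a‖ ^ 2 = ‖inner ℂ (∑ c, a c • v c) f‖ := by
        rw [← e, Complex.norm_real, Real.norm_eq_abs, abs_of_nonneg (by positivity)]
      rw [e']; exact norm_inner_le_norm _ _
    have h2 : ‖∑ c, a c • v c‖ ^ 2 ≤ (l + δ) * ‖a‖ ^ 2 := by
      have := (abs_le.1 (abs_norm_sq_sum_sub_le v D hδ.le a (hb a haZ))).2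
      have h3 : ∑ c, D c * ‖a c‖ ^ 2 ≤ l * ‖a‖ ^ 2 := by
        rw [EuclideanSpace.norm_sq_eq, Finset.mul_sum]
        refine Finset.sum_le_sum fun c _ => ?_
        by_cases hc : l < D c
        · simp [haD c hc]
        · exact mul_le_mul_of_nonneg_right (not_lt.1 hc) (by positivity)
      linarith
    rw [ha2]
    by_cases h0 : ‖a‖ = 0
    · rw [h0, zero_pow two_ne_zero]; positivity
    · have hpos : 0 < ‖a‖ ^ 2 := by positivity
      have h3 : (‖a‖ ^ 2) ^ 2 ≤ (‖∑ c, a c • v c‖ * ‖f‖) ^ 2 := by gcongr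
      have h4 : (‖a‖ ^ 2) ^ 2 ≤ (l + δ) * ‖a‖ ^ 2 * ‖f‖ ^ 2 := by
        rw [mul_pow] at h3
        exact h3.trans (by gcongr)
      nlinarith
  refine key.mono (fun _ => le_rfl) le_rfl ?_
  rw [Fintype.card_sum, Fintype.card_fin, Fintype.card_subtype]
  push_cast
  linarith

theorem exists_submodule_sum_inner_ge (v : K → E) (D : K → ℝ) {B δ l : ℝ} (hδ : 0 < δ)
    (hl : δ < l) (hD : ∀ c, l ≤ D c)
    (hB : ∑ c, ∑ c', ‖gramDefect v D c c'‖ ^ 2 ≤ B) :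
    ∃ V : Submodule ℂ E, FiniteDimensional ℂ V ∧ (Fintype.card K : ℝ) - B / δ ^ 2 ≤
      Module.finrank ℂ V ∧ ∀ f ∈ V, (l - δ) * ‖f‖ ^ 2 ≤ ∑ c, ‖inner ℂ (v c) f‖ ^ 2 ∧
        ∃ x : EuclideanSpace ℂ K, f = ∑ c, x c • v c ∧ (l - δ) * ‖x‖ ^ 2 ≤ ‖f‖ ^ 2 := by
  obtain ⟨Z, hZ, hdim, hb⟩ := smallOffDim_gramDefect v D hδ hB
  set T : EuclideanSpace ℂ K →ₗ[ℂ] E :=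
    { toFun := fun x => ∑ c, x c • v c
      map_add' := fun x y => by simp [add_smul, Finset.sum_add_distrib]
      map_smul' := fun a x => by simp [mul_smul, Finset.smul_sum] } with hT
  have hTx : ∀ x, T x = ∑ c, x c • v c := fun x => rfl
  have hlow : ∀ x ∈ Zᗮ, (l - δ) * ‖x‖ ^ 2 ≤ ‖T x‖ ^ 2 := by
    intro x hx
    have h1 := (abs_le.1 (abs_norm_sq_sum_sub_le v D hδ.le x (hb x hx))).1
    have h3 : l * ‖x‖ ^ 2 ≤ ∑ c, D c * ‖x c‖ ^ 2 := by
      rw [EuclideanSpace.norm_sq_eq, Finset.mul_sum]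
      exact Finset.sum_le_sum fun c _ => mul_le_mul_of_nonneg_right (hD c) (by positivity)
    rw [hTx]; linarith
  refine ⟨Submodule.map T Zᗮ, inferInstance, ?_, ?_⟩
  · have hinj : LinearMap.ker (T.domRestrict Zᗮ) = ⊥ := by
      rw [LinearMap.ker_eq_bot']
      intro x hx
      have h1 := hlow x x.2
      have hx' : T x = 0 := hx
      rw [hx', norm_zero] at h1
      have : ‖(x : EuclideanSpace ℂ K)‖ ^ 2 ≤ 0 := by nlinarith [sq_nonneg ‖(x : EuclideanSpace ℂ K)‖]
      have : ‖(x : EuclideanSpace ℂ K)‖ = 0 := by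
        have := sq_nonneg ‖(x : EuclideanSpace ℂ K)‖
        exact pow_eq_zero_iff (two_ne_zero) |>.1 (by linarith)
      exact Subtype.ext (norm_eq_zero.1 this)
    have h1 := LinearMap.finrank_range_of_inj (LinearMap.ker_eq_bot.1 hinj)
    rw [LinearMap.range_domRestrict] at h1
    have h2 := Submodule.finrank_add_finrank_orthogonal Z
    rw [finrank_euclideanSpace] at h2
    rw [h1, ← h2]
    push_cast
    linarith
  · rintro _ ⟨x, hx, rfl⟩
    have hx1 := hlow x hx
    refine ⟨?_, x, hTx x, hx1⟩
    set a : EuclideanSpace ℂ K := WithLp.toLp 2 fun c => inner ℂ (v c) (T x) with ha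
    have ha2 : ∑ c, ‖inner ℂ (v c) (T x)‖ ^ 2 = ‖a‖ ^ 2 := by
      rw [EuclideanSpace.norm_sq_eq]
    have h1 : ‖T x‖ ^ 2 ≤ ‖x‖ * ‖a‖ := by
      have e : ((‖T x‖ ^ 2 : ℝ) : ℂ) = inner ℂ x a := by
        have := inner_self_eq_norm_sq_to_K (𝕜 := ℂ) (T x)
        simp only [Complex.coe_algebraMap] at this
        push_cast
        rw [← this]
        nth_rewrite 1 [hTx x]
        rw [sum_inner, PiLp.inner_apply]
        refine Finset.sum_congr rfl fun c _ => ?_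
        rw [inner_smul_left]
        simp [ha, mul_comm]
      have e' : ‖T x‖ ^ 2 = ‖inner ℂ x a‖ := by
        rw [← e, Complex.norm_real, Real.norm_eq_abs, abs_of_nonneg (by positivity)]
      rw [e']; exact norm_inner_le_norm _ _
    rw [ha2]
    by_cases h0 : ‖T x‖ = 0
    · rw [h0]; simp
    · have hpos : 0 < ‖T x‖ ^ 2 := by positivity
      have h3 : (‖T x‖ ^ 2) ^ 2 ≤ (‖x‖ * ‖a‖) ^ 2 := by gcongr
      have h4 : (l - δ) * (‖T x‖ ^ 2) ^ 2 ≤ ‖T x‖ ^ 2 * ‖a‖ ^ 2 := by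
        calc (l - δ) * (‖T x‖ ^ 2) ^ 2 ≤ (l - δ) * (‖x‖ * ‖a‖) ^ 2 :=
              mul_le_mul_of_nonneg_left h3 (by linarith)
          _ = ((l - δ) * ‖x‖ ^ 2) * ‖a‖ ^ 2 := by ring
          _ ≤ ‖T x‖ ^ 2 * ‖a‖ ^ 2 := by gcongr
      nlinarith

end Gram

/-- The Carleman-type kernel `1 / (2 cosh (z / 2))`. -/
def sechKernel (z : ℝ) : ℝ := (2 * Real.cosh (z / 2))⁻¹

/-- The Fourier transform `π / cosh (π ξ)` of `sechKernel`. -/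
def sechSymbol (ξ : ℝ) : ℝ := Real.pi / Real.cosh (Real.pi * ξ)

theorem integral_sigmoid_cpow (u v : ℂ) :
    ∫ z : ℝ, ((Real.sigmoid z : ℝ) : ℂ) ^ u * ((1 - Real.sigmoid z : ℝ) : ℂ) ^ v =
      Complex.betaIntegral u v := by
  rw [Complex.betaIntegral, intervalIntegral.integral_of_le zero_le_one,
    integral_Ioc_eq_integral_Ioo, ← Real.range_sigmoid, ← image_univ,
    integral_image_eq_integral_abs_deriv_smul MeasurableSet.univ
      (fun x _ => (Real.hasDerivAt_sigmoid x).hasDerivWithinAt) Real.sigmoid_injective.injOn]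
  simp only [Measure.restrict_univ]
  refine integral_congr_ae (Eventually.of_forall fun z => ?_)
  have h0 := Real.sigmoid_pos z
  have h1 : 0 < 1 - Real.sigmoid z := sub_pos.2 (Real.sigmoid_lt_one z)
  have e0 : ((Real.sigmoid z : ℝ) : ℂ) ≠ 0 := by exact_mod_cast h0.ne'
  have e1 : ((1 - Real.sigmoid z : ℝ) : ℂ) ≠ 0 := by exact_mod_cast h1.ne'
  have e2 : (1 : ℂ) - (Real.sigmoid z : ℝ) = ((1 - Real.sigmoid z : ℝ) : ℂ) := by push_cast; rfl
  simp only [e2]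
  rw [abs_of_pos (mul_pos h0 h1), Complex.cpow_sub _ _ e0, Complex.cpow_sub _ _ e1,
    Complex.cpow_one, Complex.cpow_one, Complex.real_smul]
  rw [Complex.ofReal_mul]
  field_simp

theorem sigmoid_eq_exp_mul_sechKernel (z : ℝ) :
    Real.sigmoid z = Real.exp (z / 2) * sechKernel z := by
  rw [Real.sigmoid_def, sechKernel, Real.cosh_eq]
  have : Real.exp (-z) = Real.exp (-(z/2)) * Real.exp (-(z/2)) := by
    rw [← Real.exp_add]; ring_nf
  rw [this, Real.exp_neg]
  have := Real.exp_pos (z/2)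
  field_simp

theorem sechKernel_pos (z : ℝ) : 0 < sechKernel z :=
  inv_pos.2 (mul_pos two_pos (Real.cosh_pos _))

theorem sechKernel_neg (z : ℝ) : sechKernel (-z) = sechKernel z := by
  rw [sechKernel, sechKernel, neg_div, Real.cosh_neg]

theorem one_sub_sigmoid_eq (z : ℝ) :
    1 - Real.sigmoid z = Real.exp (-z / 2) * sechKernel z := by
  rw [← Real.sigmoid_neg, sigmoid_eq_exp_mul_sechKernel, sechKernel_neg]

theorem continuous_sechKernel : Continuous sechKernel := by
  unfold sechKernel
  exact (continuous_const.mul (Real.continuous_cosh.comp (continuous_id.div_const 2))).inv₀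
    fun z => (mul_pos two_pos (Real.cosh_pos _)).ne'

theorem sechKernel_le_exp (z : ℝ) : sechKernel z ≤ Real.exp (-(|z| / 2)) := by
  rw [sechKernel, Real.exp_neg, ← Real.cosh_abs, abs_div, abs_two]
  apply inv_anti₀ (Real.exp_pos _)
  rw [Real.cosh_eq]
  have := Real.exp_pos (-(|z| / 2))
  linarith

theorem integrable_exp_neg_mul_abs {c : ℝ} (hc : 0 < c) :
    Integrable fun z : ℝ => Real.exp (-(c * |z|)) := by
  rw [← integrableOn_univ, ← Iic_union_Ioi (a := (0 : ℝ))]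
  refine IntegrableOn.union ?_ ?_
  · refine (integrableOn_exp_mul_Iic hc 0).congr_fun (fun z hz => ?_) measurableSet_Iic
    simp only [abs_of_nonpos hz.out]; ring_nf
  · refine (integrableOn_exp_mul_Ioi (neg_lt_zero.2 hc) 0).congr_fun (fun z hz => ?_)
      measurableSet_Ioi
    simp only [abs_of_pos hz.out]; ring_nf

theorem integrable_sechKernel : Integrable sechKernel := by
  refine (integrable_exp_neg_mul_abs one_half_pos).mono' continuous_sechKernel.aestronglyMeasurable
    (Eventually.of_forall fun z => ?_)
  rw [Real.norm_of_nonneg (sechKernel_pos z).le]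
  refine (sechKernel_le_exp z).trans (Real.exp_le_exp.2 (le_of_eq (by ring)))

theorem sechKernel_sq_le_exp (z : ℝ) : sechKernel z ^ 2 ≤ Real.exp (-|z|) := by
  calc sechKernel z ^ 2 ≤ Real.exp (-(|z| / 2)) ^ 2 :=
        pow_le_pow_left₀ (sechKernel_pos z).le (sechKernel_le_exp z) 2
    _ = _ := by rw [← Real.exp_nat_mul]; push_cast; ring_nf

theorem integrable_sechKernel_sq : Integrable fun z => sechKernel z ^ 2 := by
  refine (integrable_exp_neg_mul_abs one_pos).mono'
    (continuous_sechKernel.pow 2).aestronglyMeasurable (Eventually.of_forall fun z => ?_)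
  rw [Real.norm_of_nonneg (sq_nonneg _), one_mul]
  exact sechKernel_sq_le_exp z

theorem integral_sechKernel_sq : ∫ z, sechKernel z ^ 2 = 1 := by
  have h : ∀ z, sechKernel z ^ 2 = Real.sigmoid z * (1 - Real.sigmoid z) := fun z => by
    rw [one_sub_sigmoid_eq, sigmoid_eq_exp_mul_sechKernel]
    have : Real.exp (z / 2) * Real.exp (-z / 2) = 1 := by rw [← Real.exp_add]; ring_nf; simp
    linear_combination (-sechKernel z ^ 2) * this
  rw [integral_of_hasDerivAt_of_tendsto (f := Real.sigmoid) (m := 0) (n := 1)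
    (fun z => by rw [h]; exact Real.hasDerivAt_sigmoid z) integrable_sechKernel_sq
    Real.tendsto_sigmoid_atBot Real.tendsto_sigmoid_atTop, sub_zero]

theorem integral_exp_mul_sechKernel (ξ : ℝ) :
    ∫ z : ℝ, Complex.exp (Complex.I * (ξ * z : ℝ)) * (sechKernel z : ℂ) = sechSymbol ξ := by
  have h1 := integral_sigmoid_cpow (1 / 2 + Complex.I * ξ) (1 / 2 - Complex.I * ξ)
  have h2 : ∀ z : ℝ, ((Real.sigmoid z : ℝ) : ℂ) ^ (1 / 2 + Complex.I * ξ) *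
      ((1 - Real.sigmoid z : ℝ) : ℂ) ^ (1 / 2 - Complex.I * ξ) =
      Complex.exp (Complex.I * (ξ * z : ℝ)) * (sechKernel z : ℂ) := fun z => by
    have k0 := sechKernel_pos z
    rw [one_sub_sigmoid_eq, sigmoid_eq_exp_mul_sechKernel, ← Real.exp_log k0, ← Real.exp_add,
      ← Real.exp_add, Complex.ofReal_exp, Complex.ofReal_exp, Complex.ofReal_exp,
      Complex.cpow_def_of_ne_zero (Complex.exp_ne_zero _),
      Complex.cpow_def_of_ne_zero (Complex.exp_ne_zero _), ← Complex.ofReal_exp,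
      ← Complex.ofReal_exp, ← Complex.ofReal_log (Real.exp_pos _).le, Real.log_exp,
      ← Complex.ofReal_log (Real.exp_pos _).le, Real.log_exp, ← Complex.exp_add, ← Complex.exp_add]
    congr 1
    push_cast
    ring
  simp only [h2] at h1
  rw [h1, Complex.betaIntegral_eq_Gamma_mul_div _ _ (by simp) (by simp)]
  have e : (1 / 2 - Complex.I * ξ : ℂ) = 1 - (1 / 2 + Complex.I * ξ) := by ring
  rw [e, Complex.Gamma_mul_Gamma_one_sub]
  rw [show (1 / 2 + Complex.I * ξ + (1 - (1 / 2 + Complex.I * ξ)) : ℂ) = 1 by ring,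
    Complex.Gamma_one, div_one, sechSymbol]
  push_cast
  congr 1
  rw [show (Real.pi * (1 / 2 + Complex.I * ξ) : ℂ) = (Real.pi * ξ) * Complex.I + Real.pi / 2 by ring,
    Complex.sin_add_pi_div_two, Complex.cos_mul_I]

theorem integral_sechKernel_rpow {p : ℝ} (hp : 0 < p) :
    ∫ z : ℝ, sechKernel z ^ p = Real.Gamma (p / 2) * Real.Gamma (p / 2) / Real.Gamma p := by
  have h1 := integral_sigmoid_cpow (p / 2 : ℝ) (p / 2 : ℝ)
  have h2 : ∀ z : ℝ, ((Real.sigmoid z : ℝ) : ℂ) ^ ((p / 2 : ℝ) : ℂ) *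
      ((1 - Real.sigmoid z : ℝ) : ℂ) ^ ((p / 2 : ℝ) : ℂ) = ((sechKernel z ^ p : ℝ) : ℂ) := fun z => by
    have k0 := sechKernel_pos z
    rw [← Complex.ofReal_cpow (Real.sigmoid_nonneg z),
      ← Complex.ofReal_cpow (sub_pos.2 (Real.sigmoid_lt_one z)).le, ← Complex.ofReal_mul,
      one_sub_sigmoid_eq, sigmoid_eq_exp_mul_sechKernel,
      ← Real.mul_rpow (by positivity) (by positivity)]
    have : Real.exp (z / 2) * Real.exp (-z / 2) = 1 := by rw [← Real.exp_add]; ring_nf; simp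
    rw [show Real.exp (z / 2) * sechKernel z * (Real.exp (-z / 2) * sechKernel z) = sechKernel z ^ 2 by
      linear_combination (sechKernel z ^ 2) * this, ← Real.rpow_natCast, ← Real.rpow_mul k0.le]
    congr 2
    push_cast; ring
  simp only [h2] at h1
  rw [integral_complex_ofReal, Complex.betaIntegral_eq_Gamma_mul_div _ _
    (by simpa using hp) (by simpa using hp), ← Complex.ofReal_add, Complex.Gamma_ofReal,
    Complex.Gamma_ofReal, add_halves] at h1
  exact_mod_cast h1

theorem sechSymbol_eq (ξ : ℝ) : sechSymbol ξ = 2 * Real.pi * sechKernel (2 * Real.pi * ξ) := by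
  rw [sechSymbol, sechKernel, show 2 * Real.pi * ξ / 2 = Real.pi * ξ by ring, mul_inv]
  field_simp

theorem sechSymbol_pos (ξ : ℝ) : 0 < sechSymbol ξ := div_pos Real.pi_pos (Real.cosh_pos _)

theorem continuous_sechSymbol : Continuous sechSymbol := by
  have : sechSymbol = fun ξ => 2 * Real.pi * sechKernel (2 * Real.pi * ξ) := funext sechSymbol_eq
  rw [this]
  exact continuous_const.mul (continuous_sechKernel.comp (continuous_const.mul continuous_id))

theorem sechSymbol_abs (ξ : ℝ) : sechSymbol |ξ| = sechSymbol ξ := by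
  rw [sechSymbol, sechSymbol, ← Real.cosh_abs (Real.pi * ξ), abs_mul, abs_of_pos Real.pi_pos]

theorem sechSymbol_zero : sechSymbol 0 = Real.pi := by simp [sechSymbol]

theorem antitoneOn_sechSymbol : AntitoneOn sechSymbol (Ici 0) := by
  intro x hx y hy hxy
  refine div_le_div_of_nonneg_left Real.pi_pos.le (Real.cosh_pos _) (Real.cosh_le_cosh.2 ?_)
  rw [abs_of_nonneg (mul_nonneg Real.pi_pos.le hx), abs_of_nonneg (mul_nonneg Real.pi_pos.le hy)]
  exact mul_le_mul_of_nonneg_left hxy Real.pi_pos.le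

theorem integrable_sechKernel_rpow {p : ℝ} (hp : 0 < p) : Integrable fun z => sechKernel z ^ p := by
  refine (integrable_exp_neg_mul_abs (half_pos hp)).mono'
    (continuous_sechKernel.rpow_const fun z => Or.inl (sechKernel_pos z).ne').aestronglyMeasurable
    (Eventually.of_forall fun z => ?_)
  rw [Real.norm_of_nonneg (Real.rpow_nonneg (sechKernel_pos z).le _)]
  refine (Real.rpow_le_rpow (sechKernel_pos z).le (sechKernel_le_exp z) hp.le).trans ?_
  rw [← Real.exp_mul]
  exact Real.exp_le_exp.2 (le_of_eq (by ring))

theorem sechSymbol_rpow (p ξ : ℝ) :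
    sechSymbol ξ ^ p = (2 * Real.pi) ^ p * sechKernel (2 * Real.pi * ξ) ^ p := by
  rw [sechSymbol_eq, Real.mul_rpow (by positivity) (sechKernel_pos _).le]

theorem integrable_sechSymbol_rpow {p : ℝ} (hp : 0 < p) : Integrable fun z => sechSymbol z ^ p := by
  simp only [sechSymbol_rpow]
  exact ((integrable_sechKernel_rpow hp).comp_mul_left' (by positivity)).const_mul _

theorem tauC_eq {α : ℝ} (hα : 0 < α) :
    tauC α = ((2 * Real.pi)⁻¹ * ∫ ξ, sechSymbol ξ ^ (1 / α)) ^ α := by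
  have hp : 0 < 1 / α := by positivity
  set p := 1 / α with hpd
  have hpi := Real.pi_pos
  have h0 : ∫ ξ, sechSymbol ξ ^ p =
      (2 * Real.pi) ^ p * ((2 * Real.pi)⁻¹ * (Real.Gamma (p / 2) * Real.Gamma (p / 2) / Real.Gamma p)) := by
    simp only [sechSymbol_rpow]
    rw [integral_const_mul, Measure.integral_comp_mul_left (fun z => sechKernel z ^ p),
      integral_sechKernel_rpow hp, abs_of_pos (by positivity), smul_eq_mul]
  have h1 := Real.Gamma_mul_Gamma_add_half (p / 2)
  rw [show 2 * (p / 2) = p by ring] at h1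
  have g1 : 0 < Real.Gamma (p / 2) := Real.Gamma_pos_of_pos (by positivity)
  have g2 : 0 < Real.Gamma (p / 2 + 1 / 2) := Real.Gamma_pos_of_pos (by positivity)
  have g3 : 0 < Real.Gamma p := Real.Gamma_pos_of_pos (by positivity)
  have h2 : (2 * Real.pi)⁻¹ * ∫ ξ, sechSymbol ξ ^ p =
      2⁻¹ * Real.pi ^ (p - 2) *
        (Real.Gamma (p / 2) * Real.Gamma (1 / 2) / Real.Gamma (p / 2 + 1 / 2)) := by
    rw [h0, Real.Gamma_one_half_eq, Real.mul_rpow two_pos.le hpi.le, Real.rpow_sub hpi,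
      Real.rpow_two]
    rw [Real.rpow_sub two_pos, Real.rpow_one] at h1
    have : (0 : ℝ) < 2 ^ p := by positivity
    have : (0 : ℝ) < Real.pi ^ p := by positivity
    field_simp at h1 ⊢
    linear_combination h1
  rw [h2, tauC, Real.mul_rpow (by positivity) (by positivity), Real.mul_rpow (by positivity)
    (by positivity), Real.inv_rpow two_pos.le, Real.rpow_neg two_pos.le, ← Real.rpow_mul hpi.le]
  have e1 : (p - 2) * α = 1 - 2 * α := by rw [hpd]; field_simp
  have e2 : p / 2 = 1 / (2 * α) := by rw [hpd]; field_simp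
  rw [e1, e2]

theorem sum_Icc_neg_eq {g : ℝ → ℝ} (hg : ∀ x, g (-x) = g x) (m : ℕ) :
    ∑ k ∈ Finset.Icc (-(m : ℤ)) m, g k = g 0 + 2 * ∑ i ∈ Finset.range m, g (i + 1) := by
  induction m with
  | zero => simp
  | succ m ih =>
    have : Finset.Icc (-((m + 1 : ℕ) : ℤ)) ((m + 1 : ℕ) : ℤ) =
        insert (-((m + 1 : ℕ) : ℤ)) (insert ((m + 1 : ℕ) : ℤ) (Finset.Icc (-(m : ℤ)) m)) := by
      ext k; simp only [Finset.mem_Icc, Finset.mem_insert]; omega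
    rw [this, Finset.sum_insert (by simp; omega), Finset.sum_insert (by simp), ih,
      Finset.sum_range_succ]
    push_cast
    have := hg (m + 1)
    rw [this]
    ring

theorem sum_Icc_neg_bounds {g : ℝ → ℝ} (hg : ∀ x, g (-x) = g x) (hg0 : ∀ x, 0 ≤ g x)
    (ha : AntitoneOn g (Ici 0)) {d : ℝ} (hd : 0 < d) (m : ℕ) :
    2 * (∫ x in (0 : ℝ)..m * d, g x) - d * g 0 ≤ d * ∑ k ∈ Finset.Icc (-(m : ℤ)) m, g (k * d) ∧
    d * ∑ k ∈ Finset.Icc (-(m : ℤ)) m, g (k * d) ≤ 2 * (∫ x in (0 : ℝ)..m * d, g x) + d * g 0 := by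
  have hga : AntitoneOn (fun x => g (x * d)) (Icc (0 : ℝ) (0 + (m : ℝ))) := by
    intro x hx y hy hxy
    exact ha (mul_nonneg hx.1 hd.le) (mul_nonneg hy.1 hd.le) (mul_le_mul_of_nonneg_right hxy hd.le)
  have h1 := hga.integral_le_sum
  have h2 := hga.sum_le_integral
  have h3 : ∫ x in (0 : ℝ)..0 + m, g (x * d) = d⁻¹ * ∫ x in (0 : ℝ)..m * d, g x := by
    rw [intervalIntegral.integral_comp_mul_right _ hd.ne']; simp
  have h4 := sum_Icc_neg_eq (g := fun x => g (x * d)) (fun x => by rw [neg_mul, hg]) m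
  have h5 := Finset.sum_range_succ' (fun i : ℕ => g ((i : ℝ) * d)) m
  rw [Finset.sum_range_succ] at h5
  simp only [zero_add, Nat.cast_add, Nat.cast_one, Nat.cast_zero, zero_mul] at h1 h2 h4 h5
  have h6 := hg0 (m * d)
  rw [zero_add] at h3
  have h7 : d * (d⁻¹ * ∫ x in (0 : ℝ)..m * d, g x) = ∫ x in (0 : ℝ)..m * d, g x := by
    field_simp
  rw [← h3] at h7
  rw [h4, ← h7]
  have h1' := mul_le_mul_of_nonneg_left h1 hd.le
  have h2' := mul_le_mul_of_nonneg_left h2 hd.le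
  have h6' := mul_nonneg hd.le h6
  have h5' := congrArg (d * ·) h5
  simp only [mul_add] at h1' h2' h5' ⊢
  constructor <;> linarith

theorem integral_sechSymbol (X : ℝ) :
    ∫ x in (0 : ℝ)..X, sechSymbol x = Real.arctan (Real.sinh (Real.pi * X)) := by
  rw [intervalIntegral.integral_eq_sub_of_hasDerivAt
    (f := fun x => Real.arctan (Real.sinh (Real.pi * x))) (fun x _ => ?_)
    (continuous_sechSymbol.intervalIntegrable _ _)]
  · simp
  · have := (((hasDerivAt_id x).const_mul Real.pi).sinh).arctan
    convert! this using 1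
    have h := Real.cosh_sq (Real.pi * x)
    have := Real.cosh_pos (Real.pi * x)
    simp only [id, sechSymbol]
    rw [show 1 + Real.sinh (Real.pi * x) ^ 2 = Real.cosh (Real.pi * x) ^ 2 by rw [h]; ring]
    field_simp

theorem integral_sechSymbol_sq (X : ℝ) :
    ∫ x in (0 : ℝ)..X, sechSymbol x ^ 2 = Real.pi * (Real.sinh (Real.pi * X) / Real.cosh (Real.pi * X)) := by
  rw [intervalIntegral.integral_eq_sub_of_hasDerivAt (f' := fun x => sechSymbol x ^ 2)
    (f := fun x => Real.pi * (Real.sinh (Real.pi * x) / Real.cosh (Real.pi * x))) (fun x _ => ?_)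
    ((continuous_sechSymbol.pow 2).intervalIntegrable _ _)]
  · simp
  · have h1 := ((hasDerivAt_id x).const_mul Real.pi)
    have := (h1.sinh.div h1.cosh (Real.cosh_pos _).ne').const_mul Real.pi
    convert! this using 1
    have h := Real.cosh_sq (Real.pi * x)
    have := Real.cosh_pos (Real.pi * x)
    simp only [id, sechSymbol]
    field_simp
    linear_combination -h

/-- The sums of the symbol over the lattice with spacing `2π / L²`. -/
theorem sum_sechSymbol_bounds {L : ℕ} (hL : 1 ≤ L) :
    (∑ k ∈ Finset.Icc (-((L ^ 3 : ℕ) : ℤ)) (L ^ 3 : ℕ), sechSymbol (k * (2 * Real.pi / (L : ℝ) ^ 2))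
      ≤ (L : ℝ) ^ 2 / 2 + 4) ∧
    ((L : ℝ) ^ 2 / 2 - 6 * L ≤
      ∑ k ∈ Finset.Icc (-((L ^ 3 : ℕ) : ℤ)) (L ^ 3 : ℕ), sechSymbol (k * (2 * Real.pi / (L : ℝ) ^ 2))) ∧
    ((L : ℝ) ^ 2 - 11 * L ≤ ∑ k ∈ Finset.Icc (-((L ^ 3 : ℕ) : ℤ)) (L ^ 3 : ℕ),
      sechSymbol (k * (2 * Real.pi / (L : ℝ) ^ 2)) ^ 2) := by
  have hL1 : (1 : ℝ) ≤ L := by exact_mod_cast hL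
  have hpi := Real.pi_pos
  have hpi3 := Real.pi_gt_three
  have hpi4 : Real.pi < 3.15 := Real.pi_lt_d2
  have hneg : ∀ x, sechSymbol (-x) = sechSymbol x := fun x => by
    rw [← sechSymbol_abs, abs_neg, sechSymbol_abs]
  set d : ℝ := 2 * Real.pi / (L : ℝ) ^ 2 with hd
  have hd0 : 0 < d := by positivity
  have hX : ((L ^ 3 : ℕ) : ℝ) * d = 2 * Real.pi * L := by
    rw [hd]; push_cast; field_simp
  have hdM : d * (L : ℝ) ^ 2 = 2 * Real.pi := by rw [hd]; field_simp
  obtain ⟨a1, a2⟩ := sum_Icc_neg_bounds hneg (fun x => (sechSymbol_pos x).le)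
    antitoneOn_sechSymbol hd0 (L ^ 3)
  obtain ⟨b1, -⟩ := sum_Icc_neg_bounds (g := fun x => sechSymbol x ^ 2)
    (fun x => by simp only [hneg]) (fun x => sq_nonneg _)
    (fun x hx y hy hxy => pow_le_pow_left₀ (sechSymbol_pos _).le
      (antitoneOn_sechSymbol hx hy hxy) 2) hd0 (L ^ 3)
  rw [integral_sechSymbol, sechSymbol_zero, hX] at a1 a2
  rw [integral_sechSymbol_sq, sechSymbol_zero, hX] at b1
  set Y := Real.pi * (2 * Real.pi * L) with hY
  have hYL : 18 * (L : ℝ) ≤ Y := by 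
    have : 9 < Real.pi ^ 2 := by nlinarith
    rw [hY]; nlinarith
  have hYpos : 0 < Y := by linarith
  have hsY : Y ≤ Real.sinh Y := Real.self_le_sinh_iff.2 hYpos.le
  have hs0 : 0 < Real.sinh Y := hYpos.trans_le hsY
  have hc0 := Real.cosh_pos Y
  have hM : (0 : ℝ) < (L : ℝ) ^ 2 := by positivity
  set S1 := ∑ k ∈ Finset.Icc (-((L ^ 3 : ℕ) : ℤ)) (L ^ 3 : ℕ), sechSymbol (k * d)
  set S2 := ∑ k ∈ Finset.Icc (-((L ^ 3 : ℕ) : ℤ)) (L ^ 3 : ℕ), sechSymbol (k * d) ^ 2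
  have key : ∀ a b : ℝ, d * a ≤ d * b → a ≤ b := fun a b h => le_of_mul_le_mul_left h hd0
  have harc : Real.pi / 2 - (Real.sinh Y)⁻¹ ≤ Real.arctan (Real.sinh Y) := by
    have h1 := Real.arctan_inv_of_pos hs0
    have h2 : Real.arctan (Real.sinh Y)⁻¹ ≤ (Real.sinh Y)⁻¹ := by
      have h3 : 0 < Real.arctan (Real.sinh Y)⁻¹ := Real.arctan_pos.2 (inv_pos.2 hs0)
      simpa [Real.tan_arctan] using (Real.lt_tan h3 (Real.arctan_lt_pi_div_two _)).le
    linarith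
  have hinv : (Real.sinh Y)⁻¹ ≤ (18 * (L : ℝ))⁻¹ := inv_anti₀ (by positivity) (hYL.trans hsY)
  have hdL : (18 * (L : ℝ))⁻¹ ≤ d * L := by
    rw [hd, inv_eq_one_div, div_le_iff₀ (by positivity)]
    field_simp
    nlinarith
  refine ⟨key _ _ ?_, key _ _ ?_, key _ _ ?_⟩
  · have := Real.arctan_lt_pi_div_two (Real.sinh Y)
    nlinarith
  · have : d * 1 ≤ d * L := mul_le_mul_of_nonneg_left hL1 hd0.le
    have : d * ((L : ℝ) ^ 2 / 2 - 6 * L) = Real.pi - 6 * (d * L) := by linear_combination hdM / 2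
    rw [this]
    have : d * Real.pi ≤ 3.15 * (d * L) := by nlinarith
    linarith
  · have hth : 1 - (18 * (L : ℝ))⁻¹ ≤ Real.sinh Y / Real.cosh Y := by
      rw [le_div_iff₀ hc0]
      have e : Real.cosh Y - Real.sinh Y = Real.exp (-Y) := Real.cosh_sub_sinh Y
      have e2 : Real.exp (-Y) ≤ 1 := Real.exp_le_one_iff.2 (by linarith)
      have e3 : (18 * (L : ℝ))⁻¹ * Real.cosh Y ≥ 1 := by
        rw [ge_iff_le, ← div_eq_inv_mul, one_le_div (by positivity)]
        exact (hYL.trans hsY).trans (Real.sinh_lt_cosh Y).le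
      nlinarith
    have h1 : 2 * (Real.pi * (1 - (18 * (L : ℝ))⁻¹)) ≤
        2 * (Real.pi * (Real.sinh Y / Real.cosh Y)) := by gcongr
    have h2 : d * 1 ≤ d * L := mul_le_mul_of_nonneg_left hL1 hd0.le
    have h3 : d * ((L : ℝ) ^ 2 - 11 * L) = 2 * Real.pi - 11 * (d * L) := by linear_combination hdM
    rw [h3]
    have h4 : Real.pi ^ 2 ≤ 9.95 := by nlinarith
    have h5 : d * Real.pi ^ 2 ≤ 9.95 * (d * L) := by nlinarith
    have h6 : 2 * Real.pi * (18 * (L : ℝ))⁻¹ ≤ d * L := by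
      rw [hd]; field_simp; nlinarith
    have h7 : 0 < d * L := by positivity
    linarith

section FourierBlocks

/-- The character `x ↦ exp (2π i m x / M)`. -/
def expChar (M : ℝ) (m : ℤ) (x : ℝ) : ℂ := Complex.exp ((2 * Real.pi * m / M * x : ℝ) * Complex.I)

theorem continuous_expChar (M : ℝ) (m : ℤ) : Continuous (expChar M m) := by
  unfold expChar; fun_prop

theorem norm_expChar (M : ℝ) (m : ℤ) (x : ℝ) : ‖expChar M m x‖ = 1 :=
  Complex.norm_exp_ofReal_mul_I _

theorem expChar_mul (M : ℝ) (m m' : ℤ) (x : ℝ) :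
    expChar M m x * expChar M m' x = expChar M (m + m') x := by
  rw [expChar, expChar, expChar, ← Complex.exp_add]
  congr 1; push_cast; ring

theorem conj_expChar (M : ℝ) (m : ℤ) (x : ℝ) :
    (starRingEnd ℂ) (expChar M m x) = expChar M (-m) x := by
  rw [expChar, expChar, ← Complex.exp_conj, map_mul, Complex.conj_ofReal, Complex.conj_I]
  congr 1; push_cast; ring

theorem integral_expChar {M : ℝ} (hM : 0 < M) (a : ℝ) (m : ℤ) :
    ∫ x in a..a + M, expChar M m x = if m = 0 then (M : ℂ) else 0 := by
  split_ifs with h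
  · simp [expChar, h]
  · have h1 : ∀ x, expChar M m x = Complex.exp ((2 * Real.pi * m / M : ℝ) * Complex.I * x) := by
      intro x; rw [expChar]; congr 1; push_cast; ring
    have h2 : ((2 * Real.pi * m / M : ℝ) * Complex.I : ℂ) ≠ 0 := by
      refine mul_ne_zero (Complex.ofReal_ne_zero.2 ?_) Complex.I_ne_zero
      have : (m : ℝ) ≠ 0 := by exact_mod_cast h
      have := Real.pi_pos
      positivity
    simp only [h1]
    rw [integral_exp_mul_complex h2, div_eq_zero_iff]
    left
    rw [sub_eq_zero]
    rw [show ((2 * Real.pi * m / M : ℝ) * Complex.I * (a + M : ℝ) : ℂ) =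
      (2 * Real.pi * m / M : ℝ) * Complex.I * a + m * (2 * Real.pi * Complex.I) by
        push_cast
        have : (M : ℂ) ≠ 0 := by exact_mod_cast hM.ne'
        field_simp]
    rw [Complex.exp_add, Complex.exp_int_mul_two_pi_mul_I, mul_one]

variable {E : Type*} [NormedAddCommGroup E] [InnerProductSpace ℂ E]

/-- The normalized Fourier coefficients of a vector valued function on `[a, a + M]`. -/
def fourierVec (M a : ℝ) (h : ℝ → E) (m : ℤ) : E :=
  (((√M)⁻¹ : ℝ) : ℂ) • ∫ x in a..a + M, expChar M m x • h x

/-- The truncated Fourier series of a vector valued function on `[a, a + M]`. -/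
def fourierSum (M a : ℝ) (h : ℝ → E) (T : Finset ℤ) (x : ℝ) : E :=
  ∑ m ∈ T, ((((√M)⁻¹ : ℝ) : ℂ) * expChar M (-m) x) • fourierVec M a h m

theorem continuous_fourierSum (M a : ℝ) (h : ℝ → E) (T : Finset ℤ) :
    Continuous (fourierSum M a h T) := by
  unfold fourierSum
  exact continuous_finsetSum _ fun m _ =>
    (continuous_const.mul (continuous_expChar M _)).smul continuous_const

variable [CompleteSpace E]

theorem inner_fourierVec {M : ℝ} (a : ℝ) {h : ℝ → E} (hc : Continuous h) (m : ℤ) (f : E) :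
    inner ℂ f (fourierVec M a h m) = fourierVec M a (fun x => inner ℂ f (h x)) m := by
  have := (innerSL ℂ f).intervalIntegral_comp_comm (μ := volume) (a := a) (b := a + M)
    (f := fun x => expChar M m x • h x)
    (((continuous_expChar M m).smul hc).intervalIntegrable _ _)
  simp only [innerSL_apply_apply, inner_smul_right] at this
  rw [fourierVec, fourierVec, inner_smul_right, ← this]
  rfl

theorem integral_norm_sub_fourierSum {M : ℝ} (hM : 0 < M) (a : ℝ) {h : ℝ → E} (hc : Continuous h)
    (T : Finset ℤ) :
    ∫ x in a..a + M, ‖h x - fourierSum M a h T x‖ ^ 2 =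
      (∫ x in a..a + M, ‖h x‖ ^ 2) - ∑ m ∈ T, ‖fourierVec M a h m‖ ^ 2 := by
  set s : ℂ := (((√M)⁻¹ : ℝ) : ℂ) with hs
  have hss : s * s * M = 1 := by
    rw [hs, ← Complex.ofReal_mul, ← Complex.ofReal_mul, ← mul_inv, Real.mul_self_sqrt hM.le,
      inv_mul_cancel₀ hM.ne', Complex.ofReal_one]
  have hsc : (starRingEnd ℂ) s = s := Complex.conj_ofReal _
  have hp := continuous_fourierSum M a h T
  have e1 : ∫ x in a..a + M, inner ℂ (fourierSum M a h T x) (h x) =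
      ((∑ m ∈ T, ‖fourierVec M a h m‖ ^ 2 : ℝ) : ℂ) := by
    have : ∀ x, inner ℂ (fourierSum M a h T x) (h x) =
        ∑ m ∈ T, s * (expChar M m x * inner ℂ (fourierVec M a h m) (h x)) := fun x => by
      rw [fourierSum, sum_inner]
      refine Finset.sum_congr rfl fun m _ => ?_
      rw [inner_smul_left, map_mul, hsc, conj_expChar, neg_neg, mul_assoc]
    simp only [this]
    rw [intervalIntegral.integral_finsetSum, Complex.ofReal_sum]
    · refine Finset.sum_congr rfl fun m _ => ?_
      rw [intervalIntegral.integral_const_mul]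
      have h2 := inner_fourierVec (M := M) a hc m (fourierVec M a h m)
      rw [inner_self_eq_norm_sq_to_K] at h2
      simp only [Complex.coe_algebraMap] at h2
      rw [Complex.ofReal_pow, h2]
      rfl
    · intro m _
      exact (continuous_const.mul ((continuous_expChar M m).mul
        (continuous_const.inner hc))).intervalIntegrable _ _
  have e2 : ∫ x in a..a + M, inner ℂ (fourierSum M a h T x) (fourierSum M a h T x) =
      ((∑ m ∈ T, ‖fourierVec M a h m‖ ^ 2 : ℝ) : ℂ) := by
    have : ∀ x, inner ℂ (fourierSum M a h T x) (fourierSum M a h T x) =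
        ∑ m ∈ T, ∑ m' ∈ T, (s * s * inner ℂ (fourierVec M a h m) (fourierVec M a h m')) *
          expChar M (m - m') x := fun x => by
      rw [fourierSum, sum_inner]
      refine Finset.sum_congr rfl fun m _ => ?_
      rw [inner_sum]
      refine Finset.sum_congr rfl fun m' _ => ?_
      rw [inner_smul_left, inner_smul_right, map_mul, hsc, conj_expChar, neg_neg, sub_eq_add_neg,
        ← expChar_mul]
      ring
    simp only [this]
    rw [intervalIntegral.integral_finsetSum, Complex.ofReal_sum]
    · refine Finset.sum_congr rfl fun m hm => ?_
      rw [intervalIntegral.integral_finsetSum, Finset.sum_eq_single m]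
      · rw [intervalIntegral.integral_const_mul, integral_expChar hM, sub_self, if_pos rfl,
          inner_self_eq_norm_sq_to_K]
        simp only [Complex.coe_algebraMap, Complex.ofReal_pow]
        linear_combination ((‖fourierVec M a h m‖ : ℂ) ^ 2) * hss
      · intro m' _ hne
        rw [intervalIntegral.integral_const_mul, integral_expChar hM,
          if_neg (sub_ne_zero.2 hne.symm), mul_zero]
      · exact fun h => absurd hm h
      · intro m' _
        exact (continuous_const.mul (continuous_expChar M _)).intervalIntegrable _ _
    · intro m _
      exact (continuous_finsetSum _ fun m' _ => continuous_const.mul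
        (continuous_expChar M _)).intervalIntegrable _ _
  have r1 := congrArg Complex.re e1
  have r2 := congrArg Complex.re e2
  have hre : ∀ F : ℝ → ℂ, Continuous F →
      (∫ x in a..a + M, F x).re = ∫ x in a..a + M, (F x).re := fun F hF =>
    (Complex.reCLM.intervalIntegral_comp_comm (hF.intervalIntegrable _ _)).symm
  rw [hre _ (hp.inner hc), Complex.ofReal_re] at r1
  rw [hre _ (hp.inner hp), Complex.ofReal_re] at r2
  have h3 : ∀ x, ‖h x - fourierSum M a h T x‖ ^ 2 = ‖h x‖ ^ 2
      - 2 * (inner ℂ (fourierSum M a h T x) (h x)).re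
      + (inner ℂ (fourierSum M a h T x) (fourierSum M a h T x)).re := fun x => by
    rw [@norm_sub_sq ℂ, inner_self_eq_norm_sq_to_K]
    simp only [Complex.coe_algebraMap]
    rw [← Complex.ofReal_pow, Complex.ofReal_re, ← inner_conj_symm (h x), RCLike.conj_re]
    rfl
  simp only [h3]
  rw [intervalIntegral.integral_add, intervalIntegral.integral_sub,
    intervalIntegral.integral_const_mul, r1, r2]
  · ring
  · exact (hc.norm.pow 2).intervalIntegrable _ _
  · exact (continuous_const.mul (Complex.continuous_re.comp (hp.inner hc))).intervalIntegrable _ _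
  · exact ((hc.norm.pow 2).sub
      (continuous_const.mul (Complex.continuous_re.comp (hp.inner hc)))).intervalIntegrable _ _
  · exact (Complex.continuous_re.comp (hp.inner hp)).intervalIntegrable _ _

/-- Bessel's inequality for vector valued Fourier coefficients. -/
theorem sum_norm_inner_fourierVec_le {M : ℝ} (hM : 0 < M) (a : ℝ) {h : ℝ → E} (hc : Continuous h)
    (T : Finset ℤ) (f : E) :
    ∑ m ∈ T, ‖(inner ℂ f (fourierVec M a h m) : ℂ)‖ ^ 2 ≤
      ∫ x in a..a + M, ‖(inner ℂ f (h x) : ℂ)‖ ^ 2 := by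
  simp only [inner_fourierVec a hc]
  have h1 := integral_norm_sub_fourierSum hM a (h := fun x => (inner ℂ f (h x) : ℂ))
    (continuous_const.inner hc) T
  have h2 : 0 ≤ ∫ x in a..a + M, ‖(inner ℂ f (h x) : ℂ) -
      fourierSum M a (fun x => (inner ℂ f (h x) : ℂ)) T x‖ ^ 2 :=
    intervalIntegral.integral_nonneg (by linarith) fun x _ => sq_nonneg _
  linarith

/-- The trace of the Fourier remainder on a block. -/
theorem sum_orthonormal_remainder_le {M : ℝ} (hM : 0 < M) (a : ℝ) {h : ℝ → E} (hc : Continuous h)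
    (T : Finset ℤ) {n : ℕ} (e : Fin n → E) (he : Orthonormal ℂ e) :
    ∑ i, ((∫ x in a..a + M, ‖(inner ℂ (e i) (h x) : ℂ)‖ ^ 2) -
      ∑ m ∈ T, ‖(inner ℂ (e i) (fourierVec M a h m) : ℂ)‖ ^ 2) ≤
      (∫ x in a..a + M, ‖h x‖ ^ 2) - ∑ m ∈ T, ‖fourierVec M a h m‖ ^ 2 := by
  rw [← integral_norm_sub_fourierSum hM a hc T]
  have hp := continuous_fourierSum M a h T
  have h1 : ∀ f : E, (∫ x in a..a + M, ‖(inner ℂ f (h x) : ℂ)‖ ^ 2) -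
      ∑ m ∈ T, ‖(inner ℂ f (fourierVec M a h m) : ℂ)‖ ^ 2 =
      ∫ x in a..a + M, ‖(inner ℂ f (h x - fourierSum M a h T x) : ℂ)‖ ^ 2 := fun f => by
    simp only [inner_fourierVec a hc]
    rw [← integral_norm_sub_fourierSum hM a (h := fun x => (inner ℂ f (h x) : ℂ))
      (continuous_const.inner hc) T]
    refine intervalIntegral.integral_congr fun x _ => ?_
    simp only [inner_sub_right, fourierSum, inner_sum, inner_smul_right, inner_fourierVec a hc,
      smul_eq_mul]
  simp only [h1]
  rw [← intervalIntegral.integral_finsetSum]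
  · refine intervalIntegral.integral_mono_on (by linarith) ?_ ?_ fun x _ => ?_
    · exact (continuous_finsetSum _ fun i _ =>
        ((continuous_const.inner (hc.sub hp)).norm.pow 2)).intervalIntegrable _ _
    · exact ((hc.sub hp).norm.pow 2).intervalIntegrable _ _
    · exact he.sum_inner_products_le _
  · intro i _
    exact ((continuous_const.inner (hc.sub hp)).norm.pow 2).intervalIntegrable _ _

end FourierBlocks

theorem norm_integral_interval_sub_sechSymbol_le {M : ℝ} (a : ℝ) (m : ℤ) {x : ℝ}
    (hx : x ∈ Icc a (a + M)) :
    ‖(∫ y in a..a + M, expChar M m (y - x) * (sechKernel (x - y) : ℂ)) -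
      sechSymbol (2 * Real.pi * m / M)‖ ≤
      2 * Real.exp ((a - x) / 2) + 2 * Real.exp ((x - (a + M)) / 2) := by
  set F : ℝ → ℂ := fun y => expChar M m (y - x) * (sechKernel (x - y) : ℂ) with hF
  have hFc : Continuous F := ((continuous_expChar M m).comp (continuous_id.sub continuous_const)).mul
    (Complex.continuous_ofReal.comp (continuous_sechKernel.comp (continuous_const.sub continuous_id)))
  have hFn : ∀ y, ‖F y‖ = sechKernel (x - y) := fun y => by
    rw [hF]; simp only [norm_mul, norm_expChar, one_mul, Complex.norm_real,
      Real.norm_of_nonneg (sechKernel_pos _).le]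
  have hFi : Integrable F := by
    refine (integrable_sechKernel.comp_sub_left x).mono' hFc.aestronglyMeasurable
      (Eventually.of_forall fun y => (hFn y).le)
  have htot : ∫ y, F y = sechSymbol (2 * Real.pi * m / M) := by
    rw [← integral_exp_mul_sechKernel, ← integral_sub_right_eq_self
      (fun z : ℝ => Complex.exp (Complex.I * (2 * Real.pi * m / M * z : ℝ)) * (sechKernel z : ℂ)) x]
    refine integral_congr_ae (Eventually.of_forall fun y => ?_)
    simp only [hF, expChar]
    rw [← sechKernel_neg, neg_sub, mul_comm Complex.I]
  have h1 := intervalIntegral.integral_Iic_sub_Iic (a := a) (b := a + M) hFi.integrableOn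
    hFi.integrableOn
  have h2 := intervalIntegral.integral_Iic_add_Ioi (b := a + M) hFi.integrableOn hFi.integrableOn
  have h3 : (∫ y in a..a + M, F y) - sechSymbol (2 * Real.pi * m / M) =
      -(∫ y in Iic a, F y) - ∫ y in Ioi (a + M), F y := by
    rw [← htot, ← h1, ← h2]; ring
  rw [h3]
  have h4 : ‖∫ y in Iic a, F y‖ ≤ 2 * Real.exp ((a - x) / 2) := by
    have hi : IntegrableOn (fun y => Real.exp (-(x / 2)) * Real.exp (1 / 2 * y)) (Iic a) :=
      (integrableOn_exp_mul_Iic one_half_pos a).const_mul _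
    refine (norm_integral_le_of_norm_le hi ((ae_restrict_iff' measurableSet_Iic).2
      (Eventually.of_forall fun y hy => ?_))).trans (le_of_eq ?_)
    · rw [hFn, ← Real.exp_add]
      refine (sechKernel_le_exp _).trans (Real.exp_le_exp.2 (le_of_eq ?_))
      rw [abs_of_nonneg (by linarith [hx.1, hy.out])]; ring
    · rw [integral_const_mul, integral_exp_mul_Iic one_half_pos, sub_div, sub_eq_add_neg,
        Real.exp_add]
      ring_nf
  have h5 : ‖∫ y in Ioi (a + M), F y‖ ≤ 2 * Real.exp ((x - (a + M)) / 2) := by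
    have hi : IntegrableOn (fun y => Real.exp (x / 2) * Real.exp (-(1 / 2) * y)) (Ioi (a + M)) :=
      (integrableOn_exp_mul_Ioi (by norm_num) _).const_mul _
    refine (norm_integral_le_of_norm_le hi ((ae_restrict_iff' measurableSet_Ioi).2
      (Eventually.of_forall fun y hy => ?_))).trans (le_of_eq ?_)
    · rw [hFn, ← Real.exp_add]
      refine (sechKernel_le_exp _).trans (Real.exp_le_exp.2 (le_of_eq ?_))
      rw [abs_of_nonpos (by linarith [hx.2, hy.out])]; ring
    · rw [integral_const_mul, integral_exp_mul_Ioi (by norm_num), sub_div, sub_eq_add_neg (x / 2),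
        Real.exp_add]
      ring_nf
  calc _ ≤ ‖-(∫ y in Iic a, F y)‖ + ‖∫ y in Ioi (a + M), F y‖ := norm_sub_le _ _
    _ ≤ _ := by rw [norm_neg]; exact add_le_add h4 h5

section SechGram

variable {E : Type*} [NormedAddCommGroup E] [InnerProductSpace ℂ E]

theorem norm_sq_of_inner_eq_sechKernel {φ : ℝ → E}
    (hG : ∀ x y, inner ℂ (φ x) (φ y) = (sechKernel (x - y) : ℂ)) (x : ℝ) : ‖φ x‖ ^ 2 = 1 / 2 := by
  have := hG x x
  rw [inner_self_eq_norm_sq_to_K] at this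
  simp only [Complex.coe_algebraMap] at this
  rw [← Complex.ofReal_pow] at this
  rw [Complex.ofReal_inj.1 this]
  simp [sechKernel]

theorem continuous_of_inner_eq_sechKernel {φ : ℝ → E}
    (hG : ∀ x y, inner ℂ (φ x) (φ y) = (sechKernel (x - y) : ℂ)) : Continuous φ := by
  rw [continuous_iff_continuousAt]
  intro x
  rw [ContinuousAt, tendsto_iff_norm_sub_tendsto_zero]
  have h1 : ∀ y, ‖φ y - φ x‖ = √(1 - 2 * sechKernel (y - x)) := fun y => by
    have h := @norm_sub_sq ℂ _ _ _ _ (φ y) (φ x)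
    rw [norm_sq_of_inner_eq_sechKernel hG, norm_sq_of_inner_eq_sechKernel hG, hG] at h
    rw [← Real.sqrt_sq (norm_nonneg (φ y - φ x)), h]
    simp only [RCLike.re_to_complex, Complex.ofReal_re]
    ring_nf
  simp only [h1]
  have : Continuous fun y => √(1 - 2 * sechKernel (y - x)) :=
    (continuous_const.sub (continuous_const.mul
      (continuous_sechKernel.comp (continuous_id.sub continuous_const)))).sqrt
  have h2 := this.tendsto x
  simpa [sechKernel] using h2

variable [CompleteSpace E]

theorem sechSymbol_sub_le_norm_fourierVec_sq {φ : ℝ → E}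
    (hG : ∀ x y, inner ℂ (φ x) (φ y) = (sechKernel (x - y) : ℂ)) {M : ℝ} (hM : 0 < M) (a : ℝ)
    (m : ℤ) : sechSymbol (2 * Real.pi * m / M) - 8 / M ≤ ‖fourierVec M a φ m‖ ^ 2 := by
  have hc := continuous_of_inner_eq_sechKernel hG
  set β := sechSymbol (2 * Real.pi * m / M) with hβ
  set ψ := fourierVec M a φ m with hψ
  set s : ℝ := (√M)⁻¹ with hs
  have hss : s * s * M = 1 := by
    rw [hs, ← mul_inv, Real.mul_self_sqrt hM.le, inv_mul_cancel₀ hM.ne']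
  have hin : ∀ x, inner ℂ (φ x) ψ = s * ∫ y in a..a + M, expChar M m y * (sechKernel (x - y) : ℂ) :=
    fun x => by
      rw [hψ, inner_fourierVec a hc, fourierVec]
      simp only [hG, smul_eq_mul, hs]
  set G : ℝ → ℂ := fun x => ∫ y in a..a + M, expChar M m (y - x) * (sechKernel (x - y) : ℂ) with hGd
  have hG2 : ∀ x, (starRingEnd ℂ) (expChar M m x) * inner ℂ (φ x) ψ = s * G x := fun x => by
    rw [hin, hGd, mul_left_comm, ← intervalIntegral.integral_const_mul]
    congr 1
    refine intervalIntegral.integral_congr fun y _ => ?_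
    have : expChar M m (y - x) = expChar M (-m) x * expChar M m y := by
      rw [expChar, expChar, expChar, ← Complex.exp_add]
      congr 1; push_cast; ring
    simp only [this, conj_expChar, mul_assoc]
  have hre : ∀ x, (expChar M m x * inner ℂ ψ (φ x)).re = s * (G x).re := fun x => by
    rw [← Complex.conj_re, map_mul, inner_conj_symm, hG2, Complex.re_ofReal_mul]
  have hcont : Continuous fun x => (expChar M m x * inner ℂ ψ (φ x)).re :=
    Complex.continuous_re.comp ((continuous_expChar M m).mul (continuous_const.inner hc))
  have hnorm : ‖ψ‖ ^ 2 = s * ∫ x in a..a + M, s * (G x).re := by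
    have h1 := inner_fourierVec (M := M) a hc m ψ
    rw [← hψ, inner_self_eq_norm_sq_to_K, fourierVec] at h1
    simp only [Complex.coe_algebraMap, smul_eq_mul, ← hs] at h1
    have h2 := congrArg Complex.re h1
    rw [← Complex.ofReal_pow, Complex.ofReal_re, Complex.re_ofReal_mul] at h2
    rw [h2]
    congr 1
    rw [← intervalIntegral.integral_congr (fun x _ => hre x)]
    exact (Complex.reCLM.intervalIntegral_comp_comm
      (((continuous_expChar M m).mul (continuous_const.inner hc)).intervalIntegrable _ _)).symm
  have hs0 : 0 < s := inv_pos.2 (Real.sqrt_pos.2 hM)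
  have hlow : ∫ x in a..a + M, (s * β - s * (2 * Real.exp ((a - x) / 2)
      + 2 * Real.exp ((x - (a + M)) / 2))) ≤ ∫ x in a..a + M, s * (G x).re := by
    refine intervalIntegral.integral_mono_on (by linarith) ?_ ?_ fun x hx => ?_
    · exact Continuous.intervalIntegrable (by fun_prop) _ _
    · simp only [← hre]; exact hcont.intervalIntegrable _ _
    · have h1 := norm_integral_interval_sub_sechSymbol_le a m hx
      have h2 := (Complex.abs_re_le_norm _).trans h1
      rw [Complex.sub_re, Complex.ofReal_re] at h2
      have h3 := (abs_le.1 h2).1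
      rw [← mul_sub]
      exact mul_le_mul_of_nonneg_left (by simp only [hGd, hβ]; linarith) hs0.le
  have hintvl : ∫ x in a..a + M, (s * β - s * (2 * Real.exp ((a - x) / 2)
      + 2 * Real.exp ((x - (a + M)) / 2))) = s * (M * β - 8 + 8 * Real.exp (-(M / 2))) := by
    rw [intervalIntegral.integral_eq_sub_of_hasDerivAt (f := fun x => s * β * x -
      s * (-4 * Real.exp ((a - x) / 2) + 4 * Real.exp ((x - (a + M)) / 2))) (fun x _ => ?_)
      (Continuous.intervalIntegrable (by fun_prop) _ _)]
    · simp only [sub_self, zero_div, Real.exp_zero]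
      rw [show (a - (a + M)) / 2 = -(M / 2) by ring]
      ring
    · have d1 : HasDerivAt (fun x => (a - x) / 2) (-1 / 2) x :=
        ((hasDerivAt_id x).const_sub a).div_const 2
      have d2 : HasDerivAt (fun x => (x - (a + M)) / 2) (1 / 2) x :=
        ((hasDerivAt_id x).sub_const (a + M)).div_const 2
      have := ((hasDerivAt_id x).const_mul (s * β)).sub
        (((d1.exp.const_mul (-4)).add (d2.exp.const_mul 4)).const_mul s)
      convert! this using 1
      ring
  rw [hintvl] at hlow
  rw [hnorm]
  refine le_trans ?_ (mul_le_mul_of_nonneg_left hlow hs0.le)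
  have h5 : s * s = 1 / M := by field_simp; linarith
  have h6 : s * (s * (M * β - 8 + 8 * Real.exp (-(M / 2)))) =
      β - 8 / M + 8 * Real.exp (-(M / 2)) / M := by
    rw [← mul_assoc, h5]; field_simp
  rw [h6]
  have : 0 ≤ 8 * Real.exp (-(M / 2)) / M := by positivity
  linarith

end SechGram

/-- The set of frequencies used on a block of length `L ^ 2`. -/
def blockFreqs (L : ℕ) : Finset ℤ := Finset.Icc (-((L ^ 3 : ℕ) : ℤ)) (L ^ 3 : ℕ)

/-- The symbol at the `m`-th lattice frequency of a block of length `L ^ 2`. -/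
def blockSymbol (L : ℕ) (m : ℤ) : ℝ := sechSymbol (m * (2 * Real.pi / (L : ℝ) ^ 2))

section Blocks

variable {E : Type*} [NormedAddCommGroup E] [InnerProductSpace ℂ E] [CompleteSpace E]
  {ι : Type*} [Fintype ι] [DecidableEq ι]

theorem norm_gramDefect_sq {K : Type*} [DecidableEq K] (v : K → E) (D : K → ℝ) (c c' : K) :
    ‖gramDefect v D c c'‖ ^ 2 = ‖(inner ℂ (v c) (v c') : ℂ)‖ ^ 2 -
      if c = c' then 2 * D c * ‖v c‖ ^ 2 - D c ^ 2 else 0 := by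
  rw [gramDefect]
  split_ifs with h
  · subst h
    rw [inner_self_eq_norm_sq_to_K]
    simp only [Complex.coe_algebraMap]
    rw [← Complex.ofReal_pow, ← Complex.ofReal_sub, Complex.norm_real, Complex.norm_real,
      Real.norm_eq_abs, Real.norm_eq_abs, sq_abs, sq_abs]
    ring
  · rw [sub_zero, sub_zero]

theorem sum_interval_sechKernel_sq_le {M : ℝ} (hM : 0 ≤ M) (a : ι → ℝ)
    (ha : Pairwise fun i j => Disjoint (Ioc (a i) (a i + M)) (Ioc (a j) (a j + M))) (y : ℝ) :
    ∑ i, ∫ x in a i..a i + M, sechKernel (y - x) ^ 2 ≤ 1 := by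
  have hi : Integrable fun x => sechKernel (y - x) ^ 2 := integrable_sechKernel_sq.comp_sub_left y
  simp only [fun i => intervalIntegral.integral_of_le (μ := volume)
    (f := fun x => sechKernel (y - x) ^ 2) (show a i ≤ a i + M by linarith)]
  rw [← integral_iUnion_fintype (fun i => measurableSet_Ioc) ha (fun i => hi.integrableOn)]
  refine (setIntegral_le_integral hi (Eventually.of_forall fun x => sq_nonneg _)).trans ?_
  rw [integral_sub_left_eq_self (fun z => sechKernel z ^ 2), integral_sechKernel_sq]

variable {φ : ℝ → E}

theorem norm_inner_sechKernel_sq (hG : ∀ x y, inner ℂ (φ x) (φ y) = (sechKernel (x - y) : ℂ))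
    (x y : ℝ) : ‖(inner ℂ (φ x) (φ y) : ℂ)‖ ^ 2 = sechKernel (x - y) ^ 2 := by
  rw [hG, Complex.norm_real, Real.norm_of_nonneg (sechKernel_pos _).le]

theorem sum_norm_inner_block_le (hG : ∀ x y, inner ℂ (φ x) (φ y) = (sechKernel (x - y) : ℂ))
    {M : ℝ} (hM : 0 < M) (a : ι → ℝ)
    (ha : Pairwise fun i j => Disjoint (Ioc (a i) (a i + M)) (Ioc (a j) (a j + M)))
    (T : Finset ℤ) :
    ∑ c : ι × T, ∑ c' : ι × T,
      ‖(inner ℂ (fourierVec M (a c.1) φ c.2) (fourierVec M (a c'.1) φ c'.2) : ℂ)‖ ^ 2 ≤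
      Fintype.card ι * M := by
  have hc := continuous_of_inner_eq_sechKernel hG
  have hsym : ∀ u v : E, ‖(inner ℂ u v : ℂ)‖ = ‖(inner ℂ v u : ℂ)‖ := fun u v => norm_inner_symm u v
  have hBessel : ∀ (i : ι) (f : E), ∑ m : T, ‖(inner ℂ f (fourierVec M (a i) φ m) : ℂ)‖ ^ 2 ≤
      ∫ x in a i..a i + M, ‖(inner ℂ f (φ x) : ℂ)‖ ^ 2 := fun i f => by
    rw [Finset.sum_coe_sort T fun m => ‖(inner ℂ f (fourierVec M (a i) φ m) : ℂ)‖ ^ 2]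
    exact sum_norm_inner_fourierVec_le hM _ hc T f
  have hintvl : ∀ (u : E) (j : ι), IntervalIntegrable (fun y => ‖(inner ℂ u (φ y) : ℂ)‖ ^ 2) volume
      (a j) (a j + M) := fun u j => ((continuous_const.inner hc).norm.pow 2).intervalIntegrable _ _
  calc ∑ c : ι × T, ∑ c' : ι × T,
        ‖(inner ℂ (fourierVec M (a c.1) φ c.2) (fourierVec M (a c'.1) φ c'.2) : ℂ)‖ ^ 2
      ≤ ∑ c : ι × T, ∑ j, ∫ y in a j..a j + M,
          ‖(inner ℂ (fourierVec M (a c.1) φ c.2) (φ y) : ℂ)‖ ^ 2 := by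
        refine Finset.sum_le_sum fun c _ => ?_
        rw [Fintype.sum_prod_type]
        exact Finset.sum_le_sum fun j _ => hBessel j _
    _ = ∑ j, ∫ y in a j..a j + M, ∑ c : ι × T,
          ‖(inner ℂ (fourierVec M (a c.1) φ c.2) (φ y) : ℂ)‖ ^ 2 := by
        rw [Finset.sum_comm]
        refine Finset.sum_congr rfl fun j _ => ?_
        rw [intervalIntegral.integral_finsetSum fun c _ => hintvl _ j]
    _ ≤ ∑ j : ι, ∫ y in a j..a j + M, (1 : ℝ) := by
        refine Finset.sum_le_sum fun j _ => ?_
        refine intervalIntegral.integral_mono_on (by linarith) ?_ (by simp) fun y _ => ?_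
        · exact (continuous_finsetSum _ fun c _ =>
            ((continuous_const.inner hc).norm.pow 2)).intervalIntegrable _ _
        · rw [Fintype.sum_prod_type]
          refine le_trans (Finset.sum_le_sum fun i _ => ?_)
            (sum_interval_sechKernel_sq_le hM.le a ha y)
          simp only [hsym _ (φ y)]
          refine (hBessel i (φ y)).trans (le_of_eq ?_)
          simp only [norm_inner_sechKernel_sq hG]
    _ = Fintype.card ι * M := by simp

theorem sum_norm_gramDefect_block_le
    (hG : ∀ x y, inner ℂ (φ x) (φ y) = (sechKernel (x - y) : ℂ)) {L : ℕ} (hL : 1 ≤ L) (a : ι → ℝ)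
    (ha : Pairwise fun i j =>
      Disjoint (Ioc (a i) (a i + (L : ℝ) ^ 2)) (Ioc (a j) (a j + (L : ℝ) ^ 2))) :
    ∑ c : ι × blockFreqs L, ∑ c' : ι × blockFreqs L,
      ‖gramDefect (fun c : ι × blockFreqs L => fourierVec ((L : ℝ) ^ 2) (a c.1) φ c.2)
        (fun c => blockSymbol L c.2) c c'‖ ^ 2 ≤ Fintype.card ι * (100 * L) := by
  have hL1 : (1 : ℝ) ≤ L := by exact_mod_cast hL
  have hM : (0 : ℝ) < (L : ℝ) ^ 2 := by positivity
  obtain ⟨s1, -, s3⟩ := sum_sechSymbol_bounds hL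
  simp only [norm_gramDefect_sq, Finset.sum_sub_distrib, Finset.sum_ite_eq, Finset.mem_univ, if_true]
  have h1 := sum_norm_inner_block_le hG hM a ha (blockFreqs L)
  have h2 : ∀ (i : ι) (m : ℤ), blockSymbol L m ^ 2 - 16 / (L : ℝ) ^ 2 * blockSymbol L m ≤
      2 * blockSymbol L m * ‖fourierVec ((L : ℝ) ^ 2) (a i) φ m‖ ^ 2 - blockSymbol L m ^ 2 :=
    fun i m => by
      have := sechSymbol_sub_le_norm_fourierVec_sq hG hM (a i) m
      rw [show 2 * Real.pi * m / (L : ℝ) ^ 2 = m * (2 * Real.pi / (L : ℝ) ^ 2) by ring] at this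
      change blockSymbol L m - _ ≤ _ at this
      have h0 : 0 < blockSymbol L m := sechSymbol_pos _
      have := mul_le_mul_of_nonneg_left this h0.le
      have e : 16 / (L : ℝ) ^ 2 * blockSymbol L m = 2 * (blockSymbol L m * (8 / (L : ℝ) ^ 2)) := by
        ring
      rw [e]
      linarith
  have h3 : (Fintype.card ι : ℝ) * ((L : ℝ) ^ 2 - 91 * L) ≤ ∑ c : ι × blockFreqs L,
      (2 * blockSymbol L c.2 * ‖fourierVec ((L : ℝ) ^ 2) (a c.1) φ c.2‖ ^ 2 -
        blockSymbol L c.2 ^ 2) := by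
    rw [Fintype.sum_prod_type, ← nsmul_eq_mul, ← Finset.card_univ, ← Finset.sum_const]
    refine Finset.sum_le_sum fun i _ => ?_
    refine le_trans ?_ (Finset.sum_le_sum fun m _ => h2 i m)
    rw [Finset.sum_coe_sort (blockFreqs L)
      fun m => blockSymbol L m ^ 2 - 16 / (L : ℝ) ^ 2 * blockSymbol L m, Finset.sum_sub_distrib,
      ← Finset.mul_sum]
    have e1 : 16 / (L : ℝ) ^ 2 * ∑ m ∈ blockFreqs L, blockSymbol L m ≤ 80 * L := by
      have := mul_le_mul_of_nonneg_left s1 (show 0 ≤ 16 / (L : ℝ) ^ 2 by positivity)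
      refine this.trans ?_
      rw [div_mul_eq_mul_div, div_le_iff₀ hM]
      nlinarith [mul_nonneg (sub_nonneg.2 hL1) hM.le]
    have e2 : (L : ℝ) ^ 2 - 11 * L ≤ ∑ m ∈ blockFreqs L, blockSymbol L m ^ 2 := s3
    linarith
  rw [Finset.sum_sub_distrib] at h3
  have hn : (0 : ℝ) ≤ Fintype.card ι := Nat.cast_nonneg _
  nlinarith [mul_nonneg hn (show (0 : ℝ) ≤ L by linarith)]

theorem norm_gramDefect_smul_le {K : Type*} [DecidableEq K] (v : K → E) (D w : K → ℝ) {S : ℝ}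
    (hw : ∀ c, 0 ≤ w c) (hS : ∀ c, w c ≤ S) (c c' : K) :
    ‖gramDefect (fun c => ((√(w c) : ℝ) : ℂ) • v c) (fun c => w c * D c) c c'‖ ^ 2 ≤
      S ^ 2 * ‖gramDefect v D c c'‖ ^ 2 := by
  have h : gramDefect (fun c => ((√(w c) : ℝ) : ℂ) • v c) (fun c => w c * D c) c c' =
      ((√(w c) * √(w c') : ℝ) : ℂ) * gramDefect v D c c' := by
    rw [gramDefect, gramDefect, inner_smul_left, inner_smul_right, Complex.conj_ofReal]
    split_ifs with hcc
    · subst hcc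
      rw [Real.mul_self_sqrt (hw c), mul_sub, ← mul_assoc, ← Complex.ofReal_mul,
        Real.mul_self_sqrt (hw c), Complex.ofReal_mul]
    · push_cast; ring
  rw [h, norm_mul, mul_pow, Complex.norm_real, Real.norm_eq_abs, sq_abs, mul_pow,
    Real.sq_sqrt (hw c), Real.sq_sqrt (hw c')]
  refine mul_le_mul_of_nonneg_right ?_ (sq_nonneg _)
  rw [sq]
  exact mul_le_mul (hS c) (hS c') (hw c') ((hw c).trans (hS c))

end Blocks

section BlockForms

variable {E : Type*} [NormedAddCommGroup E] [InnerProductSpace ℂ E] [CompleteSpace E]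
  {ι : Type*} [Fintype ι] {φ : ℝ → E}

theorem integral_norm_sq_sub_sum_fourierVec_le
    (hG : ∀ x y, inner ℂ (φ x) (φ y) = (sechKernel (x - y) : ℂ)) {L : ℕ} (hL : 1 ≤ L) (a : ℝ) :
    (∫ x in a..a + (L : ℝ) ^ 2, ‖φ x‖ ^ 2) -
      ∑ m ∈ blockFreqs L, ‖fourierVec ((L : ℝ) ^ 2) a φ m‖ ^ 2 ≤ 30 * L := by
  have hL1 : (1 : ℝ) ≤ L := by exact_mod_cast hL
  have hM : (0 : ℝ) < (L : ℝ) ^ 2 := by positivity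
  obtain ⟨-, s2, -⟩ := sum_sechSymbol_bounds hL
  have h1 : ∑ m ∈ blockFreqs L, (blockSymbol L m - 8 / (L : ℝ) ^ 2) ≤
      ∑ m ∈ blockFreqs L, ‖fourierVec ((L : ℝ) ^ 2) a φ m‖ ^ 2 :=
    Finset.sum_le_sum fun m _ => by
      have := sechSymbol_sub_le_norm_fourierVec_sq hG hM a m
      rwa [show 2 * Real.pi * m / (L : ℝ) ^ 2 = m * (2 * Real.pi / (L : ℝ) ^ 2) by ring] at this
  have hcard : (blockFreqs L).card = 2 * L ^ 3 + 1 := by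
    rw [blockFreqs, Int.card_Icc]; omega
  rw [Finset.sum_sub_distrib, Finset.sum_const, hcard, nsmul_eq_mul] at h1
  have h2 : ((2 * L ^ 3 + 1 : ℕ) : ℝ) * (8 / (L : ℝ) ^ 2) ≤ 24 * L := by
    push_cast
    rw [mul_div_assoc', div_le_iff₀ hM]
    nlinarith [one_le_pow₀ hL1 (n := 3)]
  have h3 : (L : ℝ) ^ 2 / 2 - 6 * L ≤ ∑ m ∈ blockFreqs L, blockSymbol L m := s2
  simp only [norm_sq_of_inner_eq_sechKernel hG]
  rw [intervalIntegral.integral_const, smul_eq_mul]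
  linarith

variable [DecidableEq ι]

theorem norm_inner_sqrt_smul_sq {w : ℝ} (hw : 0 ≤ w) (v f : E) :
    ‖(inner ℂ (((√w : ℝ) : ℂ) • v) f : ℂ)‖ ^ 2 = w * ‖(inner ℂ v f : ℂ)‖ ^ 2 := by
  rw [inner_smul_left, norm_mul, mul_pow, Complex.conj_ofReal, Complex.norm_real,
    Real.norm_eq_abs, sq_abs, Real.sq_sqrt hw]

theorem sum_norm_gramDefect_weighted_le
    (hG : ∀ x y, inner ℂ (φ x) (φ y) = (sechKernel (x - y) : ℂ)) {L : ℕ} (hL : 1 ≤ L) (a : ι → ℝ)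
    (ha : Pairwise fun i j =>
      Disjoint (Ioc (a i) (a i + (L : ℝ) ^ 2)) (Ioc (a j) (a j + (L : ℝ) ^ 2)))
    {w : ι → ℝ} {S : ℝ} (hw : ∀ i, 0 ≤ w i) (hS : ∀ i, w i ≤ S) :
    ∑ c : ι × blockFreqs L, ∑ c' : ι × blockFreqs L,
      ‖gramDefect (fun c : ι × blockFreqs L =>
        ((√(w c.1) : ℝ) : ℂ) • fourierVec ((L : ℝ) ^ 2) (a c.1) φ c.2)
        (fun c => w c.1 * blockSymbol L c.2) c c'‖ ^ 2 ≤
      S ^ 2 * (Fintype.card ι * (100 * L)) := by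
  refine le_trans ?_ (mul_le_mul_of_nonneg_left (sum_norm_gramDefect_block_le hG hL a ha)
    (sq_nonneg S))
  simp only [Finset.mul_sum]
  exact Finset.sum_le_sum fun c _ => Finset.sum_le_sum fun c' _ =>
    norm_gramDefect_smul_le _ _ (fun c : ι × blockFreqs L => w c.1) (fun c => hw c.1)
      (fun c => hS c.1) c c'

theorem smallOffDim_sum_block
    (hG : ∀ x y, inner ℂ (φ x) (φ y) = (sechKernel (x - y) : ℂ)) {L : ℕ} (hL : 1 ≤ L) (a : ι → ℝ)
    (ha : Pairwise fun i j =>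
      Disjoint (Ioc (a i) (a i + (L : ℝ) ^ 2)) (Ioc (a j) (a j + (L : ℝ) ^ 2)))
    {w : ι → ℝ} {S δ l : ℝ} (hw : ∀ i, 0 ≤ w i) (hS : ∀ i, w i ≤ S) (hδ : 0 < δ) (hl : 0 ≤ l) :
    SmallOffDim (fun f => ∑ i, w i * ∫ x in a i..a i + (L : ℝ) ^ 2, ‖(inner ℂ (φ x) f : ℂ)‖ ^ 2)
      (l + δ + δ)
      ((Finset.univ.filter fun c : ι × blockFreqs L => l < w c.1 * blockSymbol L c.2).card +
        S ^ 2 * (Fintype.card ι * (100 * L)) / δ ^ 2 + S * (Fintype.card ι * (30 * L)) / δ) := by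
  have hL1 : (1 : ℝ) ≤ L := by exact_mod_cast hL
  have hM : (0 : ℝ) < (L : ℝ) ^ 2 := by positivity
  have hc := continuous_of_inner_eq_sechKernel hG
  have h1 := smallOffDim_sum_inner _ _ hδ hl (sum_norm_gramDefect_weighted_le hG hL a ha hw hS)
  set rem : ι → E → ℝ := fun i f => (∫ x in a i..a i + (L : ℝ) ^ 2, ‖(inner ℂ f (φ x) : ℂ)‖ ^ 2) -
      ∑ m ∈ blockFreqs L, ‖(inner ℂ f (fourierVec ((L : ℝ) ^ 2) (a i) φ m) : ℂ)‖ ^ 2 with hrem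
  have h2 : SmallOffDim (fun f => ∑ i, w i * rem i f) δ (S * (Fintype.card ι * (30 * L)) / δ) := by
    refine smallOffDim_of_sum_le _ (fun c f => ?_) hδ fun n e he => ?_
    · simp only [hrem, inner_smul_left, norm_mul, mul_pow, RCLike.norm_conj,
        intervalIntegral.integral_const_mul, ← Finset.mul_sum, ← mul_sub]
      rw [Finset.mul_sum]
      exact Finset.sum_congr rfl fun i _ => by ring
    · rw [Finset.sum_comm]
      simp only [← Finset.mul_sum]
      calc ∑ i, w i * ∑ j, rem i (e j) ≤ ∑ i : ι, S * (30 * L) := by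
            refine Finset.sum_le_sum fun i _ => ?_
            refine (mul_le_mul_of_nonneg_left ((sum_orthonormal_remainder_le hM (a i) hc
              (blockFreqs L) e he).trans (integral_norm_sq_sub_sum_fourierVec_le hG hL _))
              (hw i)).trans (mul_le_mul_of_nonneg_right (hS i) (by positivity))
        _ = S * (Fintype.card ι * (30 * L)) := by
            rw [Finset.sum_const, nsmul_eq_mul, Finset.card_univ]; ring
  refine (h1.add h2).mono (fun f => ?_) le_rfl (by rw [add_assoc])
  rw [Fintype.sum_prod_type, ← Finset.sum_add_distrib]
  refine Finset.sum_le_sum fun i _ => ?_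
  simp only [norm_inner_sqrt_smul_sq (hw i), hrem, norm_inner_symm f]
  rw [← Finset.mul_sum, ← mul_add, Finset.sum_coe_sort (blockFreqs L)
    fun m => ‖(inner ℂ (fourierVec ((L : ℝ) ^ 2) (a i) φ m) f : ℂ)‖ ^ 2]
  exact le_of_eq (by ring)

theorem exists_submodule_sum_block_ge
    (hG : ∀ x y, inner ℂ (φ x) (φ y) = (sechKernel (x - y) : ℂ)) {L : ℕ} (hL : 1 ≤ L) (a : ι → ℝ)
    (ha : Pairwise fun i j =>
      Disjoint (Ioc (a i) (a i + (L : ℝ) ^ 2)) (Ioc (a j) (a j + (L : ℝ) ^ 2)))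
    {w : ι → ℝ} {S δ l : ℝ} (hw : ∀ i, 0 ≤ w i) (hS : ∀ i, w i ≤ S) (hδ : 0 < δ) (hl : δ < l) :
    ∃ V : Submodule ℂ E, FiniteDimensional ℂ V ∧
      ((Finset.univ.filter fun c : ι × blockFreqs L => l ≤ w c.1 * blockSymbol L c.2).card : ℝ) -
        S ^ 2 * (Fintype.card ι * (100 * L)) / δ ^ 2 ≤ Module.finrank ℂ V ∧
      ∀ f ∈ V, (l - δ) * ‖f‖ ^ 2 ≤
          ∑ i, w i * ∫ x in a i..a i + (L : ℝ) ^ 2, ‖(inner ℂ (φ x) f : ℂ)‖ ^ 2 ∧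
        ∀ y, (l - δ) * ‖(inner ℂ (φ y) f : ℂ)‖ ^ 2 ≤ ‖f‖ ^ 2 *
          ∑ i, w i * ∫ x in a i..a i + (L : ℝ) ^ 2, sechKernel (x - y) ^ 2 := by
  classical
  have hL1 : (1 : ℝ) ≤ L := by exact_mod_cast hL
  have hM : (0 : ℝ) < (L : ℝ) ^ 2 := by positivity
  have hc := continuous_of_inner_eq_sechKernel hG
  have hB := sum_norm_gramDefect_weighted_le hG hL a ha hw hS
  set P : ι × blockFreqs L → Prop := fun c => l ≤ w c.1 * blockSymbol L c.2 with hP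
  set v : ι × blockFreqs L → E := fun c =>
    ((√(w c.1) : ℝ) : ℂ) • fourierVec ((L : ℝ) ^ 2) (a c.1) φ c.2 with hv
  set D : ι × blockFreqs L → ℝ := fun c => w c.1 * blockSymbol L c.2 with hD
  have hB' : ∑ c : {c // P c}, ∑ c' : {c // P c},
      ‖gramDefect (fun c : {c // P c} => v c) (fun c => D c) c c'‖ ^ 2 ≤
      S ^ 2 * (Fintype.card ι * (100 * L)) := by
    have e : ∀ c c' : {c // P c}, gramDefect (fun c : {c // P c} => v c) (fun c => D c) c c' =
        gramDefect v D c c' := fun c c' => by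
      simp only [gramDefect, Subtype.ext_iff]
    simp only [e]
    have hsub : ∀ g : ι × blockFreqs L → ℝ, (∀ c, 0 ≤ g c) → ∑ c : {c // P c}, g c ≤ ∑ c, g c :=
      fun g hg => by
        rw [← Finset.sum_subtype (Finset.univ.filter P) (by simp) g]
        exact Finset.sum_le_sum_of_subset_of_nonneg (Finset.filter_subset _ _) fun c _ _ => hg c
    refine le_trans (Finset.sum_le_sum fun c _ => hsub (fun c' => ‖gramDefect v D c c'‖ ^ 2)
      fun c' => sq_nonneg _) (le_trans (hsub (fun c => ∑ c', ‖gramDefect v D c c'‖ ^ 2)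
      fun c => Finset.sum_nonneg fun c' _ => sq_nonneg _) hB)
  obtain ⟨V, hV, hdim, hVf⟩ := exists_submodule_sum_inner_ge (fun c : {c // P c} => v c)
    (fun c => D c) hδ hl (fun c => c.2) hB'
  refine ⟨V, hV, ?_, fun f hf => ?_⟩
  · rw [Fintype.card_subtype] at hdim
    exact hdim
  obtain ⟨h1, x, hx, hxf⟩ := hVf f hf
  have hbes : ∀ g : E, ∑ c, ‖(inner ℂ (v c) g : ℂ)‖ ^ 2 ≤
      ∑ i, w i * ∫ x in a i..a i + (L : ℝ) ^ 2, ‖(inner ℂ (φ x) g : ℂ)‖ ^ 2 := fun g => by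
    rw [Fintype.sum_prod_type]
    refine Finset.sum_le_sum fun i _ => ?_
    simp only [hv, norm_inner_sqrt_smul_sq (hw i)]
    rw [← Finset.mul_sum, Finset.sum_coe_sort (blockFreqs L)
      fun m => ‖(inner ℂ (fourierVec ((L : ℝ) ^ 2) (a i) φ m) g : ℂ)‖ ^ 2]
    refine mul_le_mul_of_nonneg_left ?_ (hw i)
    simp only [norm_inner_symm _ g]
    exact sum_norm_inner_fourierVec_le hM (a i) hc (blockFreqs L) g
  have hsub : ∀ g : E, ∑ c : {c // P c}, ‖(inner ℂ (v c) g : ℂ)‖ ^ 2 ≤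
      ∑ c, ‖(inner ℂ (v c) g : ℂ)‖ ^ 2 := fun g => by
    rw [← Finset.sum_subtype (Finset.univ.filter P) (by simp)
      fun c => ‖(inner ℂ (v c) g : ℂ)‖ ^ 2]
    exact Finset.sum_le_sum_of_subset_of_nonneg (Finset.filter_subset _ _) fun c _ _ => sq_nonneg _
  refine ⟨h1.trans ((hsub f).trans (hbes f)), fun y => ?_⟩
  have hS' : ∑ c : {c // P c}, ‖(inner ℂ (v c) (φ y) : ℂ)‖ ^ 2 ≤
      ∑ i, w i * ∫ x in a i..a i + (L : ℝ) ^ 2, sechKernel (x - y) ^ 2 := by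
    refine (hsub _).trans ((hbes _).trans (le_of_eq ?_))
    simp only [norm_inner_sechKernel_sq hG]
  have hCS : ‖(inner ℂ (φ y) f : ℂ)‖ ^ 2 ≤
      ‖x‖ ^ 2 * ∑ c : {c // P c}, ‖(inner ℂ (v c) (φ y) : ℂ)‖ ^ 2 := by
    rw [EuclideanSpace.norm_sq_eq, hx, inner_sum]
    refine le_trans ?_ (Finset.sum_mul_sq_le_sq_mul_sq _ _ _)
    refine pow_le_pow_left₀ (norm_nonneg _) ((norm_sum_le _ _).trans (Finset.sum_le_sum
      fun c _ => ?_)) 2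
    rw [inner_smul_right, norm_mul, norm_inner_symm]
  calc (l - δ) * ‖(inner ℂ (φ y) f : ℂ)‖ ^ 2
      ≤ (l - δ) * (‖x‖ ^ 2 * ∑ c : {c // P c}, ‖(inner ℂ (v c) (φ y) : ℂ)‖ ^ 2) :=
        mul_le_mul_of_nonneg_left hCS (by linarith)
    _ = (l - δ) * ‖x‖ ^ 2 * ∑ c : {c // P c}, ‖(inner ℂ (v c) (φ y) : ℂ)‖ ^ 2 := by ring
    _ ≤ _ := mul_le_mul hxf hS' (Finset.sum_nonneg fun c _ => sq_nonneg _) (sq_nonneg _)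

end BlockForms

open Topology

theorem blockSymbol_pos (L : ℕ) (m : ℤ) : 0 < blockSymbol L m := sechSymbol_pos _

theorem integral_sechSymbol_rpow_eq (r : ℝ) :
    ∫ x, sechSymbol x ^ r = 2 * ∫ x in Ioi (0 : ℝ), sechSymbol x ^ r := by
  rw [← integral_comp_abs (f := fun x => sechSymbol x ^ r)]
  simp only [sechSymbol_abs]

theorem sum_Icc_sechSymbol_rpow_bounds {r : ℝ} (hr : 0 < r) {d : ℝ} (hd : 0 < d) (m : ℕ) :
    2 * (∫ x in (0 : ℝ)..m * d, sechSymbol x ^ r) - d * Real.pi ^ r ≤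
        d * ∑ k ∈ Finset.Icc (-(m : ℤ)) m, sechSymbol (k * d) ^ r ∧
      d * ∑ k ∈ Finset.Icc (-(m : ℤ)) m, sechSymbol (k * d) ^ r ≤
        2 * (∫ x in (0 : ℝ)..m * d, sechSymbol x ^ r) + d * Real.pi ^ r := by
  have := sum_Icc_neg_bounds (g := fun x => sechSymbol x ^ r)
    (fun x => by rw [← sechSymbol_abs, abs_neg, sechSymbol_abs])
    (fun x => (Real.rpow_pos_of_pos (sechSymbol_pos x) r).le)
    (fun x hx y hy hxy => Real.rpow_le_rpow (sechSymbol_pos y).le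
      (antitoneOn_sechSymbol hx hy hxy) hr.le) hd m
  simpa only [sechSymbol_zero] using this

theorem sum_blockSymbol_rpow_le {r : ℝ} (hr : 0 < r) {L : ℕ} (hL : 1 ≤ L) :
    ∑ m ∈ blockFreqs L, blockSymbol L m ^ r ≤
      (L : ℝ) ^ 2 * ((2 * Real.pi)⁻¹ * ∫ x, sechSymbol x ^ r) + Real.pi ^ r := by
  have hL1 : (1 : ℝ) ≤ L := by exact_mod_cast hL
  have hpi := Real.pi_pos
  have hd : 0 < 2 * Real.pi / (L : ℝ) ^ 2 := by positivity
  have h := (sum_Icc_sechSymbol_rpow_bounds hr hd (L ^ 3)).2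
  have hi := integrable_sechSymbol_rpow hr
  have h2 : ∫ x in (0 : ℝ)..((L ^ 3 : ℕ) : ℝ) * (2 * Real.pi / (L : ℝ) ^ 2), sechSymbol x ^ r ≤
      ∫ x in Ioi (0 : ℝ), sechSymbol x ^ r := by
    rw [intervalIntegral.integral_of_le (by positivity)]
    exact setIntegral_mono_set hi.integrableOn
      (Eventually.of_forall fun x => (Real.rpow_pos_of_pos (sechSymbol_pos x) r).le)
      Ioc_subset_Ioi_self.eventuallyLE
  have h3 : 2 * Real.pi / (L : ℝ) ^ 2 * ∑ m ∈ blockFreqs L, blockSymbol L m ^ r ≤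
      2 * Real.pi / (L : ℝ) ^ 2 * ((L : ℝ) ^ 2 * ((2 * Real.pi)⁻¹ * ∫ x, sechSymbol x ^ r) +
        Real.pi ^ r) := by
    refine h.trans ?_
    rw [mul_add, integral_sechSymbol_rpow_eq r]
    have : 2 * Real.pi / (L : ℝ) ^ 2 * ((L : ℝ) ^ 2 *
        ((2 * Real.pi)⁻¹ * (2 * ∫ x in Ioi (0 : ℝ), sechSymbol x ^ r))) =
        2 * ∫ x in Ioi (0 : ℝ), sechSymbol x ^ r := by field_simp
    rw [this]
    linarith
  exact le_of_mul_le_mul_left h3 hd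

theorem exists_le_sum_blockSymbol_rpow {r η : ℝ} (hr : 0 < r) (hη : 0 < η) :
    ∃ R : ℕ, 1 ≤ R ∧ ∀ L : ℕ, 1 ≤ L →
      (L : ℝ) ^ 2 * (((2 * Real.pi)⁻¹ * ∫ x, sechSymbol x ^ r) - η) - Real.pi ^ r ≤
        ∑ m ∈ Finset.Icc (-((R * L ^ 2 : ℕ) : ℤ)) (R * L ^ 2 : ℕ), blockSymbol L m ^ r := by
  have hpi := Real.pi_pos
  have hi := integrable_sechSymbol_rpow hr
  have ht : Tendsto (fun R : ℕ => ∫ x in (0 : ℝ)..R * (2 * Real.pi), sechSymbol x ^ r) atTop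
      (𝓝 (∫ x in Ioi (0 : ℝ), sechSymbol x ^ r)) :=
    intervalIntegral_tendsto_integral_Ioi 0 hi.integrableOn
      (tendsto_natCast_atTop_atTop.atTop_mul_const (by positivity))
  obtain ⟨R, hR, hR1⟩ := ((ht.eventually (lt_mem_nhds (show (∫ x in Ioi (0 : ℝ),
    sechSymbol x ^ r) - Real.pi * η < _ by nlinarith))).and (eventually_ge_atTop 1)).exists
  refine ⟨R, hR1, fun L hL => ?_⟩
  have hL1 : (1 : ℝ) ≤ L := by exact_mod_cast hL
  have hd : 0 < 2 * Real.pi / (L : ℝ) ^ 2 := by positivity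
  have h := (sum_Icc_sechSymbol_rpow_bounds hr hd (R * L ^ 2)).1
  have e : ((R * L ^ 2 : ℕ) : ℝ) * (2 * Real.pi / (L : ℝ) ^ 2) = R * (2 * Real.pi) := by
    push_cast; field_simp
  rw [e] at h
  refine le_of_mul_le_mul_left (le_trans ?_ h) hd
  rw [mul_sub, integral_sechSymbol_rpow_eq r]
  have : 2 * Real.pi / (L : ℝ) ^ 2 * ((L : ℝ) ^ 2 *
      (((2 * Real.pi)⁻¹ * (2 * ∫ x in Ioi (0 : ℝ), sechSymbol x ^ r)) - η)) =
      2 * (∫ x in Ioi (0 : ℝ), sechSymbol x ^ r) - 2 * Real.pi * η := by field_simp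
  rw [this]
  linarith

theorem lt_mul_rpow_iff {α p N x b l : ℝ} (hα : 0 < α) (hp : 0 ≤ p) (hN : 0 < N) (hx : 0 < x)
    (hb : 0 < b) (hl : 0 < l) :
    l < p * (N / x) ^ α * b ↔ x < N * (p * b / l) ^ (1 / α) := by
  have hq : 0 ≤ p * b / l := by positivity
  rw [← div_lt_iff₀' hN, one_div, Real.lt_rpow_inv_iff_of_pos (by positivity) hq hα, lt_div_iff₀ hl,
    ← inv_div N x, Real.inv_rpow (by positivity), inv_mul_lt_iff₀ (by positivity)]
  ring_nf

theorem le_mul_rpow_iff {α p N x b l : ℝ} (hα : 0 < α) (hp : 0 ≤ p) (hN : 0 < N) (hx : 0 < x)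
    (hb : 0 < b) (hl : 0 < l) :
    l ≤ p * (N / x) ^ α * b ↔ x ≤ N * (p * b / l) ^ (1 / α) := by
  have hq : 0 ≤ p * b / l := by positivity
  rw [← div_le_iff₀' hN, one_div, Real.le_rpow_inv_iff_of_pos (by positivity) hq hα, le_div_iff₀ hl,
    ← inv_div N x, Real.inv_rpow (by positivity), inv_mul_le_iff₀ (by positivity)]
  ring_nf

theorem card_filter_lt_le {α p N M b l : ℝ} (hα : 0 < α) (hp : 0 ≤ p) (hN : 0 < N) (hM : 0 < M)
    (hb : 0 < b) (hl : 0 < l) {j₁ : ℕ} (j₂ : ℕ) (hj : 1 ≤ j₁) :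
    (((Finset.Ico j₁ j₂).filter fun j : ℕ => l < p * (N / (j * M)) ^ α * b).card : ℝ) ≤
      N / M * (p * b / l) ^ (1 / α) := by
  set Y := N / M * (p * b / l) ^ (1 / α) with hY
  have hY0 : 0 ≤ Y := by positivity
  have hsub : ((Finset.Ico j₁ j₂).filter fun j : ℕ => l < p * (N / (j * M)) ^ α * b) ⊆
      Finset.Ico 1 ⌈Y⌉₊ := fun j hj' => by
    simp only [Finset.mem_filter, Finset.mem_Ico] at hj' ⊢
    obtain ⟨⟨h1, -⟩, h2⟩ := hj'
    have hj0 : (0 : ℝ) < j := by exact_mod_cast (show 0 < j by omega)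
    refine ⟨by omega, Nat.lt_ceil.2 ?_⟩
    rw [lt_mul_rpow_iff hα hp hN (by positivity) hb hl, ← lt_div_iff₀ hM] at h2
    refine h2.trans_eq ?_
    rw [hY]; ring
  have h := Finset.card_le_card hsub
  rw [Nat.card_Ico] at h
  have h' : (((Finset.Ico j₁ j₂).filter fun j : ℕ => l < p * (N / (j * M)) ^ α * b).card : ℝ) ≤
      ((⌈Y⌉₊ - 1 : ℕ) : ℝ) := by exact_mod_cast h
  refine h'.trans ?_
  have := Nat.ceil_lt_add_one hY0
  rcases Nat.eq_zero_or_pos ⌈Y⌉₊ with h0 | h0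
  · rw [h0]; simpa using hY0
  · rw [Nat.cast_sub h0]; push_cast; linarith

theorem le_card_filter_le {α p N M b l : ℝ} (hα : 0 < α) (hp : 0 ≤ p) (hN : 0 < N) (hM : 0 < M)
    (hb : 0 < b) (hl : 0 < l) (j₁ : ℕ) {j₂ : ℕ} (hj : N / M * (p * b / l) ^ (1 / α) ≤ j₂) :
    N / M * (p * b / l) ^ (1 / α) - 1 - j₁ ≤
    (((Finset.Ico j₁ j₂).filter fun j : ℕ => l ≤ p * (N / ((j + 1) * M)) ^ α * b).card : ℝ) := by
  set Y := N / M * (p * b / l) ^ (1 / α) with hY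
  have hY0 : 0 ≤ Y := by positivity
  have hsub : Finset.Ico j₁ ⌊Y⌋₊ ⊆
      ((Finset.Ico j₁ j₂).filter fun j : ℕ => l ≤ p * (N / ((j + 1) * M)) ^ α * b) := fun j hj' => by
    simp only [Finset.mem_filter, Finset.mem_Ico] at hj' ⊢
    obtain ⟨h1, h2⟩ := hj'
    have h3 : ((j + 1 : ℕ) : ℝ) ≤ Y := (Nat.cast_le.2 h2).trans (Nat.floor_le hY0)
    refine ⟨⟨h1, ?_⟩, ?_⟩
    · have : ((j + 1 : ℕ) : ℝ) ≤ j₂ := h3.trans hj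
      exact_mod_cast this
    · rw [le_mul_rpow_iff hα hp hN (by positivity) hb hl, ← le_div_iff₀ hM]
      push_cast at h3
      refine h3.trans_eq ?_
      rw [hY]; ring
  have h := Finset.card_le_card hsub
  rw [Nat.card_Ico] at h
  have h' : ((⌊Y⌋₊ - j₁ : ℕ) : ℝ) ≤ _ := Nat.cast_le.2 h
  refine le_trans ?_ h'
  have h1 := Nat.lt_floor_add_one Y
  have h2 : (⌊Y⌋₊ : ℝ) ≤ ((⌊Y⌋₊ - j₁ : ℕ) : ℝ) + j₁ := by exact_mod_cast le_tsub_add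
  linarith

section Inner

variable {E : Type*} [NormedAddCommGroup E] [InnerProductSpace ℂ E]

theorem SmallOffDim.const_mul {q : E → ℝ} {c r t : ℝ} (h : SmallOffDim q c r) (ht : 0 ≤ t) :
    SmallOffDim (fun f => t * q f) (t * c) r := by
  obtain ⟨Z, h1, h2, h3⟩ := h
  refine ⟨Z, h1, h2, fun f hf => ?_⟩
  rw [mul_assoc]
  exact mul_le_mul_of_nonneg_left (h3 f hf) ht

theorem smallOffDim_of_le {q : E → ℝ} {c : ℝ} (h : ∀ f, q f ≤ c * ‖f‖ ^ 2) : SmallOffDim q c 0 := by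
  have := smallOffDim_of_inner_eq_zero (ι := Fin 0) (fun _ => (0 : E)) (q := q) (c := c)
    fun f _ => h f
  simpa using this

/-- On every interval of length `1 / 5` the family `φ` is approximated with geometric accuracy
by `n`-dimensional subspaces. -/
def LocallyLowRank (φ : ℝ → E) : Prop :=
  ∃ C, 0 ≤ C ∧ ∀ (a : ℝ) (n : ℕ), ∃ v : Fin n → E, ∀ x ∈ Icc a (a + 1 / 5), ∀ f : E,
    (∀ k, inner ℂ (v k) f = 0) → ‖(inner ℂ (φ x) f : ℂ)‖ ^ 2 ≤ C * (1 / 4) ^ n * ‖f‖ ^ 2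

theorem exists_projection_orthogonal {n : ℕ} (v : Fin n → E) : ∃ P : E →L[ℂ] E,
    (∀ f j, inner ℂ (v j) (P f) = 0) ∧ (∀ f, (∀ j, inner ℂ (v j) f = 0) → P f = f) ∧
      ∀ f g, (inner ℂ (P f) g : ℂ) = inner ℂ f (P g) := by
  set W := Submodule.span ℂ (Set.range v) with hW
  have hfin : FiniteDimensional ℂ W := FiniteDimensional.span_of_finite ℂ (Set.finite_range v)
  refine ⟨Submodule.starProjection (Submodule.orthogonal W), fun f j => ?_, fun f hf => ?_,
    fun f g => Submodule.inner_starProjection_left_eq_right _ f g⟩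
  · exact (Submodule.mem_orthogonal _ _).1 (Submodule.starProjection_apply_mem _ f) _
      (Submodule.subset_span ⟨j, rfl⟩)
  · rw [Submodule.starProjection_eq_self_iff, Submodule.mem_orthogonal]
    intro u hu
    induction hu using Submodule.span_induction with
    | mem x hx => obtain ⟨j, rfl⟩ := hx; exact hf j
    | zero => simp
    | add x y _ _ hx hy => rw [inner_add_left, hx, hy, add_zero]
    | smul c x _ hx => rw [inner_smul_left, hx, mul_zero]

theorem smallOffDim_sum_cells {φ : ℝ → E} (hc : Continuous φ) {C : ℝ} (hC : 0 ≤ C)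
    {ι : Type*} [Fintype ι]
    (a w : ι → ℝ) (k : ι → ℕ) {C₁ δ : ℝ} (hw : ∀ i, 0 ≤ w i) (v : ∀ i, Fin (k i) → E)
    (hv : ∀ i, ∀ x ∈ Icc (a i) (a i + 1 / 5), ∀ f : E,
      (∀ j, inner ℂ (v i j) f = 0) → ‖(inner ℂ (φ x) f : ℂ)‖ ^ 2 ≤ C * (1 / 4) ^ k i * ‖f‖ ^ 2)
    (hC₁ : ∀ i, w i * (C * (1 / 4) ^ k i) ≤ C₁) (hδ : 0 < δ) :
    SmallOffDim (fun f => ∑ i, w i * ∫ x in a i..a i + 1 / 5, ‖(inner ℂ (φ x) f : ℂ)‖ ^ 2) δ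
      (∑ i, (k i : ℝ) + Fintype.card ι * C₁ / δ) := by
  choose P hP0 hP1 hP2 using fun i => exists_projection_orthogonal (v i)
  have hnorm : ∀ i, ∀ x ∈ Icc (a i) (a i + 1 / 5), ‖P i (φ x)‖ ^ 2 ≤ C * (1 / 4) ^ k i :=
    fun i x hx => by
    have h1 := hv i x hx (P i (φ x)) (hP0 i _)
    have h2 : (inner ℂ (φ x) (P i (φ x)) : ℂ) = ((‖P i (φ x)‖ ^ 2 : ℝ) : ℂ) := by
      rw [← hP1 i (P i (φ x)) (hP0 i _), ← hP2, hP1 i (P i (φ x)) (hP0 i _),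
        inner_self_eq_norm_sq_to_K]
      simp
    rw [h2, Complex.norm_real, Real.norm_eq_abs, sq_abs] at h1
    rcases (sq_nonneg ‖P i (φ x)‖).eq_or_lt with h0 | h0
    · rw [← h0]; positivity
    · rw [sq (‖P i (φ x)‖ ^ 2)] at h1
      exact le_of_mul_le_mul_right h1 h0
  have hcP : ∀ i, Continuous fun x => P i (φ x) := fun i => (P i).continuous.comp hc
  have hq' : SmallOffDim (fun f => ∑ i, w i * ∫ x in a i..a i + 1 / 5,
      ‖(inner ℂ f (P i (φ x)) : ℂ)‖ ^ 2) δ (Fintype.card ι * C₁ / δ) := by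
    refine smallOffDim_of_sum_le _ (fun c f => ?_) hδ fun n e he => ?_
    · simp only [inner_smul_left, norm_mul, mul_pow, RCLike.norm_conj,
        intervalIntegral.integral_const_mul]
      rw [Finset.mul_sum]
      exact Finset.sum_congr rfl fun i _ => by ring
    · rw [Finset.sum_comm]
      simp only [← Finset.mul_sum]
      calc ∑ i, w i * ∑ j, ∫ x in a i..a i + 1 / 5, ‖(inner ℂ (e j) (P i (φ x)) : ℂ)‖ ^ 2
          ≤ ∑ i : ι, C₁ := by
            refine Finset.sum_le_sum fun i _ => le_trans (mul_le_mul_of_nonneg_left ?_ (hw i))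
              (hC₁ i)
            have hintvl : ∀ j, IntervalIntegrable (fun x => ‖(inner ℂ (e j) (P i (φ x)) : ℂ)‖ ^ 2)
                volume (a i) (a i + 1 / 5) := fun j =>
              ((continuous_const.inner (hcP i)).norm.pow 2).intervalIntegrable _ _
            rw [← intervalIntegral.integral_finsetSum fun j _ => hintvl j]
            refine le_trans (intervalIntegral.integral_mono_on
              (g := fun _ => C * (1 / 4) ^ k i) (by linarith) ?_ (by simp) fun x hx => ?_) ?_
            · exact (continuous_finsetSum _ fun j _ =>
                ((continuous_const.inner (hcP i)).norm.pow 2)).intervalIntegrable _ _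
            · exact (he.sum_inner_products_le (s := Finset.univ) _).trans (hnorm i x hx)
            · rw [intervalIntegral.integral_const, smul_eq_mul]
              have : 0 ≤ C * (1 / 4) ^ k i := by positivity
              linarith
        _ = Fintype.card ι * C₁ := by rw [Finset.sum_const, nsmul_eq_mul, Finset.card_univ]
  have hq'' := smallOffDim_of_inner_eq_zero (fun c : (i : ι) × Fin (k i) => v c.1 c.2)
    (q := fun f => ∑ i, w i * ((∫ x in a i..a i + 1 / 5, ‖(inner ℂ (φ x) f : ℂ)‖ ^ 2) -
      ∫ x in a i..a i + 1 / 5, ‖(inner ℂ f (P i (φ x)) : ℂ)‖ ^ 2)) (c := 0) fun f hf => by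
    rw [zero_mul]
    refine (Finset.sum_eq_zero fun i _ => ?_).le
    rw [mul_eq_zero, sub_eq_zero]
    right
    refine intervalIntegral.integral_congr fun x _ => ?_
    rw [norm_inner_symm, ← hP2, hP1 i f fun j => hf ⟨i, j⟩]
  refine (hq''.add hq').mono (fun f => le_of_eq ?_) (by simp) (le_of_eq ?_)
  · rw [← Finset.sum_add_distrib]
    exact Finset.sum_congr rfl fun i _ => by ring
  · rw [Fintype.card_sigma]
    simp

theorem exists_forall_rpow_mul_pow_le (α C : ℝ) (hα : 0 < α) (hC : 0 ≤ C) :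
    ∃ C₁, 0 ≤ C₁ ∧ ∀ t : ℝ, 0 ≤ t → (5 * t) ^ α * (C * (1 / 4) ^ ⌈√t⌉₊) ≤ C₁ := by
  have hlog : 0 < Real.log 4 := Real.log_pos (by norm_num)
  have ht := (tendsto_rpow_mul_exp_neg_mul_atTop_nhds_zero (2 * α) (Real.log 4) hlog).comp
    tendsto_natCast_atTop_atTop
  obtain ⟨B, hB⟩ := ht.bddAbove_range
  have hB' : ∀ k : ℕ, (k : ℝ) ^ (2 * α) * (1 / 4) ^ k ≤ B := fun k => by
    have h := hB ⟨k, rfl⟩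
    simp only [Function.comp] at h
    have e : Real.exp (-Real.log 4 * k) = (1 / 4) ^ k := by
      rw [mul_comm, Real.exp_nat_mul, Real.exp_neg, Real.exp_log (by norm_num)]
      norm_num
    rwa [e] at h
  have hB0 : 0 ≤ B := le_trans (by positivity) (hB' 0)
  refine ⟨5 ^ α * C * B, by positivity, fun t ht0 => ?_⟩
  have h1 : t ^ α ≤ (⌈√t⌉₊ : ℝ) ^ (2 * α) := by
    rw [Real.rpow_mul (Nat.cast_nonneg _)]
    refine Real.rpow_le_rpow ht0 ?_ hα.le
    rw [Real.rpow_two, ← Real.sqrt_le_left (Nat.cast_nonneg _)]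
    exact Nat.le_ceil _
  rw [Real.mul_rpow (by norm_num) ht0]
  calc 5 ^ α * t ^ α * (C * (1 / 4) ^ ⌈√t⌉₊)
      ≤ 5 ^ α * (⌈√t⌉₊ : ℝ) ^ (2 * α) * (C * (1 / 4) ^ ⌈√t⌉₊) := by gcongr
    _ = 5 ^ α * C * ((⌈√t⌉₊ : ℝ) ^ (2 * α) * (1 / 4) ^ ⌈√t⌉₊) := by ring
    _ ≤ _ := mul_le_mul_of_nonneg_left (hB' _) (by positivity)

theorem sum_range_inv_sqrt_le (N : ℕ) : ∑ i ∈ Finset.range N, 1 / √((i : ℝ) + 1) ≤ 2 * √N := by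
  induction N with
  | zero => simp
  | succ N ih =>
    rw [Finset.sum_range_succ]
    refine (add_le_add_left ih _).trans ?_
    push_cast
    have h1 : 0 < √((N : ℝ) + 1) := Real.sqrt_pos.2 (by positivity)
    have h2 := Real.sq_sqrt (show (0 : ℝ) ≤ (N : ℝ) + 1 by positivity)
    have h3 := Real.sq_sqrt (show (0 : ℝ) ≤ (N : ℝ) by positivity)
    have h4 : 1 / √((N : ℝ) + 1) ≤ 2 * (√((N : ℝ) + 1) - √N) := by
      rw [div_le_iff₀ h1]
      nlinarith [sq_nonneg (√((N : ℝ) + 1) - √N)]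
    linarith

theorem integral_le_sum_cells {g F : ℝ → ℝ} (hg : Continuous g) (hF : Continuous F) {N : ℕ}
    (w : ℕ → ℝ) (hgF : ∀ (i : ℕ) x, (i : ℝ) / 5 ≤ |x| → g x ≤ w i * F x) :
    ∫ x in (-(N / 5 : ℝ))..(N / 5 : ℝ), g x ≤ ∑ i : Bool × Fin N, w i.2 *
      ∫ x in (if i.1 then (i.2 : ℝ) / 5 else -(((i.2 : ℝ) + 1) / 5))..
        (if i.1 then (i.2 : ℝ) / 5 else -(((i.2 : ℝ) + 1) / 5)) + 1 / 5, F x := by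
  have h1 := intervalIntegral.sum_integral_adjacent_intervals (f := g) (μ := volume)
    (a := fun k : ℕ => (k : ℝ) / 5) (n := N) fun k _ => hg.intervalIntegrable _ _
  have h2 := intervalIntegral.sum_integral_adjacent_intervals (f := g) (μ := volume)
    (a := fun k : ℕ => -((k : ℝ) / 5)) (n := N) fun k _ => hg.intervalIntegrable _ _
  have h3 := intervalIntegral.integral_add_adjacent_intervals
    (hg.intervalIntegrable (μ := volume) (-(N / 5 : ℝ)) 0) (hg.intervalIntegrable 0 (N / 5 : ℝ))
  simp only [Nat.cast_zero, zero_div, neg_zero] at h1 h2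
  rw [← h3, ← h1, intervalIntegral.integral_symm, ← h2, ← Finset.sum_neg_distrib,
    Fintype.sum_prod_type, Fintype.sum_bool, add_comm,
    Finset.sum_range fun k => ∫ x in (k : ℝ) / 5..((k + 1 : ℕ) : ℝ) / 5, g x,
    Finset.sum_range fun k => -∫ x in -((k : ℝ) / 5)..-(((k + 1 : ℕ) : ℝ) / 5), g x]
  refine add_le_add (Finset.sum_le_sum fun i _ => ?_) (Finset.sum_le_sum fun i _ => ?_)
  · simp only [if_true]
    rw [← intervalIntegral.integral_const_mul,
      show ((i : ℕ) : ℝ) / 5 + 1 / 5 = ((i + 1 : ℕ) : ℝ) / 5 by push_cast; ring]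
    refine intervalIntegral.integral_mono_on (by push_cast; linarith) (hg.intervalIntegrable _ _)
      ((hF.const_mul _).intervalIntegrable _ _) fun x hx => hgF i x (hx.1.trans (le_abs_self x))
  · simp only [Bool.false_eq_true, if_false]
    rw [← intervalIntegral.integral_const_mul, ← intervalIntegral.integral_symm,
      show -((((i : ℕ) : ℝ) + 1) / 5) + 1 / 5 = -(((i : ℕ) : ℝ) / 5) by ring]
    push_cast
    refine intervalIntegral.integral_mono_on (by linarith) (hg.intervalIntegrable _ _)
      ((hF.const_mul _).intervalIntegrable _ _) fun x hx => hgF i x ?_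
    exact (le_neg.1 hx.2).trans (neg_le_abs x)

theorem eventually_smallOffDim_inner {φ : ℝ → E} (hc : Continuous φ) (hT : LocallyLowRank φ)
    {α δ η : ℝ} (hα : 0 < α) (hδ : 0 < δ) (hη : 0 < η) :
    ∃ ε : ℝ, 0 < ε ∧ ∀ᶠ n : ℕ in atTop, ∀ X : ℝ, 0 ≤ X → X ≤ ε * n →
      SmallOffDim (fun f => ∫ x in -X..X, ((n : ℝ) / (1 + |x|)) ^ α * ‖(inner ℂ (φ x) f : ℂ)‖ ^ 2) δ
        (η * n) := by
  obtain ⟨C, hC, hv⟩ := hT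
  choose v hv using hv
  obtain ⟨C₁, hC₁, hC₁t⟩ := exists_forall_rpow_mul_pow_le α C hα hC
  set e : ℝ := min 1 (η / (24 + 12 * C₁ / δ)) with he
  have hden : 0 < 24 + 12 * C₁ / δ := by positivity
  have he0 : 0 < e := lt_min one_pos (by positivity)
  have he1 : e ≤ 1 := min_le_left _ _
  have he2 : e * (24 + 12 * C₁ / δ) ≤ η := (le_div_iff₀ hden).1 (min_le_right _ _)
  refine ⟨e ^ 2, by positivity, ?_⟩
  filter_upwards [(tendsto_natCast_atTop_atTop (R := ℝ)).eventually_ge_atTop (1 / e ^ 2)]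
    with n hn X hX0 hX
  have hn0 : (0 : ℝ) < n := lt_of_lt_of_le (by positivity) hn
  rw [div_le_iff₀ (by positivity)] at hn
  set N := ⌈5 * (e ^ 2 * n)⌉₊ with hN
  have hN1 : 5 * (e ^ 2 * n) ≤ N := Nat.le_ceil _
  have hN2 : (N : ℝ) ≤ 6 * (e ^ 2 * n) := by
    have := Nat.ceil_lt_add_one (show 0 ≤ 5 * (e ^ 2 * n) by positivity)
    linarith
  have hcell := smallOffDim_sum_cells hc hC (ι := Bool × Fin N)
    (fun i => if i.1 then (i.2 : ℝ) / 5 else -(((i.2 : ℝ) + 1) / 5))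
    (fun i => (5 * ((n : ℝ) / ((i.2 : ℕ) + 1))) ^ α) (fun i => ⌈√((n : ℝ) / ((i.2 : ℕ) + 1))⌉₊)
    (C₁ := C₁) (δ := δ) (fun i => by positivity) (fun i => v _ _) (fun i => hv _ _)
    (fun i => hC₁t _ (by positivity)) hδ
  refine hcell.mono (fun f => ?_) le_rfl ?_
  · have hF : Continuous fun x => ‖(inner ℂ (φ x) f : ℂ)‖ ^ 2 :=
      (hc.inner continuous_const).norm.pow 2
    have hg : Continuous fun x : ℝ => ((n : ℝ) / (1 + |x|)) ^ α * ‖(inner ℂ (φ x) f : ℂ)‖ ^ 2 := by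
      refine Continuous.mul (Continuous.rpow_const (continuous_const.div (by fun_prop)
        fun x => by positivity) fun x => Or.inr hα.le) hF
    refine le_trans ?_ (integral_le_sum_cells (N := N) hg hF
      (fun i => (5 * ((n : ℝ) / (i + 1))) ^ α) fun i x hx => ?_)
    · refine intervalIntegral.integral_mono_interval (by linarith) (by linarith) (by linarith)
        (Eventually.of_forall fun x => ?_) (hg.intervalIntegrable _ _)
      exact mul_nonneg (Real.rpow_nonneg (by positivity) _) (sq_nonneg _)
    · refine mul_le_mul_of_nonneg_right (Real.rpow_le_rpow (by positivity) ?_ hα.le) (sq_nonneg _)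
      rw [mul_div_assoc', div_le_div_iff₀ (by positivity) (by positivity)]
      nlinarith [Nat.cast_nonneg (α := ℝ) i]
  · have hs1 : ∑ i : Bool × Fin N, (⌈√((n : ℝ) / ((i.2 : ℕ) + 1))⌉₊ : ℝ) ≤
        2 * (N + √n * (2 * √N)) := by
      rw [Fintype.sum_prod_type]
      simp only [Fintype.sum_bool]
      rw [← two_mul]
      refine mul_le_mul_of_nonneg_left ?_ (by norm_num)
      rw [← Finset.sum_range fun i => (⌈√((n : ℝ) / ((i : ℕ) + 1))⌉₊ : ℝ)]
      calc ∑ i ∈ Finset.range N, (⌈√((n : ℝ) / ((i : ℕ) + 1))⌉₊ : ℝ)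
          ≤ ∑ i ∈ Finset.range N, (1 + √n * (1 / √((i : ℝ) + 1))) := by
            refine Finset.sum_le_sum fun i _ => ?_
            have := (Nat.ceil_lt_add_one (Real.sqrt_nonneg ((n : ℝ) / ((i : ℕ) + 1)))).le
            rw [Real.sqrt_div hn0.le] at this ⊢
            rw [mul_one_div]
            linarith
        _ ≤ N + √n * (2 * √N) := by
            rw [Finset.sum_add_distrib, ← Finset.mul_sum]
            simp only [Finset.sum_const, Finset.card_range, nsmul_eq_mul, mul_one]
            exact add_le_add_right (mul_le_mul_of_nonneg_left (sum_range_inv_sqrt_le N)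
              (Real.sqrt_nonneg _)) _
    have hs2 : √n * √N ≤ 3 * (e * n) := by
      rw [← Real.sqrt_mul hn0.le]
      refine Real.sqrt_le_iff.2 ⟨by positivity, ?_⟩
      nlinarith [mul_le_mul_of_nonneg_left hN2 hn0.le, mul_pos he0 hn0, sq_nonneg (e * n)]
    have hcard : (Fintype.card (Bool × Fin N) : ℝ) = 2 * N := by simp
    rw [hcard]
    have hee : e ^ 2 * n ≤ e * n := by nlinarith [mul_nonneg he0.le hn0.le]
    have hs3 : 2 * (N : ℝ) * C₁ / δ ≤ 12 * C₁ / δ * (e * n) := by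
      rw [div_mul_eq_mul_div]
      refine div_le_div_of_nonneg_right ?_ hδ.le
      nlinarith [mul_le_mul_of_nonneg_right (hN2.trans (mul_le_mul_of_nonneg_left hee
        (by norm_num : (0 : ℝ) ≤ 6))) hC₁]
    have := mul_le_mul_of_nonneg_right he2 hn0.le
    nlinarith

end Inner

section Assembly

/-- Left endpoint of the `j`-th block of length `M` on the positive (`b = true`) or
negative (`b = false`) half-axis. -/
def blockStart (M : ℝ) (b : Bool) (j : ℕ) : ℝ := if b then j * M else -((j + 1) * M)

theorem pairwise_disjoint_block {M : ℝ} (hM : 0 < M) (j₁ j₂ : ℕ) :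
    Pairwise fun i j : Bool × Finset.Ico j₁ j₂ =>
      Disjoint (Ioc (blockStart M i.1 i.2) (blockStart M i.1 i.2 + M))
        (Ioc (blockStart M j.1 j.2) (blockStart M j.1 j.2 + M)) := by
  have key : ∀ j k : ℕ, j ≠ k → ((j : ℝ) + 1) * M ≤ k * M ∨ ((k : ℝ) + 1) * M ≤ j * M :=
    fun j k hjk => by
    rcases lt_or_gt_of_ne hjk with h | h
    · left; exact mul_le_mul_of_nonneg_right (by exact_mod_cast h) hM.le
    · right; exact mul_le_mul_of_nonneg_right (by exact_mod_cast h) hM.le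
  rintro ⟨b, j, hj⟩ ⟨c, k, hk⟩ hne
  have hj0 : (0 : ℝ) ≤ j * M := by positivity
  have hk0 : (0 : ℝ) ≤ k * M := by positivity
  rw [Set.disjoint_left]
  rintro x ⟨h1, h2⟩ ⟨h3, h4⟩
  cases b <;> cases c <;> simp [blockStart] at h1 h2 h3 h4 hne
  · rcases key j k hne with h | h <;> linarith
  · linarith
  · linarith
  · rcases key j k hne with h | h <;> linarith

/-- A symbol with power-like behaviour at both infinities. -/
structure TailSymbol (α : ℝ) (κ : Bool → ℝ) (s : ℝ → ℝ) : Prop where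
  aestronglyMeasurable : AEStronglyMeasurable s volume
  bound : ∃ C, 0 ≤ C ∧ ∀ x, |s x| ≤ C * (1 + |x|) ^ (-α)
  eq_tail : ∀ b x, 2 ≤ x → s (if b then x else -x) = κ b * x ^ (-α)

variable {E : Type*} [NormedAddCommGroup E] [InnerProductSpace ℂ E]

/-- The properties of the family of exponentials used in the spectral analysis. -/
structure LaplaceFrame (φ : ℝ → E) : Prop where
  inner_eq : ∀ x y, inner ℂ (φ x) (φ y) = (sechKernel (x - y) : ℂ)
  integrable : ∀ f : E, Integrable fun x => ‖(inner ℂ (φ x) f : ℂ)‖ ^ 2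
  integral_le : ∀ f : E, ∫ x, ‖(inner ℂ (φ x) f : ℂ)‖ ^ 2 ≤ Real.pi * ‖f‖ ^ 2
  locallyLowRank : LocallyLowRank φ

/-- The quadratic form with symbol `s`. -/
def symbolForm (s : ℝ → ℝ) (φ : ℝ → E) (f : E) : ℝ := ∫ x, s x * ‖(inner ℂ (φ x) f : ℂ)‖ ^ 2

variable {α : ℝ} {κ : Bool → ℝ} {s : ℝ → ℝ} {φ : ℝ → E}

theorem TailSymbol.exists_abs_le (hs : TailSymbol α κ s) (hα : 0 < α) :
    ∃ C, 0 ≤ C ∧ ∀ x, |s x| ≤ C := by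
  obtain ⟨C, hC, h⟩ := hs.bound
  refine ⟨C, hC, fun x => (h x).trans (mul_le_of_le_one_right hC ?_)⟩
  exact Real.rpow_le_one_of_one_le_of_nonpos (by linarith [abs_nonneg x]) (by linarith)

theorem TailSymbol.neg (hs : TailSymbol α κ s) :
    TailSymbol α (fun b => -κ b) (fun x => -s x) := by
  refine ⟨hs.1.neg, ?_, fun b x hx => ?_⟩
  · simpa only [abs_neg] using hs.bound
  · rw [hs.eq_tail b x hx]; ring

theorem TailSymbol.integrable_mul (hs : TailSymbol α κ s) (hα : 0 < α) {F : ℝ → ℝ}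
    (hF : Integrable F) : Integrable fun x => s x * F x := by
  obtain ⟨C, hC, h⟩ := hs.exists_abs_le hα
  exact hF.bdd_mul hs.1 (Eventually.of_forall fun x => by rw [Real.norm_eq_abs]; exact h x)

theorem mul_rpow_neg_eq_div_rpow {N x : ℝ} (hN : 0 ≤ N) (hx : 0 ≤ x) :
    N ^ α * x ^ (-α) = (N / x) ^ α := by
  rw [Real.rpow_neg hx, Real.div_rpow hN hx, div_eq_mul_inv]

theorem exists_mem_block {M : ℝ} (hM : 0 < M) {j₁ : ℕ} {x : ℝ}
    (hx : x ∉ Ioc (-(j₁ * M)) (j₁ * M)) : ∃ b : Bool, ∃ j : ℕ, j₁ ≤ j ∧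
      x ∈ Ioc (blockStart M b j) (blockStart M b j + M) ∧ ∃ y, j * M ≤ y ∧ y = |x| ∧
        x = if b then y else -y := by
  have h0 : 0 ≤ j₁ * M := by positivity
  rcases lt_or_ge (j₁ * M) x with h | h
  · have hx0 : 0 < x := h0.trans_lt h
    have h1 : j₁ < ⌈x / M⌉₊ := Nat.lt_ceil.2 ((lt_div_iff₀ hM).2 h)
    have h2 := Nat.ceil_lt_add_one (show 0 ≤ x / M by positivity)
    have h3 := Nat.le_ceil (x / M)
    obtain ⟨j, hj⟩ : ∃ j, ⌈x / M⌉₊ = j + 1 := ⟨⌈x / M⌉₊ - 1, by omega⟩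
    rw [hj] at h1 h2 h3
    push_cast at h2 h3
    have h4 : j * M < x := (lt_div_iff₀ hM).1 (by linarith)
    rw [div_le_iff₀ hM] at h3
    refine ⟨true, j, by omega, ⟨?_, ?_⟩, x, h4.le, (abs_of_pos hx0).symm, by simp⟩ <;>
      simp only [blockStart, if_true] <;> linarith
  · have h5 : j₁ * M ≤ -x := by
      by_contra! h6
      exact hx ⟨by linarith, h⟩
    have h1 := Nat.floor_le (show 0 ≤ -x / M from div_nonneg (by linarith) hM.le)
    have h2 := Nat.lt_floor_add_one (-x / M)
    rw [le_div_iff₀ hM] at h1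
    rw [div_lt_iff₀ hM] at h2
    refine ⟨false, ⌊-x / M⌋₊, Nat.le_floor ((le_div_iff₀ hM).2 h5), ⟨?_, ?_⟩, -x, h1,
      (abs_of_nonpos (by linarith)).symm, by simp⟩ <;>
      simp only [blockStart, Bool.false_eq_true, if_false] <;> linarith

theorem TailSymbol.rpow_mul_le (hs : TailSymbol α κ s) (hα : 0 < α) {C : ℝ} (hC : 0 ≤ C)
    (hsC : ∀ x, |s x| ≤ C * (1 + |x|) ^ (-α)) {N M : ℝ} (hN : 0 < N) (hM : 0 < M) {j₁ j₂ : ℕ}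
    (hj₁ : 1 ≤ j₁) (hj₂ : 1 ≤ j₂) (hj : 2 ≤ j₁ * M) {F : ℝ → ℝ} (hF : ∀ x, 0 ≤ F x) (x : ℝ) :
    N ^ α * (s x * F x) ≤ C * (Ioc (-(j₁ * M)) (j₁ * M)).indicator
      (fun x => (N / (1 + |x|)) ^ α * F x) x +
      ∑ i : Bool × Finset.Ico j₁ j₂, max (κ i.1) 0 * (N / (i.2 * M)) ^ α *
        (Ioc (blockStart M i.1 i.2) (blockStart M i.1 i.2 + M)).indicator F x +
      C * (N / (j₂ * M)) ^ α * F x := by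
  have hmain : N ^ α * (s x * F x) ≤ C * ((N / (1 + |x|)) ^ α * F x) := by
    rw [← mul_rpow_neg_eq_div_rpow hN.le (by positivity)]
    have := mul_le_mul_of_nonneg_left (mul_le_mul_of_nonneg_right
      ((le_abs_self _).trans (hsC x)) (hF x)) (Real.rpow_nonneg hN.le α)
    linarith
  have t1 : 0 ≤ C * (Ioc (-(j₁ * M)) (j₁ * M)).indicator
      (fun x => (N / (1 + |x|)) ^ α * F x) x :=
    mul_nonneg hC (indicator_nonneg (fun x _ => mul_nonneg (by positivity) (hF x)) x)
  have t2 : ∀ i : Bool × Finset.Ico j₁ j₂, 0 ≤ max (κ i.1) 0 * (N / (i.2 * M)) ^ α *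
        (Ioc (blockStart M i.1 i.2) (blockStart M i.1 i.2 + M)).indicator F x := fun i =>
    mul_nonneg (mul_nonneg (le_max_right _ _) (by positivity)) (indicator_nonneg (fun x _ => hF x) x)
  have t2' := Finset.sum_nonneg fun i (_ : i ∈ Finset.univ) => t2 i
  have t3 : 0 ≤ C * (N / (j₂ * M)) ^ α * F x := mul_nonneg (by positivity) (hF x)
  by_cases hx : x ∈ Ioc (-(j₁ * M)) (j₁ * M)
  · rw [indicator_of_mem hx] at t1 ⊢
    linarith
  obtain ⟨b, j, hjj, hxb, y, hjy, hy, hxy⟩ := exists_mem_block hM hx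
  rcases lt_or_ge j j₂ with h | h
  · have hsingle := Finset.single_le_sum (fun i _ => t2 i)
      (Finset.mem_univ ((b, ⟨j, Finset.mem_Ico.2 ⟨hjj, h⟩⟩) : Bool × Finset.Ico j₁ j₂))
    have hjM : 0 < j * M := by
      have : (0 : ℝ) < j := by exact_mod_cast (show 0 < j by omega)
      positivity
    have hj2 : j₁ * M ≤ j * M := mul_le_mul_of_nonneg_right (by exact_mod_cast hjj) hM.le
    have hy0 : 0 < y := hjM.trans_le hjy
    simp only at hsingle
    rw [indicator_of_mem hxb] at hsingle
    have : N ^ α * (s x * F x) ≤ max (κ b) 0 * (N / (j * M)) ^ α * F x := by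
      rw [hxy, hs.eq_tail b y (by linarith), ← hxy]
      calc N ^ α * (κ b * y ^ (-α) * F x) = κ b * (N / y) ^ α * F x := by
            rw [← mul_rpow_neg_eq_div_rpow hN.le hy0.le]; ring
        _ ≤ max (κ b) 0 * (N / y) ^ α * F x := mul_le_mul_of_nonneg_right
            (mul_le_mul_of_nonneg_right (le_max_left _ _) (by positivity)) (hF x)
        _ ≤ max (κ b) 0 * (N / (j * M)) ^ α * F x := by
            refine mul_le_mul_of_nonneg_right (mul_le_mul_of_nonneg_left ?_ (le_max_right _ _))
              (hF x)
            exact Real.rpow_le_rpow (by positivity) (by gcongr) hα.le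
    linarith
  · have hj2 : j₂ * M ≤ j * M := mul_le_mul_of_nonneg_right (by exact_mod_cast h) hM.le
    have hj0 : (0 : ℝ) < j₂ := by exact_mod_cast hj₂
    have : C * ((N / (1 + |x|)) ^ α * F x) ≤ C * (N / (j₂ * M)) ^ α * F x := by
      rw [mul_assoc]
      refine mul_le_mul_of_nonneg_left (mul_le_mul_of_nonneg_right ?_ (hF x)) hC
      refine Real.rpow_le_rpow (by positivity) ?_ hα.le
      exact div_le_div_of_nonneg_left hN.le (by positivity) (by linarith)
    linarith

theorem LaplaceFrame.rpow_mul_symbolForm_le (hφ : LaplaceFrame φ) (hs : TailSymbol α κ s)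
    (hα : 0 < α) {C : ℝ} (hC : 0 ≤ C)
    (hsC : ∀ x, |s x| ≤ C * (1 + |x|) ^ (-α)) {N M : ℝ} (hN : 0 < N) (hM : 0 < M) {j₁ j₂ : ℕ}
    (hj₁ : 1 ≤ j₁) (hj₂ : 1 ≤ j₂) (hj : 2 ≤ j₁ * M) (f : E) :
    N ^ α * symbolForm s φ f ≤ C * (∫ x in -(j₁ * M)..j₁ * M, (N / (1 + |x|)) ^ α *
        ‖(inner ℂ (φ x) f : ℂ)‖ ^ 2) +
      (∑ i : Bool × Finset.Ico j₁ j₂, max (κ i.1) 0 * (N / (i.2 * M)) ^ α *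
        ∫ x in blockStart M i.1 i.2..blockStart M i.1 i.2 + M, ‖(inner ℂ (φ x) f : ℂ)‖ ^ 2) +
      C * (N / (j₂ * M)) ^ α * Real.pi * ‖f‖ ^ 2 := by
  set F : ℝ → ℝ := fun x => ‖(inner ℂ (φ x) f : ℂ)‖ ^ 2 with hF
  have hF0 : ∀ x, 0 ≤ F x := fun x => sq_nonneg _
  have hFi : Integrable F := hφ.integrable f
  have hc : Continuous φ := continuous_of_inner_eq_sechKernel hφ.inner_eq
  have hFc : Continuous F := (hc.inner continuous_const).norm.pow 2
  have hgc : Continuous fun x : ℝ => (N / (1 + |x|)) ^ α * F x :=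
    (Continuous.rpow_const (continuous_const.div (by fun_prop) fun x => by positivity)
      fun x => Or.inr hα.le).mul hFc
  have i1 : Integrable ((Ioc (-(j₁ * M)) (j₁ * M)).indicator
      (fun x => (N / (1 + |x|)) ^ α * F x)) :=
    (integrable_indicator_iff measurableSet_Ioc).2 (hgc.integrableOn_Ioc)
  have i2 : ∀ i : Bool × Finset.Ico j₁ j₂,
      Integrable ((Ioc (blockStart M i.1 i.2) (blockStart M i.1 i.2 + M)).indicator F) :=
    fun i => hFi.indicator measurableSet_Ioc
  have i1' := i1.const_mul C
  have i2' := integrable_finsetSum Finset.univ fun (i : Bool × Finset.Ico j₁ j₂) _ =>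
    (i2 i).const_mul (max (κ i.1) 0 * (N / (i.2 * M)) ^ α)
  have i3' := hFi.const_mul (C * (N / (j₂ * M)) ^ α)
  have h := integral_mono ((hs.integrable_mul hα hFi).const_mul (N ^ α)) ((i1'.add i2').add i3')
    (fun x => hs.rpow_mul_le hα hC hsC hN hM hj₁ hj₂ hj hF0 x)
  rw [integral_const_mul] at h
  refine h.trans ?_
  rw [integral_add' (i1'.add i2') i3', integral_add' i1' i2', integral_const_mul,
    integral_const_mul, integral_finsetSum _ fun i _ => (i2 i).const_mul _,
    integral_indicator measurableSet_Ioc,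
    intervalIntegral.integral_of_le (show -((j₁ : ℝ) * M) ≤ j₁ * M by
      have : 0 ≤ (j₁ : ℝ) * M := by positivity
      linarith)]
  refine add_le_add (add_le_add le_rfl (Finset.sum_le_sum fun i _ => ?_)) ?_
  · rw [integral_const_mul, integral_indicator measurableSet_Ioc,
      intervalIntegral.integral_of_le (by linarith)]
  · rw [mul_assoc _ Real.pi]
    exact mul_le_mul_of_nonneg_left (hφ.integral_le f) (by positivity)

end Assembly

section Upper

theorem card_filter_triple (A : Finset ℕ) (T : Finset ℤ) (P : Bool → ℕ → ℤ → Prop)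
    [∀ b j m, Decidable (P b j m)] :
    ((Finset.univ.filter fun c : (Bool × A) × T => P c.1.1 c.1.2 c.2).card : ℝ) =
      ∑ b, ∑ m ∈ T, ((A.filter fun j => P b j m).card : ℝ) := by
  simp only [Finset.card_filter, Nat.cast_sum]
  rw [Fintype.sum_prod_type, Fintype.sum_prod_type]
  refine Finset.sum_congr rfl fun b _ => ?_
  rw [Finset.sum_coe_sort A fun j => ∑ m : T, (((if P b j m then 1 else 0 : ℕ)) : ℝ),
    Finset.sum_comm' (t' := Finset.univ) (s' := fun _ => A) (by simp),
    Finset.sum_coe_sort T fun m => ∑ j ∈ A, (((if P b j m then 1 else 0 : ℕ)) : ℝ)]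

/-- The coefficient of the counting function of the eigenvalues. -/
def sideSum (α : ℝ) (κ : Bool → ℝ) : ℝ := ∑ b, max (κ b) 0 ^ (1 / α)

/-- The normalized integral of the power of the symbol. -/
def symbolIntegral (α : ℝ) : ℝ := (2 * Real.pi)⁻¹ * ∫ x, sechSymbol x ^ (1 / α)

theorem sideSum_nonneg (α : ℝ) (κ : Bool → ℝ) : 0 ≤ sideSum α κ :=
  Finset.sum_nonneg fun _ _ => Real.rpow_nonneg (le_max_right _ _) _

theorem symbolIntegral_nonneg (α : ℝ) : 0 ≤ symbolIntegral α :=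
  mul_nonneg (by have := Real.pi_pos; positivity)
    (integral_nonneg fun x => Real.rpow_nonneg (sechSymbol_pos x).le _)

variable {α : ℝ} {κ : Bool → ℝ}

theorem card_block_lt_le (hα : 0 < α) {N l : ℝ} (hN : 0 < N) (hl : 0 < l) {L : ℕ} (hL : 1 ≤ L)
    {j₁ : ℕ} (j₂ : ℕ) (hj₁ : 1 ≤ j₁) :
    ((Finset.univ.filter fun c : (Bool × Finset.Ico j₁ j₂) × blockFreqs L =>
      l < max (κ c.1.1) 0 * (N / (c.1.2 * (L : ℝ) ^ 2)) ^ α * blockSymbol L c.2).card : ℝ) ≤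
      N * (sideSum α κ / l ^ (1 / α)) *
        (symbolIntegral α + Real.pi ^ (1 / α) / (L : ℝ) ^ 2) := by
  have hL0 : (0 : ℝ) < L := by exact_mod_cast hL
  have hM : (0 : ℝ) < (L : ℝ) ^ 2 := by positivity
  rw [card_filter_triple (Finset.Ico j₁ j₂) (blockFreqs L) fun b j m =>
    l < max (κ b) 0 * (N / (j * (L : ℝ) ^ 2)) ^ α * blockSymbol L m]
  calc _ ≤ ∑ b, ∑ m ∈ blockFreqs L, N / (L : ℝ) ^ 2 *
        (max (κ b) 0 * blockSymbol L m / l) ^ (1 / α) :=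
        Finset.sum_le_sum fun b _ => Finset.sum_le_sum fun m _ =>
          card_filter_lt_le hα (le_max_right _ _) hN hM (blockSymbol_pos L m) hl j₂ hj₁
    _ = N / (L : ℝ) ^ 2 * (sideSum α κ / l ^ (1 / α)) *
        ∑ m ∈ blockFreqs L, blockSymbol L m ^ (1 / α) := by
        rw [sideSum, Finset.sum_div, mul_assoc, Finset.sum_mul_sum, Finset.mul_sum]
        refine Finset.sum_congr rfl fun b _ => ?_
        rw [Finset.mul_sum]
        refine Finset.sum_congr rfl fun m _ => ?_
        rw [Real.div_rpow (mul_nonneg (le_max_right _ _) (blockSymbol_pos L m).le) hl.le,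
          Real.mul_rpow (le_max_right _ _) (blockSymbol_pos L m).le]
        ring
    _ ≤ N / (L : ℝ) ^ 2 * (sideSum α κ / l ^ (1 / α)) *
        ((L : ℝ) ^ 2 * symbolIntegral α + Real.pi ^ (1 / α)) :=
        mul_le_mul_of_nonneg_left (sum_blockSymbol_rpow_le (by positivity) hL)
          (mul_nonneg (by positivity) (div_nonneg (sideSum_nonneg _ _) (by positivity)))
    _ = _ := by field_simp

theorem exists_pos_lt_rpow_sub {c μ r k : ℝ} (hr : 0 < r) (hμ : 0 < μ) (h : c < μ ^ r) :
    ∃ δ, 0 < δ ∧ 0 < μ - k * δ ∧ c < (μ - k * δ) ^ r := by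
  have hc : ContinuousAt (fun δ : ℝ => (μ - k * δ) ^ r) 0 :=
    ContinuousAt.rpow_const (by fun_prop) (Or.inr hr.le)
  have h1 : ∀ᶠ δ in 𝓝 (0 : ℝ), c < (μ - k * δ) ^ r :=
    hc.eventually (lt_mem_nhds (by simpa using h))
  have h2 : ∀ᶠ δ in 𝓝 (0 : ℝ), 0 < μ - k * δ :=
    (show ContinuousAt (fun δ : ℝ => μ - k * δ) 0 by fun_prop).eventually
      (lt_mem_nhds (by simpa using hμ))
  obtain ⟨δ, ⟨h3, h4⟩, h5⟩ := (((h1.and h2).filter_mono nhdsWithin_le_nhds).and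
    (self_mem_nhdsWithin : Ioi (0 : ℝ) ∈ 𝓝[>] 0)).exists
  exact ⟨δ, h5, h4, h3⟩

theorem exists_forall_div_rpow_mul_le (hα : 0 < α) {C δ : ℝ} (hC : 0 ≤ C) (hδ : 0 < δ) :
    ∃ A : ℝ, 1 ≤ A ∧ ∀ N Y : ℝ, 0 < N → A * N ≤ Y → C * (N / Y) ^ α ≤ δ := by
  have ht : Tendsto (fun A : ℝ => C * A ^ (-α)) atTop (𝓝 (C * 0)) :=
    (tendsto_rpow_neg_atTop hα).const_mul C
  rw [mul_zero] at ht
  obtain ⟨A, hA, hA1⟩ := ((ht.eventually (gt_mem_nhds hδ)).and (eventually_ge_atTop 1)).exists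
  have hA0 : 0 < A := by linarith
  refine ⟨A, hA1, fun N Y hN hY => le_trans (mul_le_mul_of_nonneg_left ?_ hC) hA.le⟩
  have hY0 : 0 < Y := lt_of_lt_of_le (by positivity) hY
  rw [Real.rpow_neg hA0.le, ← Real.inv_rpow hA0.le]
  refine Real.rpow_le_rpow (by positivity) ?_ hα.le
  rw [div_le_iff₀ hY0, inv_mul_eq_div, le_div_iff₀ hA0]
  linarith

theorem card_block_mul_le {A N L : ℝ} (hL : 0 < L) {j₁ j₂ : ℕ} (h : j₂ * L ^ 2 ≤ 2 * A * N) :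
    ((Fintype.card (Bool × Finset.Ico j₁ j₂) : ℕ) : ℝ) * L ≤ 4 * A * N / L := by
  have e1 : ((Fintype.card (Bool × Finset.Ico j₁ j₂) : ℕ) : ℝ) ≤ 2 * j₂ := by
    rw [Fintype.card_prod, Fintype.card_bool, Fintype.card_coe, Nat.card_Ico]
    push_cast
    have : ((j₂ - j₁ : ℕ) : ℝ) ≤ j₂ := by exact_mod_cast Nat.sub_le _ _
    linarith
  rw [le_div_iff₀ hL]
  nlinarith [mul_le_mul_of_nonneg_right e1 (sq_nonneg L)]

theorem block_remainder_le {S δ A N L c : ℝ} (hS : 0 ≤ S) (hδ : 0 < δ)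
    (hc : c * L ≤ 4 * A * N / L) :
    S ^ 2 * (c * (100 * L)) / δ ^ 2 + S * (c * (30 * L)) / δ ≤
      (400 * A * S ^ 2 / δ ^ 2 + 120 * A * S / δ) * (N / L) := by
  have e2 : S ^ 2 * (c * (100 * L)) / δ ^ 2 ≤ 400 * A * S ^ 2 / δ ^ 2 * (N / L) := by
    calc S ^ 2 * (c * (100 * L)) / δ ^ 2 = 100 * S ^ 2 / δ ^ 2 * (c * L) := by ring
      _ ≤ 100 * S ^ 2 / δ ^ 2 * (4 * A * N / L) :=
        mul_le_mul_of_nonneg_left hc (by positivity)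
      _ = _ := by ring
  have e3 : S * (c * (30 * L)) / δ ≤ 120 * A * S / δ * (N / L) := by
    calc S * (c * (30 * L)) / δ = 30 * S / δ * (c * L) := by ring
      _ ≤ 30 * S / δ * (4 * A * N / L) :=
        mul_le_mul_of_nonneg_left hc (by positivity)
      _ = _ := by ring
  rw [add_mul]
  exact add_le_add e2 e3

theorem block_count_le {ρ I P Q N L η : ℝ} (hρ : 0 ≤ ρ) (hP : 0 ≤ P) (hN : 0 ≤ N) (hL : 1 ≤ L)
    (hK : ρ * P + Q ≤ η * L) :
    N * ρ * (I + P / L ^ 2) + Q * (N / L) ≤ N * (ρ * I) + η * N := by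
  have hL0 : 0 < L := by linarith
  have h1 : N * ρ * P / L ^ 2 ≤ N * ρ * P / L :=
    div_le_div_of_nonneg_left (by positivity) hL0 (by nlinarith)
  have h2 : (ρ * P + Q) * (N / L) ≤ η * N := by
    rw [mul_div_assoc', div_le_iff₀ hL0]
    nlinarith [mul_le_mul_of_nonneg_right hK hN]
  have h3 : N * ρ * (I + P / L ^ 2) = N * (ρ * I) + N * ρ * P / L ^ 2 := by ring
  have h4 : (ρ * P + Q) * (N / L) = N * ρ * P / L + Q * (N / L) := by ring
  linarith

variable {E : Type*} [NormedAddCommGroup E] [InnerProductSpace ℂ E] [CompleteSpace E]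
  {s : ℝ → ℝ} {φ : ℝ → E}

set_option maxHeartbeats 1000000 in
theorem LaplaceFrame.eventually_smallOffDim (hφ : LaplaceFrame φ) (hs : TailSymbol α κ s)
    (hα : 0 < α) {μ : ℝ} (hμ : 0 < μ) (h : sideSum α κ * symbolIntegral α < μ ^ (1 / α)) :
    ∀ᶠ n : ℕ in atTop, ∃ r : ℝ, r < n ∧
      SmallOffDim (symbolForm s φ) (μ * (n : ℝ) ^ (-α)) r := by
  have hpi := Real.pi_pos
  obtain ⟨δ, hδ, hl, hlc⟩ := exists_pos_lt_rpow_sub (k := 5) (by positivity) hμ h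
  set l := μ - 5 * δ with hl_def
  have hlr : 0 < l ^ (1 / α) := by positivity
  set ρ := sideSum α κ / l ^ (1 / α) with hρ
  have hρ0 : 0 ≤ ρ := div_nonneg (sideSum_nonneg _ _) hlr.le
  have hρI : ρ * symbolIntegral α < 1 := by
    rw [hρ, div_mul_eq_mul_div, div_lt_one hlr]; exact hlc
  set η := (1 - ρ * symbolIntegral α) / 4 with hη_def
  have hη : 0 < η := by rw [hη_def]; linarith
  obtain ⟨C, hC, hsC⟩ := hs.bound
  obtain ⟨A, hA1, hA⟩ := exists_forall_div_rpow_mul_le hα (mul_nonneg hC hpi.le) hδ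
  have hc : Continuous φ := continuous_of_inner_eq_sechKernel hφ.inner_eq
  obtain ⟨ε, hε, hin⟩ := eventually_smallOffDim_inner hc hφ.locallyLowRank hα
    (δ := δ / (C + 1)) (by positivity) hη
  set p : ℝ := max (κ true) 0 + max (κ false) 0 with hp_def
  have hp0 : 0 ≤ p := add_nonneg (le_max_right _ _) (le_max_right _ _)
  have hp : ∀ b, max (κ b) 0 ≤ p := fun b => by
    cases b
    · exact le_add_of_nonneg_left (le_max_right _ _)
    · exact le_add_of_nonneg_right (le_max_right _ _)
  set S := p * (2 / ε) ^ α with hS_def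
  have hS0 : 0 ≤ S := by positivity
  set K := ρ * Real.pi ^ (1 / α) + (400 * A * S ^ 2 / δ ^ 2 + 120 * A * S / δ) with hK
  obtain ⟨L, hL1, hLK⟩ : ∃ L : ℕ, 1 ≤ L ∧ K ≤ η * L := by
    obtain ⟨L, hL⟩ := exists_nat_ge (K / η)
    refine ⟨L + 1, by omega, ?_⟩
    rw [div_le_iff₀ hη] at hL
    push_cast
    linarith
  have hL1' : (1 : ℝ) ≤ L := by exact_mod_cast hL1
  have hL0 : (0 : ℝ) < L := by linarith
  set M : ℝ := (L : ℝ) ^ 2 with hM_def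
  have hM : 0 < M := by positivity
  filter_upwards [hin, (tendsto_natCast_atTop_atTop (R := ℝ)).eventually_ge_atTop
    ((2 * M + 4) / ε + M)] with n hn hnb
  have hq : 0 < (2 * M + 4) / ε := by positivity
  have hn0 : (0 : ℝ) < n := by linarith
  have hnε : 2 * M + 4 ≤ ε * n := by
    rw [← div_le_iff₀' hε]; linarith
  have hnM : M ≤ n := by linarith
  set j₁ := ⌊ε * n / M⌋₊ with hj₁_def
  set j₂ := ⌈A * n / M⌉₊ with hj₂_def
  have hj₁_le : j₁ * M ≤ ε * n := (le_div_iff₀ hM).1 (Nat.floor_le (by positivity))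
  have hj₁_ge : ε * n / 2 ≤ j₁ * M := by
    have := (div_lt_iff₀ hM).1 (Nat.lt_floor_add_one (ε * n / M))
    linarith
  have hj₁ : 1 ≤ j₁ := Nat.le_floor (by rw [Nat.cast_one, le_div_iff₀ hM]; linarith)
  have hj₂_ge : A * n ≤ j₂ * M := (div_le_iff₀ hM).1 (Nat.le_ceil _)
  have hj₂_le : j₂ * M ≤ 2 * A * n := by
    have := Nat.ceil_lt_add_one (show 0 ≤ A * n / M by positivity)
    have : j₂ * M ≤ (A * n / M + 1) * M := mul_le_mul_of_nonneg_right this.le hM.le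
    rw [add_mul, div_mul_cancel₀ _ hM.ne', one_mul] at this
    nlinarith
  have hj₂ : 1 ≤ j₂ := Nat.one_le_ceil_iff.2 (by positivity)
  have hwS : ∀ i : Bool × Finset.Ico j₁ j₂, max (κ i.1) 0 * ((n : ℝ) / (i.2 * M)) ^ α ≤ S :=
    fun i => by
    refine mul_le_mul (hp _) (Real.rpow_le_rpow (by positivity) ?_ hα.le) (by positivity) hp0
    have h1 : j₁ * M ≤ (i.2 : ℕ) * M :=
      mul_le_mul_of_nonneg_right (by exact_mod_cast (Finset.mem_Ico.1 i.2.2).1) hM.le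
    have h2 : 0 < ε * n / 2 := by positivity
    rw [div_le_div_iff₀ (by linarith) hε]
    linarith
  have hblock := smallOffDim_sum_block hφ.inner_eq hL1
    (fun i : Bool × Finset.Ico j₁ j₂ => blockStart M i.1 i.2) (pairwise_disjoint_block hM j₁ j₂)
    (fun i => mul_nonneg (le_max_right _ _) (by positivity)) hwS hδ hl.le
  have hcount := card_block_lt_le (κ := κ) hα hn0 hl hL1 j₂ hj₁
  have hinner := (hn (j₁ * M) (by positivity) hj₁_le).const_mul hC
  have houter := smallOffDim_of_le (E := E) (q := fun f => C * (n / (j₂ * M)) ^ α * Real.pi *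
    ‖f‖ ^ 2) (c := δ) fun f => by
      refine mul_le_mul_of_nonneg_right ?_ (sq_nonneg _)
      rw [mul_right_comm]
      exact hA n _ hn0 hj₂_ge
  have hCδ : C * (δ / (C + 1)) ≤ δ := by
    rw [mul_div_assoc', div_le_iff₀ (by positivity)]
    nlinarith
  have hsum := (hinner.add hblock).add houter
  have hsum' : SmallOffDim (fun f => (n : ℝ) ^ α * symbolForm s φ f) μ _ :=
    hsum.mono (fun f => hφ.rpow_mul_symbolForm_le hs hα hC hsC hn0 hM hj₁ hj₂
      (by linarith) f) (by linarith) le_rfl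
  have hsum'' := hsum'.const_mul (Real.rpow_nonneg hn0.le (-α))
  refine ⟨_, ?_, hsum''.mono (fun f => ?_) (by rw [mul_comm]) le_rfl⟩
  · have e1 := block_remainder_le hS0 hδ (card_block_mul_le (j₁ := j₁) hL0 hj₂_le)
    have e2 := block_count_le (I := symbolIntegral α) (N := n) hρ0
      (Real.rpow_nonneg hpi.le (1 / α)) hn0.le hL1' hLK
    have e6 : (1 - ρ * symbolIntegral α) * n = 4 * η * n := by rw [hη_def]; ring
    have e7 : 0 < η * n := by positivity
    rw [add_zero]
    linarith
  · rw [← mul_assoc, ← Real.rpow_add hn0, neg_add_cancel, Real.rpow_zero, one_mul]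

end Upper

section Lower

variable {α : ℝ} {κ : Bool → ℝ}

theorem exists_pos_rpow_add_lt {c μ r k : ℝ} (hr : 0 < r) (h : μ ^ r < c) :
    ∃ δ, 0 < δ ∧ (μ + k * δ) ^ r < c := by
  have hc : ContinuousAt (fun δ : ℝ => (μ + k * δ) ^ r) 0 :=
    ContinuousAt.rpow_const (by fun_prop) (Or.inr hr.le)
  have h1 : ∀ᶠ δ in 𝓝 (0 : ℝ), (μ + k * δ) ^ r < c :=
    hc.eventually (gt_mem_nhds (by simpa using h))
  obtain ⟨δ, h3, h5⟩ := ((h1.filter_mono nhdsWithin_le_nhds).and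
    (self_mem_nhdsWithin : Ioi (0 : ℝ) ∈ 𝓝[>] 0)).exists
  exact ⟨δ, h5, h3⟩

theorem le_card_block_le (hα : 0 < α) {N l A ε η : ℝ} (hN : 0 < N) (hl : 0 < l) {L R : ℕ}
    (hL : 1 ≤ L) (hR : 1 ≤ R) (hRL : R ≤ L) {j₁ j₂ : ℕ}
    (hA : ∀ b, (max (κ b) 0 * Real.pi / l) ^ (1 / α) ≤ A) (hj₂ : A * N ≤ j₂ * (L : ℝ) ^ 2)
    (hj₁ : j₁ * (L : ℝ) ^ 2 ≤ ε * N)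
    (hsum : (L : ℝ) ^ 2 * (symbolIntegral α - η) - Real.pi ^ (1 / α) ≤
      ∑ m ∈ Finset.Icc (-((R * L ^ 2 : ℕ) : ℤ)) (R * L ^ 2 : ℕ), blockSymbol L m ^ (1 / α)) :
    N * (sideSum α κ / l ^ (1 / α)) * (symbolIntegral α - η - Real.pi ^ (1 / α) / (L : ℝ) ^ 2) -
        6 * R * ((L : ℝ) ^ 2 + ε * N) ≤
      ((Finset.univ.filter fun c : (Bool × Finset.Ico j₁ j₂) × blockFreqs L =>
        l ≤ max (κ c.1.1) 0 * (N / ((c.1.2 + 1) * (L : ℝ) ^ 2)) ^ α * blockSymbol L c.2).card : ℝ)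
      := by
  have hpi := Real.pi_pos
  have hL0 : (1 : ℝ) ≤ L := by exact_mod_cast hL
  have hR0 : (1 : ℝ) ≤ R := by exact_mod_cast hR
  set M : ℝ := (L : ℝ) ^ 2 with hM_def
  have hM : 1 ≤ M := one_le_pow₀ hL0
  have hM0 : 0 < M := by linarith
  set T := Finset.Icc (-((R * L ^ 2 : ℕ) : ℤ)) (R * L ^ 2 : ℕ) with hT
  have hTsub : T ⊆ blockFreqs L := by
    have : R * L ^ 2 ≤ L ^ 3 := by rw [pow_succ' L 2]; exact Nat.mul_le_mul_right _ hRL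
    have h' : ((R * L ^ 2 : ℕ) : ℤ) ≤ ((L ^ 3 : ℕ) : ℤ) := by exact_mod_cast this
    exact Finset.Icc_subset_Icc (neg_le_neg h') h'
  have hTcard : (T.card : ℝ) ≤ 3 * R * M := by
    have : T.card = 2 * (R * L ^ 2) + 1 := by
      rw [hT, Int.card_Icc]; omega
    rw [this]
    push_cast
    nlinarith
  rw [card_filter_triple (Finset.Ico j₁ j₂) (blockFreqs L) fun b j m =>
    l ≤ max (κ b) 0 * (N / ((j + 1) * M)) ^ α * blockSymbol L m]
  have hρ : 0 ≤ sideSum α κ / l ^ (1 / α) := div_nonneg (sideSum_nonneg _ _) (by positivity)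
  have hj : (1 + (j₁ : ℝ)) * M ≤ M + ε * N := by linarith
  have hbm : ∀ m, blockSymbol L m ≤ Real.pi := fun m => by
    rw [blockSymbol, sechSymbol]
    exact div_le_self hpi.le (Real.one_le_cosh _)
  calc _ ≤ N / M * (sideSum α κ / l ^ (1 / α)) * (M * (symbolIntegral α - η) -
        Real.pi ^ (1 / α)) - 2 * (T.card * (1 + j₁)) := by
        have h1 : (T.card : ℝ) * (1 + j₁) ≤ 3 * R * M * (1 + j₁) :=
          mul_le_mul_of_nonneg_right hTcard (by positivity)
        have h2 : 3 * R * ((1 + (j₁ : ℝ)) * M) ≤ 3 * R * (M + ε * N) :=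
          mul_le_mul_of_nonneg_left hj (by positivity)
        have h3 : N * (sideSum α κ / l ^ (1 / α)) *
            (symbolIntegral α - η - Real.pi ^ (1 / α) / M) =
            N / M * (sideSum α κ / l ^ (1 / α)) * (M * (symbolIntegral α - η) -
              Real.pi ^ (1 / α)) := by
          field_simp
        rw [h3]
        linarith
    _ ≤ N / M * (sideSum α κ / l ^ (1 / α)) * (∑ m ∈ T, blockSymbol L m ^ (1 / α)) -
        2 * (T.card * (1 + j₁)) :=
        sub_le_sub_right (mul_le_mul_of_nonneg_left hsum (by positivity)) _
    _ = ∑ b, ∑ m ∈ T, (N / M * (max (κ b) 0 * blockSymbol L m / l) ^ (1 / α) - 1 - j₁) := by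
        simp only [sub_sub, Finset.sum_sub_distrib, Finset.sum_const, nsmul_eq_mul,
          Finset.card_univ, Fintype.card_bool]
        congr 1
        rw [sideSum, Finset.sum_div, mul_assoc, Finset.sum_mul_sum, Finset.mul_sum]
        refine Finset.sum_congr rfl fun b _ => ?_
        rw [Finset.mul_sum]
        refine Finset.sum_congr rfl fun m _ => ?_
        rw [Real.div_rpow (mul_nonneg (le_max_right _ _) (blockSymbol_pos L m).le) hl.le,
          Real.mul_rpow (le_max_right _ _) (blockSymbol_pos L m).le]
        ring
    _ ≤ ∑ b, ∑ m ∈ T, (((Finset.Ico j₁ j₂).filter fun j : ℕ =>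
          l ≤ max (κ b) 0 * (N / ((j + 1) * M)) ^ α * blockSymbol L m).card : ℝ) := by
        refine Finset.sum_le_sum fun b _ => Finset.sum_le_sum fun m _ => ?_
        refine le_card_filter_le hα (le_max_right _ _) hN hM0 (blockSymbol_pos L m) hl j₁ ?_
        have : (max (κ b) 0 * blockSymbol L m / l) ^ (1 / α) ≤ A := by
          refine le_trans (Real.rpow_le_rpow ?_ ?_ (by positivity)) (hA b)
          · exact div_nonneg (mul_nonneg (le_max_right _ _) (blockSymbol_pos L m).le) hl.le
          · exact div_le_div_of_nonneg_right
              (mul_le_mul_of_nonneg_left (hbm m) (le_max_right _ _)) hl.le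
        calc N / M * (max (κ b) 0 * blockSymbol L m / l) ^ (1 / α) ≤ N / M * A :=
              mul_le_mul_of_nonneg_left this (by positivity)
          _ ≤ j₂ := by rw [div_mul_eq_mul_div, div_le_iff₀ hM0]; linarith
    _ ≤ _ := Finset.sum_le_sum fun b _ => Finset.sum_le_sum_of_subset_of_nonneg hTsub
        fun _ _ _ => Nat.cast_nonneg _

/-- The complement of the half-lines where the symbol is positive. -/
def badSet (κ : Bool → ℝ) : Set ℝ :=
  {x | (0 < κ true → x < 2) ∧ (0 < κ false → -2 < x)}

theorem measurableSet_badSet (κ : Bool → ℝ) : MeasurableSet (badSet κ) := by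
  have h1 : MeasurableSet {x : ℝ | 0 < κ true → x < 2} := by
    by_cases h : 0 < κ true
    · exact (measurableSet_Iio (a := (2 : ℝ))).congr (by ext; simp [h])
    · simp [h]
  have h2 : MeasurableSet {x : ℝ | 0 < κ false → -2 < x} := by
    by_cases h : 0 < κ false
    · exact (measurableSet_Ioi (a := (-2 : ℝ))).congr (by ext; simp [h])
    · simp [h]
  exact h1.inter h2

theorem abs_le_of_mem_block {M : ℝ} (hM : 0 ≤ M) {b : Bool} {j : ℕ} {x : ℝ}
    (hx : x ∈ Icc (blockStart M b j) (blockStart M b j + M)) :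
    x = (if b then |x| else -|x|) ∧ j * M ≤ |x| ∧ |x| ≤ (j + 1) * M := by
  have h0 : 0 ≤ j * M := by positivity
  obtain ⟨h1, h2⟩ := hx
  cases b <;> simp only [blockStart, if_true, if_false, Bool.false_eq_true] at h1 h2 ⊢
  · have hx0 : x ≤ 0 := by linarith
    rw [abs_of_nonpos hx0]
    exact ⟨by ring, by linarith, by linarith⟩
  · have hx0 : 0 ≤ x := by linarith
    rw [abs_of_nonneg hx0]
    exact ⟨rfl, by linarith, by linarith⟩

theorem le_abs_sub_of_mem_badSet {M : ℝ} (hM : 0 ≤ M) {b : Bool} (hb : 0 < κ b) {j₁ j : ℕ}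
    (hj : j₁ ≤ j) {x y : ℝ} (hx : x ∈ Icc (blockStart M b j) (blockStart M b j + M))
    (hy : y ∈ badSet κ) : j₁ * M - 4 + |y| ≤ |x - y| := by
  obtain ⟨h1, h2, -⟩ := abs_le_of_mem_block hM hx
  have h3 : j₁ * M ≤ j * M := mul_le_mul_of_nonneg_right (by exact_mod_cast hj) hM
  cases b
  · have := hy.2 hb
    simp only [Bool.false_eq_true, if_false] at h1
    have h4 := neg_le_abs (x - y)
    rcases abs_cases y with ⟨h5, _⟩ | ⟨h5, _⟩ <;> rw [h5] <;> linarith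
  · have := hy.1 hb
    simp only [if_true] at h1
    have h4 := le_abs_self (x - y)
    rcases abs_cases y with ⟨h5, _⟩ | ⟨h5, _⟩ <;> rw [h5] <;> linarith

variable {s : ℝ → ℝ}

theorem TailSymbol.sum_block_le (hs : TailSymbol α κ s) (hα : 0 < α) {C : ℝ}
    (hsC : ∀ x, |s x| ≤ C) {N M : ℝ} (hN : 0 < N) (hM : 0 < M) {j₁ j₂ : ℕ}
    (hj : 2 ≤ j₁ * M) {F : ℝ → ℝ} (hF : ∀ x, 0 ≤ F x) (x : ℝ) :
    ∑ i : Bool × Finset.Ico j₁ j₂, max (κ i.1) 0 * (N / ((i.2 + 1) * M)) ^ α *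
        (Ioc (blockStart M i.1 i.2) (blockStart M i.1 i.2 + M)).indicator F x ≤
      N ^ α * (s x * F x) + N ^ α * (C * (badSet κ).indicator F x) := by
  have hC : 0 ≤ C := (abs_nonneg _).trans (hsC x)
  have hbad : 0 ≤ N ^ α * (C * (badSet κ).indicator F x) :=
    mul_nonneg (by positivity) (mul_nonneg hC (indicator_nonneg (fun x _ => hF x) x))
  have hjj : ∀ i : Bool × Finset.Ico j₁ j₂, j₁ * M ≤ (i.2 : ℕ) * M := fun i =>
    mul_le_mul_of_nonneg_right (by exact_mod_cast (Finset.mem_Ico.1 i.2.2).1) hM.le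
  by_cases hx : ∃ i : Bool × Finset.Ico j₁ j₂, 0 < κ i.1 ∧
      x ∈ Ioc (blockStart M i.1 i.2) (blockStart M i.1 i.2 + M)
  · obtain ⟨i, hi, hxi⟩ := hx
    rw [Finset.sum_eq_single i]
    · obtain ⟨h1, h2, h3⟩ := abs_le_of_mem_block hM.le (Ioc_subset_Icc_self hxi)
      have h4 := hjj i
      have h5 : 0 < |x| := by linarith
      rw [indicator_of_mem hxi, max_eq_left hi.le]
      have h6 : s x = κ i.1 * |x| ^ (-α) := by
        rw [← hs.eq_tail i.1 |x| (by linarith), ← h1]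
      have h7 : N ^ α * (s x * F x) = κ i.1 * (N / |x|) ^ α * F x := by
        rw [h6, ← mul_rpow_neg_eq_div_rpow hN.le h5.le]; ring
      have h8 : κ i.1 * (N / ((i.2 + 1) * M)) ^ α * F x ≤ κ i.1 * (N / |x|) ^ α * F x := by
        refine mul_le_mul_of_nonneg_right (mul_le_mul_of_nonneg_left ?_ hi.le) (hF x)
        exact Real.rpow_le_rpow (by positivity) (by gcongr) hα.le
      linarith
    · intro k _ hk
      rw [indicator_of_notMem, mul_zero]
      exact fun hxk => Set.disjoint_left.1 (pairwise_disjoint_block hM j₁ j₂ hk) hxk hxi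
    · exact fun h => absurd (Finset.mem_univ i) h
  · rw [Finset.sum_eq_zero]
    · by_cases hxb : x ∈ badSet κ
      · rw [indicator_of_mem hxb, ← mul_add, ← add_mul]
        have := neg_le_of_abs_le (hsC x)
        exact mul_nonneg (by positivity) (mul_nonneg (by linarith) (hF x))
      · refine add_nonneg (mul_nonneg (by positivity) (mul_nonneg ?_ (hF x))) hbad
        rw [badSet, mem_ofPred_eq, not_and_or] at hxb
        push Not at hxb
        rcases hxb with ⟨h1, h2⟩ | ⟨h1, h2⟩
        · have := hs.eq_tail true x h2
          simp only [if_true] at this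
          rw [this]
          exact mul_nonneg h1.le (Real.rpow_nonneg (by linarith) _)
        · have := hs.eq_tail false (-x) (by linarith)
          simp only [Bool.false_eq_true, if_false, neg_neg] at this
          rw [this]
          exact mul_nonneg h1.le (Real.rpow_nonneg (by linarith) _)
    · intro i _
      by_cases hi : 0 < κ i.1
      · rw [indicator_of_notMem fun hxi => hx ⟨i, hi, hxi⟩, mul_zero]
      · rw [max_eq_right (not_lt.1 hi), zero_mul, zero_mul]

variable {E : Type*} [NormedAddCommGroup E] [InnerProductSpace ℂ E] {φ : ℝ → E}

theorem LaplaceFrame.sum_block_le (hφ : LaplaceFrame φ) (hs : TailSymbol α κ s) (hα : 0 < α)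
    {C : ℝ} (hsC : ∀ x, |s x| ≤ C) {N M : ℝ} (hN : 0 < N) (hM : 0 < M) {j₁ j₂ : ℕ}
    (hj : 2 ≤ j₁ * M) (f : E) :
    ∑ i : Bool × Finset.Ico j₁ j₂, max (κ i.1) 0 * (N / ((i.2 + 1) * M)) ^ α *
        ∫ x in blockStart M i.1 i.2..blockStart M i.1 i.2 + M, ‖(inner ℂ (φ x) f : ℂ)‖ ^ 2 ≤
      N ^ α * symbolForm s φ f +
        N ^ α * (C * ∫ x in badSet κ, ‖(inner ℂ (φ x) f : ℂ)‖ ^ 2) := by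
  have hFi := hφ.integrable f
  have i2 : ∀ i : Bool × Finset.Ico j₁ j₂,
      Integrable ((Ioc (blockStart M i.1 i.2) (blockStart M i.1 i.2 + M)).indicator
        fun x => ‖(inner ℂ (φ x) f : ℂ)‖ ^ 2) :=
    fun i => hFi.indicator measurableSet_Ioc
  have i3 := (hs.integrable_mul hα hFi).const_mul (N ^ α)
  have i4 := ((hFi.indicator (measurableSet_badSet κ)).const_mul C).const_mul (N ^ α)
  have h := integral_mono (integrable_finsetSum Finset.univ
    fun (i : Bool × Finset.Ico j₁ j₂) _ =>
      (i2 i).const_mul (max (κ i.1) 0 * (N / ((i.2 + 1) * M)) ^ α)) (i3.add i4)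
    (fun x => hs.sum_block_le hα hsC hN hM hj (fun x => sq_nonneg _) x)
  rw [integral_add' i3 i4, integral_const_mul, integral_const_mul, integral_const_mul,
    integral_finsetSum _ fun i _ => (i2 i).const_mul _,
    integral_indicator (measurableSet_badSet κ)] at h
  refine le_trans (le_of_eq (Finset.sum_congr rfl fun i _ => ?_)) h
  rw [integral_const_mul, integral_indicator measurableSet_Ioc,
    intervalIntegral.integral_of_le (by linarith)]

theorem sum_block_sechKernel_le {M : ℝ} (hM : 0 < M) {j₁ j₂ : ℕ}
    {w : Bool × Finset.Ico j₁ j₂ → ℝ} {S : ℝ} (hw : ∀ i, 0 ≤ w i) (hwS : ∀ i, w i ≤ S)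
    (hwκ : ∀ i, κ i.1 ≤ 0 → w i = 0) {y : ℝ} (hy : y ∈ badSet κ) :
    ∑ i, w i * ∫ x in blockStart M i.1 i.2..blockStart M i.1 i.2 + M, sechKernel (x - y) ^ 2 ≤
      S * ((Fintype.card (Bool × Finset.Ico j₁ j₂) : ℕ) : ℝ) * M * Real.exp (4 - j₁ * M) *
        Real.exp (-(1 * |y|)) := by
  have hc : Continuous fun x => sechKernel (x - y) ^ 2 := by
    unfold sechKernel
    exact (Continuous.inv₀ (by fun_prop) fun x => by positivity).pow 2
  have : ∀ i : Bool × Finset.Ico j₁ j₂, i ∈ Finset.univ →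
      w i * (∫ x in blockStart M i.1 i.2..blockStart M i.1 i.2 + M, sechKernel (x - y) ^ 2) ≤
      S * M * Real.exp (4 - j₁ * M) * Real.exp (-(1 * |y|)) := fun i _ => by
    have hS : 0 ≤ S := (hw i).trans (hwS i)
    rcases le_or_gt (κ i.1) 0 with h | h
    · rw [hwκ i h, zero_mul]
      positivity
    have h1 : ∫ x in blockStart M i.1 i.2..blockStart M i.1 i.2 + M, sechKernel (x - y) ^ 2 ≤
        M * (Real.exp (4 - j₁ * M) * Real.exp (-(1 * |y|))) := by
      have := intervalIntegral.integral_mono_on (show blockStart M i.1 i.2 ≤ blockStart M i.1 i.2 + M by linarith) (hc.intervalIntegrable _ _)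
        (continuous_const.intervalIntegrable (μ := volume) _ _) fun x hx =>
          show sechKernel (x - y) ^ 2 ≤ Real.exp (4 - j₁ * M) * Real.exp (-(1 * |y|)) by
        refine (sechKernel_sq_le_exp _).trans ?_
        rw [← Real.exp_add]
        refine Real.exp_le_exp.2 ?_
        have := le_abs_sub_of_mem_badSet hM.le h (Finset.mem_Ico.1 i.2.2).1 hx hy
        linarith
      rwa [intervalIntegral.integral_const, add_sub_cancel_left, smul_eq_mul] at this
    calc _ ≤ S * (M * (Real.exp (4 - j₁ * M) * Real.exp (-(1 * |y|)))) :=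
          mul_le_mul (hwS i) h1 (intervalIntegral.integral_nonneg (by linarith)
            fun x _ => sq_nonneg _) hS
      _ = _ := by ring
  refine (Finset.sum_le_sum this).trans (le_of_eq ?_)
  rw [Finset.sum_const, Finset.card_univ, nsmul_eq_mul]
  ring

end Lower

section LowerBound

variable {α : ℝ} {κ : Bool → ℝ} {s : ℝ → ℝ}
  {E : Type*} [NormedAddCommGroup E] [InnerProductSpace ℂ E] {φ : ℝ → E}

theorem LaplaceFrame.setIntegral_badSet_le (hφ : LaplaceFrame φ) {M : ℝ} (hM : 0 < M)
    {j₁ j₂ : ℕ} {w : Bool × Finset.Ico j₁ j₂ → ℝ} {S : ℝ} (hw : ∀ i, 0 ≤ w i)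
    (hwS : ∀ i, w i ≤ S) (hwκ : ∀ i, κ i.1 ≤ 0 → w i = 0) {k : ℝ} {f : E}
    (hf : ∀ y, k * ‖(inner ℂ (φ y) f : ℂ)‖ ^ 2 ≤ ‖f‖ ^ 2 *
      ∑ i, w i * ∫ x in blockStart M i.1 i.2..blockStart M i.1 i.2 + M,
        sechKernel (x - y) ^ 2) :
    k * ∫ x in badSet κ, ‖(inner ℂ (φ x) f : ℂ)‖ ^ 2 ≤ ‖f‖ ^ 2 *
      (S * ((Fintype.card (Bool × Finset.Ico j₁ j₂) : ℕ) : ℝ) * M * Real.exp (4 - j₁ * M) *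
        ∫ y : ℝ, Real.exp (-(1 * |y|))) := by
  set S' := S * ((Fintype.card (Bool × Finset.Ico j₁ j₂) : ℕ) : ℝ) * M * Real.exp (4 - j₁ * M)
    with hS'
  have hi := integrable_exp_neg_mul_abs one_pos
  have hS0 : 0 ≤ S' := by
    rcases Nat.eq_zero_or_pos (Fintype.card (Bool × Finset.Ico j₁ j₂)) with h | h
    · rw [hS', h]; simp
    · obtain ⟨i⟩ := Fintype.card_pos_iff.1 h
      have := (hw i).trans (hwS i)
      positivity
  calc k * ∫ x in badSet κ, ‖(inner ℂ (φ x) f : ℂ)‖ ^ 2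
      = ∫ x in badSet κ, k * ‖(inner ℂ (φ x) f : ℂ)‖ ^ 2 := (integral_const_mul _ _).symm
    _ ≤ ∫ x in badSet κ, ‖f‖ ^ 2 * S' * Real.exp (-(1 * |x|)) := by
        refine setIntegral_mono_on ((hφ.integrable f).const_mul k).integrableOn
          (hi.const_mul _).integrableOn (measurableSet_badSet κ) fun y hy => ?_
        refine (hf y).trans ?_
        rw [mul_assoc]
        exact mul_le_mul_of_nonneg_left (sum_block_sechKernel_le hM hw hwS hwκ hy) (sq_nonneg _)
    _ ≤ ∫ x, ‖f‖ ^ 2 * S' * Real.exp (-(1 * |x|)) :=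
        setIntegral_le_integral (hi.const_mul _) (Eventually.of_forall fun x => by positivity)
    _ = _ := by rw [integral_const_mul, mul_assoc]

variable [CompleteSpace E]

set_option maxHeartbeats 1000000 in
theorem LaplaceFrame.eventually_exists_submodule (hφ : LaplaceFrame φ) (hs : TailSymbol α κ s)
    (hα : 0 < α) {μ : ℝ} (hμ : 0 < μ) (h : μ ^ (1 / α) < sideSum α κ * symbolIntegral α) :
    ∀ᶠ n : ℕ in atTop, ∃ V : Submodule ℂ E, FiniteDimensional ℂ V ∧
      n ≤ Module.finrank ℂ V ∧
      ∀ f ∈ V, μ * (n : ℝ) ^ (-α) * ‖f‖ ^ 2 ≤ symbolForm s φ f := by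
  have hpi := Real.pi_pos
  obtain ⟨δ, hδ, hlc⟩ := exists_pos_rpow_add_lt (k := 3) (by positivity) h
  set l := μ + 3 * δ with hl_def
  have hl : 0 < l := by positivity
  have hlr : 0 < l ^ (1 / α) := by positivity
  set ρ := sideSum α κ / l ^ (1 / α) with hρ
  have hρ0 : 0 ≤ ρ := div_nonneg (sideSum_nonneg _ _) hlr.le
  have hρI : 1 < ρ * symbolIntegral α := by
    rw [hρ, div_mul_eq_mul_div, one_lt_div hlr]; exact hlc
  set η := (ρ * symbolIntegral α - 1) / 6 with hη_def
  have hη : 0 < η := by rw [hη_def]; linarith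
  set η' := η / (ρ + 1) with hη'_def
  have hη' : 0 < η' := by positivity
  have hρη : ρ * η' ≤ η := by
    rw [hη'_def, mul_div_assoc', div_le_iff₀ (by positivity)]
    nlinarith
  obtain ⟨C, hC, hsC⟩ := hs.exists_abs_le hα
  obtain ⟨R, hR1, hR⟩ := exists_le_sum_blockSymbol_rpow (r := 1 / α) (by positivity) hη'
  have hR1' : (1 : ℝ) ≤ R := by exact_mod_cast hR1
  have hR0 : (0 : ℝ) < R := by linarith
  set ε := η / (6 * R) with hε_def
  have hε : 0 < ε := by positivity
  have hεR : 6 * R * ε = η := by rw [hε_def]; field_simp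
  set p : ℝ := max (κ true) 0 + max (κ false) 0 with hp_def
  have hp0 : 0 ≤ p := add_nonneg (le_max_right _ _) (le_max_right _ _)
  have hp : ∀ b, max (κ b) 0 ≤ p := fun b => by
    cases b
    · exact le_add_of_nonneg_left (le_max_right _ _)
    · exact le_add_of_nonneg_right (le_max_right _ _)
  set A := (p * Real.pi / l) ^ (1 / α) + 1 with hA_def
  have hA1 : 1 ≤ A := le_add_of_nonneg_left (by positivity)
  have hA : ∀ b, (max (κ b) 0 * Real.pi / l) ^ (1 / α) ≤ A := fun b => by
    refine le_trans (Real.rpow_le_rpow ?_ ?_ (by positivity)) (le_add_of_nonneg_right zero_le_one)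
    · exact div_nonneg (mul_nonneg (le_max_right _ _) hpi.le) hl.le
    · exact div_le_div_of_nonneg_right (mul_le_mul_of_nonneg_right (hp b) hpi.le) hl.le
  set S := p * (2 / ε) ^ α with hS_def
  have hS0 : 0 ≤ S := by positivity
  set Q := 400 * A * S ^ 2 / δ ^ 2 + 120 * A * S / δ with hQ
  set K := ρ * Real.pi ^ (1 / α) + Q with hK
  obtain ⟨L, hL1, hRL, hLK⟩ : ∃ L : ℕ, 1 ≤ L ∧ R ≤ L ∧ K ≤ η * L := by
    obtain ⟨L, hL⟩ := exists_nat_ge (K / η)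
    refine ⟨L + R, by omega, by omega, ?_⟩
    rw [div_le_iff₀ hη] at hL
    push_cast
    nlinarith
  have hL1' : (1 : ℝ) ≤ L := by exact_mod_cast hL1
  have hL0 : (0 : ℝ) < L := by linarith
  set M : ℝ := (L : ℝ) ^ 2 with hM_def
  have hM : 0 < M := by positivity
  set J := ∫ y : ℝ, Real.exp (-(1 * |y|)) with hJ
  have hJ0 : 0 ≤ J := integral_nonneg fun y => (Real.exp_pos _).le
  set B := C * S * (4 * A) * Real.exp 4 * J / (l - δ) with hB
  have hlδ : 0 < l - δ := by rw [hl_def]; linarith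
  have hdecay : ∀ᶠ n : ℕ in atTop,
      B * ((n : ℝ) ^ (α + 1) * Real.exp (-(ε / 2) * n)) ≤ δ := by
    have ht := (tendsto_rpow_mul_exp_neg_mul_atTop_nhds_zero (α + 1) (ε / 2)
      (by positivity)).const_mul B
    rw [mul_zero] at ht
    exact ((ht.comp tendsto_natCast_atTop_atTop).eventually (gt_mem_nhds hδ)).mono
      fun n hn => hn.le
  filter_upwards [hdecay, (tendsto_natCast_atTop_atTop (R := ℝ)).eventually_ge_atTop
    ((2 * M + 4) / ε + M + 6 * R * M / η)] with n hn hnb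
  have hq : 0 < (2 * M + 4) / ε := by positivity
  have hq' : 0 < 6 * R * M / η := by positivity
  have hn0 : (0 : ℝ) < n := by linarith
  have hnε : 2 * M + 4 ≤ ε * n := by
    rw [← div_le_iff₀' hε]; linarith
  have hnη : 6 * R * M ≤ η * n := by
    rw [← div_le_iff₀' hη]; linarith
  have hnM : M ≤ n := by linarith
  set j₁ := ⌊ε * n / M⌋₊ with hj₁_def
  set j₂ := ⌈A * n / M⌉₊ with hj₂_def
  have hj₁_le : j₁ * M ≤ ε * n := (le_div_iff₀ hM).1 (Nat.floor_le (by positivity))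
  have hj₁_ge : ε * n / 2 ≤ j₁ * M := by
    have := (div_lt_iff₀ hM).1 (Nat.lt_floor_add_one (ε * n / M))
    linarith
  have hj₂_ge : A * n ≤ j₂ * M := (div_le_iff₀ hM).1 (Nat.le_ceil _)
  have hj₂_le : j₂ * M ≤ 2 * A * n := by
    have := Nat.ceil_lt_add_one (show 0 ≤ A * n / M by positivity)
    have : j₂ * M ≤ (A * n / M + 1) * M := mul_le_mul_of_nonneg_right this.le hM.le
    rw [add_mul, div_mul_cancel₀ _ hM.ne', one_mul] at this
    nlinarith
  set w : Bool × Finset.Ico j₁ j₂ → ℝ := fun i =>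
    max (κ i.1) 0 * ((n : ℝ) / ((i.2 + 1) * M)) ^ α with hw_def
  have hw0 : ∀ i, 0 ≤ w i := fun i => mul_nonneg (le_max_right _ _) (by positivity)
  have hwS : ∀ i, w i ≤ S := fun i => by
    refine mul_le_mul (hp _) (Real.rpow_le_rpow (by positivity) ?_ hα.le) (by positivity) hp0
    have h1 : j₁ * M ≤ (i.2 : ℕ) * M :=
      mul_le_mul_of_nonneg_right (by exact_mod_cast (Finset.mem_Ico.1 i.2.2).1) hM.le
    have h2 : 0 < ε * n / 2 := by positivity
    rw [div_le_div_iff₀ (by linarith) hε]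
    linarith
  have hwκ : ∀ i, κ i.1 ≤ 0 → w i = 0 := fun i hi => by
    rw [hw_def]; simp only [max_eq_right hi, zero_mul]
  obtain ⟨V, hV, hVr, hVf⟩ := exists_submodule_sum_block_ge hφ.inner_eq hL1
    (fun i : Bool × Finset.Ico j₁ j₂ => blockStart M i.1 i.2) (pairwise_disjoint_block hM j₁ j₂)
    hw0 hwS hδ (l := l) (by linarith)
  have hcard := card_block_mul_le (j₁ := j₁) hL0 hj₂_le
  refine ⟨V, hV, ?_, fun f hf => ?_⟩
  · have hcount := le_card_block_le (κ := κ) (j₁ := j₁) hα hn0 hl hL1 hR1 hRL hA hj₂_ge hj₁_le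
      (hR L hL1)
    have e1 := block_remainder_le hS0 hδ hcard
    have e2 := block_count_le (I := 0) (N := n) hρ0
      (Real.rpow_nonneg hpi.le (1 / α)) hn0.le hL1' hLK
    have e3 : 0 ≤ S * (((Fintype.card (Bool × Finset.Ico j₁ j₂) : ℕ) : ℝ) * (30 * L)) / δ := by
      positivity
    have e4 : n * (ρ * η') ≤ n * η := mul_le_mul_of_nonneg_left hρη hn0.le
    have e5 : n * ρ * (symbolIntegral α - η' - Real.pi ^ (1 / α) / M) =
        n * (ρ * symbolIntegral α) - n * (ρ * η') - n * ρ * (0 + Real.pi ^ (1 / α) / M) := by ring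
    have e6 : 6 * R * (M + ε * n) = 6 * R * M + η * n := by rw [← hεR]; ring
    have e7 : n * (ρ * symbolIntegral α) = n + 6 * η * n := by rw [hη_def]; ring
    rw [e5, e6, e7] at hcount
    have e8 : (n : ℝ) ≤ Module.finrank ℂ V := by
      refine le_trans ?_ hVr
      have : 0 < η * n := by positivity
      linarith
    exact_mod_cast e8
  · obtain ⟨hf1, hf2⟩ := hVf f hf
    have b1 := hφ.sum_block_le hs hα hsC hn0 hM (j₂ := j₂) (by linarith : 2 ≤ j₁ * M) f
    have b2 := hφ.setIntegral_badSet_le hM hw0 hwS hwκ hf2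
    set I₀ := ∫ x in badSet κ, ‖(inner ℂ (φ x) f : ℂ)‖ ^ 2
    set c : ℝ := ((Fintype.card (Bool × Finset.Ico j₁ j₂) : ℕ) : ℝ)
    have b3 : S * c * M * Real.exp (4 - j₁ * M) * J ≤
        S * (4 * A * n) * (Real.exp 4 * Real.exp (-(ε / 2) * n)) * J := by
      have h1 : c * M ≤ 4 * A * n := by
        have := (le_div_iff₀ hL0).1 hcard
        rw [hM_def]; linarith
      have h2 : Real.exp (4 - j₁ * M) ≤ Real.exp 4 * Real.exp (-(ε / 2) * n) := by
        rw [← Real.exp_add]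
        exact Real.exp_le_exp.2 (by linarith)
      refine mul_le_mul_of_nonneg_right ?_ hJ0
      rw [mul_assoc S]
      exact mul_le_mul (mul_le_mul_of_nonneg_left h1 hS0) h2 (Real.exp_pos _).le (by positivity)
    have b4 : I₀ ≤ ‖f‖ ^ 2 * (S * (4 * A * n) * (Real.exp 4 * Real.exp (-(ε / 2) * n)) * J) /
        (l - δ) := by
      rw [le_div_iff₀ hlδ, mul_comm]
      exact b2.trans (mul_le_mul_of_nonneg_left b3 (sq_nonneg _))
    have b5 : (n : ℝ) ^ α * (C * I₀) ≤ δ * ‖f‖ ^ 2 := by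
      calc (n : ℝ) ^ α * (C * I₀) ≤ (n : ℝ) ^ α * (C * (‖f‖ ^ 2 * (S * (4 * A * n) *
            (Real.exp 4 * Real.exp (-(ε / 2) * n)) * J) / (l - δ))) := by
            refine mul_le_mul_of_nonneg_left ?_ (by positivity)
            rw [← mul_div_assoc'] at b4 ⊢
            exact mul_le_mul_of_nonneg_left b4 hC
        _ = B * ((n : ℝ) ^ (α + 1) * Real.exp (-(ε / 2) * n)) * ‖f‖ ^ 2 := by
            rw [hB, Real.rpow_add_one hn0.ne']; ring
        _ ≤ δ * ‖f‖ ^ 2 := mul_le_mul_of_nonneg_right hn (sq_nonneg _)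
    have b6 : μ * ‖f‖ ^ 2 ≤ (n : ℝ) ^ α * symbolForm s φ f := by
      have : (l - δ) * ‖f‖ ^ 2 = μ * ‖f‖ ^ 2 + 2 * (δ * ‖f‖ ^ 2) := by rw [hl_def]; ring
      have h0 : 0 ≤ δ * ‖f‖ ^ 2 := by positivity
      have b1' := hf1.trans b1
      linarith
    calc μ * (n : ℝ) ^ (-α) * ‖f‖ ^ 2 = (n : ℝ) ^ (-α) * (μ * ‖f‖ ^ 2) := by ring
      _ ≤ (n : ℝ) ^ (-α) * ((n : ℝ) ^ α * symbolForm s φ f) :=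
        mul_le_mul_of_nonneg_left b6 (by positivity)
      _ = _ := by
        rw [← mul_assoc, ← Real.rpow_add hn0, neg_add_cancel, Real.rpow_zero, one_mul]

end LowerBound

section Eigenvalues

variable {α : ℝ} {κ : Bool → ℝ} {s : ℝ → ℝ}
  {E : Type*} [NormedAddCommGroup E] [InnerProductSpace ℂ E] {φ : ℝ → E}

theorem symbolForm_neg (s : ℝ → ℝ) (φ : ℝ → E) (f : E) :
    symbolForm (fun x => -s x) φ f = -symbolForm s φ f := by
  simp only [symbolForm, neg_mul, integral_neg]

theorem tauC_mul_eq (hα : 0 < α) (κ : Bool → ℝ) :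
    tauC α * sideSum α κ ^ α = (sideSum α κ * symbolIntegral α) ^ α := by
  rw [tauC_eq hα, Real.mul_rpow (sideSum_nonneg _ _) (symbolIntegral_nonneg _), mul_comm]
  rfl

variable [CompleteSpace E]

theorem LaplaceFrame.isLittleO_posEig (hφ : LaplaceFrame φ) (hs : TailSymbol α κ s)
    (hα : 0 < α) (K : E →L[ℂ] E) (hK : ∀ f, (inner ℂ (K f) f).re = symbolForm s φ f) :
    (fun n : ℕ => posEig K n - tauC α * sideSum α κ ^ α * (n : ℝ) ^ (-α)) =o[atTop]
      fun n : ℕ => (n : ℝ) ^ (-α) := by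
  have hσI : ∀ κ : Bool → ℝ, 0 ≤ sideSum α κ * symbolIntegral α := fun κ =>
    mul_nonneg (sideSum_nonneg _ _) (symbolIntegral_nonneg _)
  have hroot : ∀ κ : Bool → ℝ, ((sideSum α κ * symbolIntegral α) ^ α) ^ (1 / α) =
      sideSum α κ * symbolIntegral α := fun κ => by
    rw [← Real.rpow_mul (hσI κ), mul_one_div_cancel hα.ne', Real.rpow_one]
  have hqf : (fun f => (inner ℂ (K f) f).re) = symbolForm s φ := funext hK
  rw [tauC_mul_eq hα]
  set a := (sideSum α κ * symbolIntegral α) ^ α with ha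
  have ha0 : 0 ≤ a := Real.rpow_nonneg (hσI κ) _
  refine isLittleO_iff.2 fun c hc => ?_
  have hup : ∀ᶠ n : ℕ in atTop, posEig K n ≤ (a + c) * (n : ℝ) ^ (-α) := by
    filter_upwards [hφ.eventually_smallOffDim hs hα (μ := a + c) (by linarith) (by
      rw [← hroot κ]; exact Real.rpow_lt_rpow ha0 (by linarith) (by positivity))] with n hn
    obtain ⟨r, hr, hd⟩ := hn
    exact posEig_le_of_smallOffDim K (by positivity) (by rw [hqf]; exact hd) hr
  have hlow : ∀ᶠ n : ℕ in atTop, (a - c) * (n : ℝ) ^ (-α) ≤ posEig K n := by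
    rcases le_or_gt (a - c) 0 with h | h
    · filter_upwards [eventually_neg_le_posEig K] with n hn
      refine (mul_nonpos_of_nonpos_of_nonneg h (by positivity)).trans ?_
      set μ := (sideSum α (fun b => -κ b) * symbolIntegral α) ^ α + 1 with hμ
      have hμ1 : 0 ≤ (sideSum α (fun b => -κ b) * symbolIntegral α) ^ α :=
        Real.rpow_nonneg (hσI _) _
      have hup' := hφ.eventually_smallOffDim hs.neg hα (μ := μ) (by linarith) (by
        rw [← hroot fun b => -κ b]
        exact Real.rpow_lt_rpow hμ1 (by linarith) (by positivity))
      have ht : Tendsto (fun N : ℕ => -(μ * (N : ℝ) ^ (-α))) atTop (𝓝 (-(μ * 0))) :=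
        (((tendsto_rpow_neg_atTop hα).comp tendsto_natCast_atTop_atTop).const_mul μ).neg
      rw [mul_zero, neg_zero] at ht
      refine le_of_tendsto ht (hup'.mono fun N hN => ?_)
      obtain ⟨r, -, hd⟩ := hN
      refine hn _ r (mul_nonneg (by linarith) (by positivity)) ?_
      convert! hd using 2 with f
      rw [symbolForm_neg, ← hK, neg_apply, inner_neg_left, Complex.neg_re]
    · filter_upwards [hφ.eventually_exists_submodule hs hα h (by
        rw [← hroot κ]; exact Real.rpow_lt_rpow h.le (by linarith) (by positivity)),
        eventually_gt_atTop 0] with n hn hn0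
      obtain ⟨V, hV, hVr, hVf⟩ := hn
      obtain ⟨W, hWV, hW⟩ := exists_le_finrank_eq hVr
      exact le_posEig_of_finrank_eq K hn0 hW fun f hf => by rw [hK]; exact hVf f (hWV hf)
  filter_upwards [hup, hlow] with n h1 h2
  rw [Real.norm_eq_abs, Real.norm_of_nonneg (by positivity), abs_le]
  constructor <;> linarith

theorem LaplaceFrame.isLittleO_negEig (hφ : LaplaceFrame φ) (hs : TailSymbol α κ s)
    (hα : 0 < α) (K : E →L[ℂ] E) (hK : ∀ f, (inner ℂ (K f) f).re = symbolForm s φ f) :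
    (fun n : ℕ => negEig K n - tauC α * sideSum α (fun b => -κ b) ^ α * (n : ℝ) ^ (-α))
      =o[atTop] fun n : ℕ => (n : ℝ) ^ (-α) :=
  hφ.isLittleO_posEig hs.neg hα (-K) fun f => by
    rw [symbolForm_neg, ← hK, neg_apply, inner_neg_left, Complex.neg_re]

end Eigenvalues

section Bessel

theorem integral_sechKernel : ∫ z, sechKernel z = Real.pi := by
  have := integral_sechKernel_rpow one_pos
  simp only [Real.rpow_one] at this
  rw [this, Real.Gamma_one_half_eq, Real.Gamma_one, div_one, Real.mul_self_sqrt Real.pi_pos.le]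

theorem intervalIntegral_sechKernel_sub_le {X : ℝ} (hX : 0 ≤ X) (x : ℝ) :
    ∫ y in -X..X, sechKernel (x - y) ≤ Real.pi := by
  rw [intervalIntegral.integral_of_le (by linarith), ← integral_sechKernel,
    ← integral_sub_left_eq_self sechKernel volume x]
  exact setIntegral_le_integral (integrable_sechKernel.comp_sub_left x)
    (Eventually.of_forall fun y => (sechKernel_pos _).le)

theorem intervalIntegral_mul_sechKernel_le {X : ℝ} (hX : 0 ≤ X) {c : ℝ → ℝ} (hc : Continuous c) :
    ∫ x in -X..X, c x * ∫ y in -X..X, sechKernel (x - y) * c y ≤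
      Real.pi * ∫ x in -X..X, c x ^ 2 := by
  have hle : -X ≤ X := by linarith
  have hk := continuous_sechKernel
  set P : ℝ → ℝ → ℝ := fun x y => c x ^ 2 * sechKernel (x - y) with hP
  have hPc : Continuous (Function.uncurry P) := by
    simp only [hP, Function.uncurry_def]; fun_prop
  have hPc' : Continuous (Function.uncurry fun x y => P y x) := by
    simp only [hP, Function.uncurry_def]; fun_prop
  have hQc : Continuous (Function.uncurry fun x y => c x * (sechKernel (x - y) * c y)) := by
    simp only [Function.uncurry_def]; fun_prop
  have hswap : ∫ x in -X..X, ∫ y in -X..X, P y x = ∫ x in -X..X, ∫ y in -X..X, P x y := by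
    refine intervalIntegral_intervalIntegral_swap
      (hPc'.continuousOn.integrableOn_compact (isCompact_uIcc.prod isCompact_uIcc) |>.mono_set
        (prod_mono uIoc_subset_uIcc uIoc_subset_uIcc))
  have i1 : ∀ x, IntervalIntegrable (fun y => P x y) volume (-X) X := fun x =>
    (hPc.comp (by fun_prop : Continuous fun y => (x, y))).intervalIntegrable _ _
  have i2 : ∀ x, IntervalIntegrable (fun y => P y x) volume (-X) X := fun x =>
    (hPc'.comp (by fun_prop : Continuous fun y => (x, y))).intervalIntegrable _ _
  have i3 : ∀ x, IntervalIntegrable (fun y => c x * (sechKernel (x - y) * c y)) volume (-X) X :=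
    fun x => (hQc.comp (by fun_prop : Continuous fun y => (x, y))).intervalIntegrable _ _
  have j1 := (intervalIntegral.continuous_parametric_intervalIntegral_of_continuous' hPc
    (-X) X (μ := volume)).intervalIntegrable (μ := volume) (-X) X
  have j2 := (intervalIntegral.continuous_parametric_intervalIntegral_of_continuous' hPc'
    (-X) X (μ := volume)).intervalIntegrable (μ := volume) (-X) X
  have j3 := (intervalIntegral.continuous_parametric_intervalIntegral_of_continuous' hQc
    (-X) X (μ := volume)).intervalIntegrable (μ := volume) (-X) X
  calc ∫ x in -X..X, c x * ∫ y in -X..X, sechKernel (x - y) * c y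
      = ∫ x in -X..X, ∫ y in -X..X, c x * (sechKernel (x - y) * c y) := by
        simp only [intervalIntegral.integral_const_mul]
    _ ≤ ∫ x in -X..X, 2⁻¹ * ((∫ y in -X..X, P x y) + ∫ y in -X..X, P y x) := by
        refine intervalIntegral.integral_mono_on hle j3 ((j1.add j2).const_mul _) fun x _ => ?_
        rw [← intervalIntegral.integral_add (i1 x) (i2 x), ← intervalIntegral.integral_const_mul]
        refine intervalIntegral.integral_mono_on hle (i3 x) (((i1 x).add (i2 x)).const_mul _)
          fun y _ => ?_
        have h1 : P y x = c y ^ 2 * sechKernel (x - y) := by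
          simp only [hP]; rw [← sechKernel_neg (x - y), neg_sub]
        rw [h1]
        have h2 := mul_nonneg (sq_nonneg (c x - c y)) (sechKernel_pos (x - y)).le
        simp only [hP]
        linarith
    _ = ∫ x in -X..X, ∫ y in -X..X, P x y := by
        rw [intervalIntegral.integral_const_mul, intervalIntegral.integral_add j1 j2, hswap]
        ring
    _ ≤ ∫ x in -X..X, Real.pi * c x ^ 2 := by
        refine intervalIntegral.integral_mono_on hle j1
          ((continuous_const.mul (hc.pow 2)).intervalIntegrable _ _) fun x _ => ?_
        simp only [hP]
        rw [intervalIntegral.integral_const_mul, mul_comm]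
        exact mul_le_mul_of_nonneg_right (intervalIntegral_sechKernel_sub_le hX x) (sq_nonneg _)
    _ = _ := intervalIntegral.integral_const_mul _ _

variable {E : Type*} [NormedAddCommGroup E] [InnerProductSpace ℂ E] [CompleteSpace E] {φ : ℝ → E}

theorem intervalIntegral_norm_inner_sq_le
    (hG : ∀ x y, inner ℂ (φ x) (φ y) = (sechKernel (x - y) : ℂ)) {X : ℝ} (hX : 0 ≤ X) (f : E) :
    ∫ x in -X..X, ‖(inner ℂ (φ x) f : ℂ)‖ ^ 2 ≤ Real.pi * ‖f‖ ^ 2 := by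
  have hφ : Continuous φ := continuous_of_inner_eq_sechKernel hG
  have hle : -X ≤ X := by linarith
  set c : ℝ → ℂ := fun x => inner ℂ (φ x) f with hc_def
  have hc : Continuous c := hφ.inner continuous_const
  set v : E := ∫ x in -X..X, c x • φ x with hv
  have hcφ : Continuous fun x => c x • φ x := hc.smul hφ
  have hinner : ∀ g : E, inner ℂ g v = ∫ x in -X..X, c x * inner ℂ g (φ x) := fun g => by
    have := (innerSL ℂ g).intervalIntegral_comp_comm (μ := volume) (hcφ.intervalIntegrable (-X) X)
    simp only [innerSL_apply_apply, inner_smul_right] at this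
    exact this.symm
  set I := ∫ x in -X..X, ‖c x‖ ^ 2 with hI
  have hI0 : 0 ≤ I := intervalIntegral.integral_nonneg hle fun x _ => sq_nonneg _
  have h1 : inner ℂ f v = (I : ℂ) := by
    rw [hinner, hI, ← intervalIntegral.integral_ofReal]
    refine intervalIntegral.integral_congr fun x _ => ?_
    simp only [hc_def]
    rw [← inner_conj_symm f, Complex.mul_conj, Complex.normSq_eq_norm_sq]
  have h2 : ∀ x, ‖(inner ℂ v (φ x) : ℂ)‖ ≤ ∫ y in -X..X, sechKernel (x - y) * ‖c y‖ := fun x => by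
    rw [norm_inner_symm, hinner]
    refine (intervalIntegral.norm_integral_le_integral_norm hle).trans (le_of_eq ?_)
    refine intervalIntegral.integral_congr fun y _ => ?_
    rw [hG, norm_mul, Complex.norm_real, Real.norm_of_nonneg (sechKernel_pos _).le, mul_comm]
  have h3 : ‖v‖ ^ 2 ≤ Real.pi * I := by
    have e : ((‖v‖ ^ 2 : ℝ) : ℂ) = ∫ x in -X..X, c x * inner ℂ v (φ x) := by
      rw [← hinner, inner_self_eq_norm_sq_to_K]
      simp only [Complex.coe_algebraMap, Complex.ofReal_pow]
    have e2 : ‖v‖ ^ 2 ≤ ∫ x in -X..X, ‖c x * inner ℂ v (φ x)‖ := by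
      have := congrArg norm e
      rw [Complex.norm_real, Real.norm_of_nonneg (sq_nonneg _)] at this
      rw [this]
      exact intervalIntegral.norm_integral_le_integral_norm hle
    refine e2.trans (le_trans ?_ (intervalIntegral_mul_sechKernel_le hX hc.norm))
    have hQc : Continuous (Function.uncurry fun x y => sechKernel (x - y) * ‖c y‖) := by
      have := continuous_sechKernel
      simp only [Function.uncurry_def]; fun_prop
    refine intervalIntegral.integral_mono_on hle
      ((hc.mul (continuous_const.inner hφ)).norm.intervalIntegrable _ _)
      ((hc.norm.mul (intervalIntegral.continuous_parametric_intervalIntegral_of_continuous' hQc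
        (-X) X (μ := volume))).intervalIntegrable _ _) fun x _ => ?_
    rw [norm_mul]
    exact mul_le_mul_of_nonneg_left (h2 x) (norm_nonneg _)
  have h4 : I ≤ ‖f‖ * ‖v‖ := by
    have := norm_inner_le_norm (𝕜 := ℂ) f v
    rwa [h1, Complex.norm_real, Real.norm_of_nonneg hI0] at this
  have h5 : I ^ 2 ≤ ‖f‖ ^ 2 * (Real.pi * I) := by
    calc I ^ 2 ≤ (‖f‖ * ‖v‖) ^ 2 := pow_le_pow_left₀ hI0 h4 2
      _ = ‖f‖ ^ 2 * ‖v‖ ^ 2 := mul_pow _ _ _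
      _ ≤ _ := mul_le_mul_of_nonneg_left h3 (sq_nonneg _)
  rcases hI0.eq_or_lt with h | h
  · rw [← h]
    exact mul_nonneg Real.pi_pos.le (sq_nonneg _)
  · refine le_of_mul_le_mul_right ?_ h
    linarith

theorem integrable_norm_inner_sq
    (hG : ∀ x y, inner ℂ (φ x) (φ y) = (sechKernel (x - y) : ℂ)) (f : E) :
    Integrable fun x => ‖(inner ℂ (φ x) f : ℂ)‖ ^ 2 := by
  have hφ : Continuous φ := continuous_of_inner_eq_sechKernel hG
  have hc : Continuous fun x => ‖(inner ℂ (φ x) f : ℂ)‖ ^ 2 :=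
    (hφ.inner continuous_const).norm.pow 2
  refine integrable_of_intervalIntegral_norm_bounded (Real.pi * ‖f‖ ^ 2)
    (a := fun X : ℝ => -X) (b := fun X : ℝ => X) (l := atTop) (fun X => hc.integrableOn_Ioc)
    tendsto_neg_atTop_atBot tendsto_id ?_
  filter_upwards [eventually_ge_atTop 0] with X hX
  simpa only [norm_pow, norm_norm] using intervalIntegral_norm_inner_sq_le hG hX f

theorem integral_norm_inner_sq_le
    (hG : ∀ x y, inner ℂ (φ x) (φ y) = (sechKernel (x - y) : ℂ)) (f : E) :
    ∫ x, ‖(inner ℂ (φ x) f : ℂ)‖ ^ 2 ≤ Real.pi * ‖f‖ ^ 2 := by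
  refine le_of_tendsto (intervalIntegral_tendsto_integral (integrable_norm_inner_sq hG f)
    tendsto_neg_atTop_atBot tendsto_id) ?_
  filter_upwards [eventually_ge_atTop 0] with X hX
  exact intervalIntegral_norm_inner_sq_le hG hX f

end Bessel

section HalfLine

/-- The element of `L²(0, ∞)` defined by a real function. -/
def realVec (g : ℝ → ℝ) (hg : MemLp g 2 muP) : HSp := (hg.ofReal (K := ℂ)).toLp

theorem coeFn_realVec {g : ℝ → ℝ} (hg : MemLp g 2 muP) :
    (realVec g hg : ℝ → ℂ) =ᵐ[muP] fun t => (g t : ℂ) :=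
  (hg.ofReal (K := ℂ)).coeFn_toLp

theorem inner_realVec {g : ℝ → ℝ} (hg : MemLp g 2 muP) (f : HSp) :
    inner ℂ (realVec g hg) f = ∫ t in Ioi (0:ℝ), (g t : ℂ) * (f : ℝ → ℂ) t := by
  rw [L2.inner_def]
  refine integral_congr_ae ?_
  filter_upwards [coeFn_realVec hg] with t ht
  rw [ht, RCLike.inner_apply, Complex.conj_ofReal, mul_comm]

theorem integrable_realVec_mul {g : ℝ → ℝ} (hg : MemLp g 2 muP) (f : HSp) :
    Integrable (fun t => (g t : ℂ) * (f : ℝ → ℂ) t) muP :=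
  (hg.ofReal (K := ℂ)).integrable_mul (Lp.memLp f)

theorem inner_realVec_realVec {g k : ℝ → ℝ} (hg : MemLp g 2 muP) (hk : MemLp k 2 muP) :
    inner ℂ (realVec g hg) (realVec k hk) = ((∫ t in Ioi (0:ℝ), g t * k t : ℝ) : ℂ) := by
  rw [inner_realVec, ← integral_complex_ofReal]
  refine integral_congr_ae ?_
  filter_upwards [coeFn_realVec hk] with t ht
  rw [ht, Complex.ofReal_mul]

theorem norm_realVec_sq {g : ℝ → ℝ} (hg : MemLp g 2 muP) :
    ‖realVec g hg‖ ^ 2 = ∫ t in Ioi (0:ℝ), g t ^ 2 := by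
  have h := inner_realVec_realVec hg hg
  rw [inner_self_eq_norm_sq_to_K] at h
  simp only [Complex.coe_algebraMap, ← Complex.ofReal_pow, Complex.ofReal_inj] at h
  rw [h]; simp only [sq]

theorem memLp_pow_mul_exp (m : ℕ) {b : ℝ} (hb : 0 < b) :
    MemLp (fun t : ℝ => t ^ m * Real.exp (-(b * t))) 2 muP := by
  have hc : Continuous fun t : ℝ => t ^ m * Real.exp (-(b * t)) := by fun_prop
  rw [memLp_two_iff_integrable_sq hc.aestronglyMeasurable]
  have h := integrableOn_rpow_mul_exp_neg_mul_rpow (s := (2 * m : ℕ)) (p := 1) (b := 2 * b)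
    (by have : (0:ℝ) ≤ ((2 * m : ℕ) : ℝ) := Nat.cast_nonneg _
        linarith) one_pos (by positivity)
  refine h.congr (Eventually.of_forall fun t => ?_)
  simp only [Real.rpow_natCast, Real.rpow_one]
  rw [mul_pow, ← Real.exp_nat_mul, pow_mul']
  congr 2
  push_cast; ring

theorem memLp_exp {b : ℝ} (hb : 0 < b) : MemLp (fun t : ℝ => Real.exp (-(b * t))) 2 muP := by
  simpa using memLp_pow_mul_exp 0 hb

theorem integral_exp_neg_mul_Ioi_zero {b : ℝ} (hb : 0 < b) :
    ∫ t in Ioi (0:ℝ), Real.exp (-(b * t)) = b⁻¹ := by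
  have h := integral_exp_mul_Ioi (a := -b) (by linarith) 0
  simp only [neg_mul] at h
  rw [h]; simp

theorem memLp_lapFun (x : ℝ) :
    MemLp (fun t : ℝ => Real.exp (x / 2) * Real.exp (-(Real.exp x * t))) 2 muP :=
  (memLp_exp (Real.exp_pos x)).const_mul _

/-- The normalized exponentials `t ↦ e^{x/2} e^{-t e^x}` in `L²(0, ∞)`. -/
def lapVec (x : ℝ) : HSp := realVec _ (memLp_lapFun x)

theorem inner_lapVec_lapVec (x y : ℝ) :
    inner ℂ (lapVec x) (lapVec y) = (sechKernel (x - y) : ℂ) := by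
  rw [lapVec, lapVec, inner_realVec_realVec, Complex.ofReal_inj]
  have h : ∀ t, Real.exp (x / 2) * Real.exp (-(Real.exp x * t)) *
      (Real.exp (y / 2) * Real.exp (-(Real.exp y * t))) =
      Real.exp (x / 2) * Real.exp (y / 2) * Real.exp (-((Real.exp x + Real.exp y) * t)) := by
    intro t
    rw [add_mul, neg_add, Real.exp_add]; ring
  simp only [h]
  rw [integral_const_mul, integral_exp_neg_mul_Ioi_zero (by positivity), sechKernel, Real.cosh_eq]
  rw [show 2 * ((Real.exp ((x - y) / 2) + Real.exp (-((x - y) / 2))) / 2) =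
    Real.exp ((x - y) / 2) + Real.exp (-((x - y) / 2)) by ring, ← div_eq_mul_inv,
    div_eq_iff (by positivity), inv_mul_eq_div, eq_div_iff (by positivity)]
  rw [mul_add, ← Real.exp_add, ← Real.exp_add, ← Real.exp_add]
  ring_nf

theorem exp_sub_sum_le (n : ℕ) {y : ℝ} (hy : 0 ≤ y) :
    Real.exp y - ∑ m ∈ Finset.range n, y ^ m / m.factorial ≤ (1 / 2) ^ n * Real.exp (2 * y) := by
  have h1 := (NormedSpace.expSeries_div_hasSum_exp (𝔸 := ℝ) y)
  have h2 := (NormedSpace.expSeries_div_hasSum_exp (𝔸 := ℝ) (2 * y)).mul_left ((1/2 : ℝ) ^ n)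
  rw [← Real.exp_eq_exp_ℝ] at h1 h2
  have h3 := (hasSum_nat_add_iff' n).2 h1
  have h4 := (hasSum_nat_add_iff' n).2 h2
  refine (hasSum_le (fun m => ?_) h3 h4).trans (sub_le_self _ ?_)
  · have e : (1 / 2 : ℝ) ^ n * ((2 * y) ^ (m + n) / (m + n).factorial) =
        2 ^ m * (y ^ (m + n) / (m + n).factorial) := by
      rw [mul_pow, pow_add (2:ℝ), one_div, inv_pow]
      field_simp
    rw [e]
    exact le_mul_of_one_le_left (by positivity) (one_le_pow₀ (by norm_num))
  · exact Finset.sum_nonneg fun m _ => by positivity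

theorem abs_exp_neg_sub_sum_le (n : ℕ) {y : ℝ} (hy : 0 ≤ y) :
    |Real.exp (-y) - ∑ m ∈ Finset.range n, (-y) ^ m / m.factorial| ≤
      (1 / 2) ^ n * Real.exp (2 * y) := by
  have h := Complex.norm_exp_sub_sum_le_exp_norm_sub_sum ((-y : ℝ) : ℂ) n
  rw [Complex.norm_real, Real.norm_eq_abs, abs_neg, abs_of_nonneg hy] at h
  refine le_trans (le_of_eq ?_) (h.trans (exp_sub_sum_le n hy))
  rw [← Real.norm_eq_abs, ← Complex.norm_real]
  push_cast
  rfl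

theorem exp_one_fifth_le : Real.exp (1 / 5) ≤ 5 / 4 := by
  have h := Real.exp_bound_div_one_sub_of_interval (x := 1/5) (by norm_num) (by norm_num)
  linarith [h, show (1:ℝ) / (1 - 1/5) = 5/4 by norm_num]

/-- The remainder of the Taylor expansion of `e^{-λ t}` in `λ` at `μ`. -/
def taylorRem (n : ℕ) (l μ t : ℝ) : ℝ :=
  Real.exp (-(l * t)) -
    ∑ m ∈ Finset.range n, (-(l - μ)) ^ m / m.factorial * (t ^ m * Real.exp (-(μ * t)))

theorem abs_taylorRem_le (n : ℕ) {l μ t : ℝ} (h1 : μ ≤ l) (h2 : l - μ ≤ μ / 4) (ht : 0 ≤ t) :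
    |taylorRem n l μ t| ≤ (1 / 2) ^ n * Real.exp (-(μ / 2 * t)) := by
  have h := abs_exp_neg_sub_sum_le n (mul_nonneg (sub_nonneg.2 h1) ht)
  have e : taylorRem n l μ t = Real.exp (-(μ * t)) * (Real.exp (-((l - μ) * t)) -
      ∑ m ∈ Finset.range n, (-((l - μ) * t)) ^ m / m.factorial) := by
    rw [taylorRem, mul_sub, ← Real.exp_add, Finset.mul_sum]
    congr 1
    · congr 1; ring
    · refine Finset.sum_congr rfl fun m _ => ?_
      rw [← neg_mul (l - μ) t, mul_pow]; ring
  rw [e, abs_mul, abs_of_pos (Real.exp_pos _)]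
  refine (mul_le_mul_of_nonneg_left h (Real.exp_pos _).le).trans ?_
  rw [mul_left_comm, ← Real.exp_add]
  gcongr
  nlinarith

theorem memLp_taylorRem (n : ℕ) {l μ : ℝ} (hl : 0 < l) (hμ : 0 < μ) :
    MemLp (taylorRem n l μ) 2 muP := by
  refine (memLp_exp hl).sub (memLp_finsetSum _ fun m _ => ?_)
  exact (memLp_pow_mul_exp m hμ).const_mul _

theorem norm_realVec_taylorRem_sq_le (n : ℕ) {l μ : ℝ} (hμ : 0 < μ) (h1 : μ ≤ l)
    (h2 : l - μ ≤ μ / 4) :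
    ‖realVec _ (memLp_taylorRem n (hμ.trans_le h1) hμ)‖ ^ 2 ≤ (1 / 4) ^ n * μ⁻¹ := by
  rw [norm_realVec_sq, ← integral_exp_neg_mul_Ioi_zero hμ, ← integral_const_mul]
  refine setIntegral_mono_on (memLp_taylorRem n (hμ.trans_le h1) hμ).integrable_sq ?_
    measurableSet_Ioi fun t ht => ?_
  · refine Integrable.const_mul ?_ _
    have := (integrableOn_exp_mul_Ioi (a := -μ) (by linarith) 0).integrable
    simpa only [neg_mul] using this
  · rw [← sq_abs]
    refine (pow_le_pow_left₀ (abs_nonneg _) (abs_taylorRem_le n h1 h2 (le_of_lt ht)) 2).trans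
      (le_of_eq ?_)
    rw [mul_pow, ← pow_mul, mul_comm n, pow_mul, ← Real.exp_nat_mul]
    congr 2
    · norm_num
    · push_cast; ring

theorem locallyLowRank_lapVec : LocallyLowRank lapVec := by
  refine ⟨5 / 4, by norm_num, fun a n => ⟨fun k => realVec _ (memLp_pow_mul_exp k (Real.exp_pos a)),
    fun x hx f hf => ?_⟩⟩
  have hμ := Real.exp_pos a
  have h1 : Real.exp a ≤ Real.exp x := Real.exp_le_exp.2 hx.1
  have hxa : Real.exp (x - a) ≤ 5 / 4 :=
    (Real.exp_le_exp.2 (by linarith [hx.2])).trans exp_one_fifth_le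
  have hxe : Real.exp x = Real.exp (x - a) * Real.exp a := by rw [← Real.exp_add]; ring_nf
  have h2 : Real.exp x - Real.exp a ≤ Real.exp a / 4 := by rw [hxe]; nlinarith
  have hl := Real.exp_pos x
  have hker : inner ℂ (lapVec x) f = (Real.exp (x / 2) : ℂ) *
      inner ℂ (realVec _ (memLp_taylorRem n hl hμ)) f := by
    have e0 : ∀ m ∈ Finset.range n, ∫ t in Ioi (0:ℝ),
        (((-(Real.exp x - Real.exp a)) ^ m / m.factorial : ℝ) : ℂ) *
          (((t ^ m * Real.exp (-(Real.exp a * t)) : ℝ) : ℂ) * (f : ℝ → ℂ) t) = 0 := by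
      intro m hm
      have := hf ⟨m, Finset.mem_range.1 hm⟩
      rw [inner_realVec] at this
      rw [integral_const_mul, this, mul_zero]
    have i0 : ∀ m ∈ Finset.range n, Integrable (fun t =>
        (((-(Real.exp x - Real.exp a)) ^ m / m.factorial : ℝ) : ℂ) *
          (((t ^ m * Real.exp (-(Real.exp a * t)) : ℝ) : ℂ) * (f : ℝ → ℂ) t)) muP :=
      fun m _ => (integrable_realVec_mul (memLp_pow_mul_exp m hμ) f).const_mul _
    have e1 : ∀ t, ((taylorRem n (Real.exp x) (Real.exp a) t : ℝ) : ℂ) * (f : ℝ → ℂ) t =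
        ((Real.exp (-(Real.exp x * t)) : ℝ) : ℂ) * (f : ℝ → ℂ) t -
        ∑ m ∈ Finset.range n, (((-(Real.exp x - Real.exp a)) ^ m / m.factorial : ℝ) : ℂ) *
          (((t ^ m * Real.exp (-(Real.exp a * t)) : ℝ) : ℂ) * (f : ℝ → ℂ) t) := by
      intro t
      rw [taylorRem, Complex.ofReal_sub, sub_mul, Complex.ofReal_sum, Finset.sum_mul]
      simp only [Complex.ofReal_mul, mul_assoc]
    rw [lapVec, inner_realVec, inner_realVec]
    simp only [e1]
    rw [integral_sub (integrable_realVec_mul (memLp_exp hl) f) (integrable_finsetSum _ i0),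
      integral_finsetSum _ i0, Finset.sum_eq_zero e0, sub_zero, ← integral_const_mul]
    simp only [Complex.ofReal_mul, mul_assoc]
  rw [hker, norm_mul, Complex.norm_real, Real.norm_eq_abs, abs_of_pos (Real.exp_pos _), mul_pow,
    ← Real.exp_nat_mul, show ((2:ℕ):ℝ) * (x / 2) = x by push_cast; ring]
  have h3 := pow_le_pow_left₀ (norm_nonneg _)
    (norm_inner_le_norm (𝕜 := ℂ) (realVec _ (memLp_taylorRem n hl hμ)) f) 2
  rw [mul_pow] at h3
  have h4 := norm_realVec_taylorRem_sq_le n hμ h1 h2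
  calc Real.exp x * ‖inner ℂ (realVec _ (memLp_taylorRem n hl hμ)) f‖ ^ 2
      ≤ Real.exp x * ((1 / 4) ^ n * (Real.exp a)⁻¹ * ‖f‖ ^ 2) := by
        gcongr
        exact h3.trans (mul_le_mul_of_nonneg_right h4 (sq_nonneg _))
    _ = Real.exp (x - a) * ((1 / 4) ^ n * ‖f‖ ^ 2) := by
        rw [hxe]; field_simp
    _ ≤ 5 / 4 * ((1 / 4) ^ n * ‖f‖ ^ 2) := by gcongr
    _ = 5 / 4 * (1 / 4) ^ n * ‖f‖ ^ 2 := by ring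

theorem laplaceFrame_lapVec : LaplaceFrame lapVec where
  inner_eq := inner_lapVec_lapVec
  integrable := integrable_norm_inner_sq inner_lapVec_lapVec
  integral_le := integral_norm_inner_sq_le inner_lapVec_lapVec
  locallyLowRank := locallyLowRank_lapVec

end HalfLine

section HankelForm

/-- The normalized exponential `e^{x/2} e^{-t e^x}`. -/
def lapFun (x t : ℝ) : ℝ := Real.exp (x / 2) * Real.exp (-(Real.exp x * t))

theorem lapFun_nonneg (x t : ℝ) : 0 ≤ lapFun x t := by unfold lapFun; positivity

theorem lapFun_mul_lapFun (x t u : ℝ) :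
    lapFun x t * lapFun x u = Real.exp x * Real.exp (-((t + u) * Real.exp x)) := by
  unfold lapFun
  rw [mul_mul_mul_comm, ← Real.exp_add, ← Real.exp_add]
  congr 2 <;> ring

theorem continuous_lapFun : Continuous (Function.uncurry lapFun) := by
  unfold lapFun
  simp only [Function.uncurry_def]
  fun_prop

theorem inner_lapVec (x : ℝ) (f : HSp) :
    inner ℂ (lapVec x) f = ∫ t in Ioi (0:ℝ), (lapFun x t : ℂ) * (f : ℝ → ℂ) t :=
  inner_realVec _ f

theorem integrable_lapFun_mul (x : ℝ) (f : HSp) :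
    Integrable (fun t => (lapFun x t : ℂ) * (f : ℝ → ℂ) t) muP :=
  integrable_realVec_mul (memLp_lapFun x) f

theorem integrable_lapFun_mul_conj (x : ℝ) (f : HSp) :
    Integrable (fun t => (lapFun x t : ℂ) * (starRingEnd ℂ) ((f : ℝ → ℂ) t)) muP := by
  refine (Complex.conjCLE.toContinuousLinearMap.integrable_comp (integrable_lapFun_mul x f)).congr
    (Eventually.of_forall fun t => ?_)
  simp

variable {α : ℝ} {κ : Bool → ℝ} {s : ℝ → ℝ}

theorem integrable_kernel (hs : TailSymbol α κ s) (hα : 0 < α) (f : HSp) :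
    Integrable (fun p : ℝ × ℝ × ℝ => (s p.1 : ℂ) *
      (((lapFun p.1 p.2.1 : ℂ) * (f : ℝ → ℂ) p.2.1) *
        ((lapFun p.1 p.2.2 : ℂ) * (starRingEnd ℂ) ((f : ℝ → ℂ) p.2.2))))
      ((volume : Measure ℝ).prod (muP.prod muP)) := by
  have hf : AEStronglyMeasurable (f : ℝ → ℂ) muP := Lp.aestronglyMeasurable f
  have hfc : AEStronglyMeasurable (fun t => (starRingEnd ℂ) ((f : ℝ → ℂ) t)) muP :=
    Complex.continuous_conj.comp_aestronglyMeasurable hf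
  have hl1 : Continuous fun p : ℝ × ℝ × ℝ => (lapFun p.1 p.2.1 : ℂ) :=
    Complex.continuous_ofReal.comp
      (continuous_lapFun.comp (by fun_prop : Continuous fun p : ℝ × ℝ × ℝ => (p.1, p.2.1)))
  have hl2 : Continuous fun p : ℝ × ℝ × ℝ => (lapFun p.1 p.2.2 : ℂ) :=
    Complex.continuous_ofReal.comp
      (continuous_lapFun.comp (by fun_prop : Continuous fun p : ℝ × ℝ × ℝ => (p.1, p.2.2)))
  have hm : AEStronglyMeasurable (fun p : ℝ × ℝ × ℝ => (s p.1 : ℂ) *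
      (((lapFun p.1 p.2.1 : ℂ) * (f : ℝ → ℂ) p.2.1) *
        ((lapFun p.1 p.2.2 : ℂ) * (starRingEnd ℂ) ((f : ℝ → ℂ) p.2.2))))
      ((volume : Measure ℝ).prod (muP.prod muP)) := by
    refine AEStronglyMeasurable.mul
      (Complex.continuous_ofReal.comp_aestronglyMeasurable hs.1).comp_fst
      ((hl1.aestronglyMeasurable.mul ?_).mul (hl2.aestronglyMeasurable.mul ?_))
    · exact (hf.comp_fst (ν := muP)).comp_snd
    · exact (hfc.comp_snd (μ := muP)).comp_snd
  rw [integrable_prod_iff hm]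
  refine ⟨Eventually.of_forall fun x => ?_, ?_⟩
  · exact ((integrable_lapFun_mul x f).mul_prod (integrable_lapFun_mul_conj x f)).const_mul (s x : ℂ)
  · have hG : MemLp (fun t => ‖(f : ℝ → ℂ) t‖) 2 muP := (Lp.memLp f).norm
    have hI := hs.integrable_mul hα (laplaceFrame_lapVec.integrable (realVec _ hG))
    refine hI.norm.congr (Eventually.of_forall fun x => ?_)
    have e1 : inner ℂ (lapVec x) (realVec _ hG) =
        ((∫ t in Ioi (0:ℝ), lapFun x t * ‖(f : ℝ → ℂ) t‖ : ℝ) : ℂ) :=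
      inner_realVec_realVec _ _
    simp only [e1, norm_mul, RCLike.norm_conj, Complex.norm_real, Real.norm_eq_abs,
      abs_of_nonneg (lapFun_nonneg _ _), norm_pow, sq_abs]
    rw [integral_const_mul, integral_prod_mul (fun t => lapFun x t * ‖(f : ℝ → ℂ) t‖)
      (fun t => lapFun x t * ‖(f : ℝ → ℂ) t‖), sq]

theorem re_inner_eq_symbolForm (hs : TailSymbol α κ s) (hα : 0 < α) {h : ℝ → ℝ}
    (hh : ∀ t, 0 < t → h t = ∫ x, s x * (Real.exp x * Real.exp (-(t * Real.exp x))))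
    {H : HSp →L[ℂ] HSp} (hH : IsHankel (fun t => ((h t : ℝ) : ℂ)) H) (f : HSp) :
    (inner ℂ (H f) f).re = symbolForm s lapVec f := by
  set F : ℝ × ℝ × ℝ → ℂ := fun p => (s p.1 : ℂ) *
      (((lapFun p.1 p.2.1 : ℂ) * (f : ℝ → ℂ) p.2.1) *
        ((lapFun p.1 p.2.2 : ℂ) * (starRingEnd ℂ) ((f : ℝ → ℂ) p.2.2))) with hF
  have hFi : Integrable F ((volume : Measure ℝ).prod (muP.prod muP)) := integrable_kernel hs hα f
  have e1 : inner ℂ (H f) f = ∫ t in Ioi (0:ℝ), ∫ u in Ioi (0:ℝ), ∫ x, F (x, t, u) := by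
    rw [L2.inner_def]
    refine integral_congr_ae ?_
    filter_upwards [hH f, ae_restrict_mem measurableSet_Ioi] with t ht ht0
    rw [ht, RCLike.inner_apply, ← integral_conj, ← integral_const_mul]
    refine setIntegral_congr_fun measurableSet_Ioi fun u hu => ?_
    have e2 : ∀ x, F (x, t, u) = ((s x * (Real.exp x * Real.exp (-((t + u) * Real.exp x))) : ℝ) : ℂ)
        * ((f : ℝ → ℂ) t * (starRingEnd ℂ) ((f : ℝ → ℂ) u)) := by
      intro x
      rw [← lapFun_mul_lapFun]
      simp only [hF, Complex.ofReal_mul]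
      ring
    simp only [e2]
    rw [integral_mul_const, integral_complex_ofReal, ← hh (t + u) (add_pos ht0 hu), map_mul,
      Complex.conj_ofReal]
    ring
  have e3 : ∫ t in Ioi (0:ℝ), ∫ u in Ioi (0:ℝ), ∫ x, F (x, t, u) =
      ∫ x, ∫ q, F (x, q) ∂(muP.prod muP) := by
    rw [← integral_prod _ hFi, integral_prod_symm _ hFi]
    exact (integral_prod _ hFi.integral_prod_right).symm
  have e4 : ∀ x, ∫ q, F (x, q) ∂(muP.prod muP) =
      ((s x * ‖inner ℂ (lapVec x) f‖ ^ 2 : ℝ) : ℂ) := by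
    intro x
    simp only [hF]
    rw [integral_const_mul, integral_prod_mul (fun t => (lapFun x t : ℂ) * (f : ℝ → ℂ) t)
      (fun t => (lapFun x t : ℂ) * (starRingEnd ℂ) ((f : ℝ → ℂ) t)), ← inner_lapVec]
    have e5 : ∫ t in Ioi (0:ℝ), (lapFun x t : ℂ) * (starRingEnd ℂ) ((f : ℝ → ℂ) t) =
        (starRingEnd ℂ) (inner ℂ (lapVec x) f) := by
      rw [inner_lapVec, ← integral_conj]
      simp only [map_mul, Complex.conj_ofReal]
    rw [e5, Complex.mul_conj, Complex.normSq_eq_norm_sq, Complex.ofReal_mul]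
  rw [e1, e3]
  simp only [e4]
  rw [integral_complex_ofReal, Complex.ofReal_re, symbolForm]

theorem integral_Ioi_eq_integral_comp_exp (g : ℝ → ℝ) :
    ∫ l in Ioi (0:ℝ), g l = ∫ x, Real.exp x * g (Real.exp x) := by
  have h := integral_image_eq_integral_abs_deriv_smul MeasurableSet.univ
    (fun x _ => (Real.hasDerivAt_exp x).hasDerivWithinAt) Real.exp_injective.injOn g
  rw [image_univ, Real.range_exp] at h
  simpa only [abs_of_pos (Real.exp_pos _), Measure.restrict_univ, smul_eq_mul] using h

end HankelForm

section ModelSymbol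

variable {α κ0 κinf : ℝ} {χ0 χinf : ℝ → ℝ}

theorem exp_two_ge : (4:ℝ) ≤ Real.exp 2 := by
  have h := Real.exp_one_gt_d9
  have : Real.exp 2 = Real.exp 1 * Real.exp 1 := by rw [← Real.exp_add]; norm_num
  nlinarith

theorem exists_abs_le_of_eq_outside {f : ℝ → ℝ} (hf : Continuous f) {C R : ℝ}
    (h : ∀ x, R ≤ |x| → |f x| ≤ C) : ∃ D, 0 ≤ D ∧ ∀ x, |f x| ≤ D := by
  obtain ⟨D, hD⟩ := (isCompact_Icc (a := -R) (b := R)).exists_bound_of_continuousOn hf.continuousOn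
  refine ⟨max 0 (max C D), le_max_left _ _, fun x => ?_⟩
  rcases le_total R |x| with hx | hx
  · exact (h x hx).trans ((le_max_left _ _).trans (le_max_right _ _))
  · exact (hD x (abs_le.1 hx)).trans ((le_max_right _ _).trans (le_max_right _ _))

theorem log_two_le_abs {x : ℝ} (h : Real.exp x ≤ 1 / 2 ∨ 2 ≤ Real.exp x) : 1 / 2 ≤ |x| := by
  have h2 := Real.log_two_gt_d9
  rcases h with h | h
  · have := Real.log_le_log (Real.exp_pos x) h
    rw [Real.log_exp, one_div, Real.log_inv] at this
    rw [abs_of_nonpos (by linarith)]; linarith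
  · have := Real.log_le_log two_pos h
    rw [Real.log_exp] at this
    rw [abs_of_nonneg (by linarith)]; linarith

theorem abs_rpow_neg_le (hα : 0 < α) {x : ℝ} (hx : 1 / 2 ≤ |x|) :
    |x| ^ (-α) ≤ 3 ^ α * (1 + |x|) ^ (-α) := by
  have h0 : 0 < |x| := by linarith
  rw [show (3:ℝ) ^ α = (3⁻¹) ^ (-α) by
    rw [Real.rpow_neg (by norm_num), Real.inv_rpow (by norm_num), inv_inv],
    ← Real.mul_rpow (by norm_num) (by linarith)]
  exact Real.rpow_le_rpow_of_nonpos (by positivity) (by linarith) (by linarith)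

theorem tailSymbol_model (hα : 0 < α)
    (hχ0 : ContinuousOn χ0 (Ioi 0)) (hχinf : ContinuousOn χinf (Ioi 0))
    (hχ0one : ∀ t : ℝ, 0 < t → t ≤ 1/4 → χ0 t = 1)
    (hχ0zero : ∀ t : ℝ, 1/2 ≤ t → χ0 t = 0)
    (hχinfzero : ∀ t : ℝ, 0 < t → t ≤ 2 → χinf t = 0)
    (hχinfone : ∀ t : ℝ, 4 ≤ t → χinf t = 1) :
    TailSymbol α (fun b => if b then κ0 else κinf) fun x =>
      κinf * |x| ^ (-α) * χ0 (Real.exp x) + κ0 * |x| ^ (-α) * χinf (Real.exp x) := by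
  have c0 : Continuous fun x => χ0 (Real.exp x) :=
    hχ0.comp_continuous Real.continuous_exp fun x => Real.exp_pos x
  have cinf : Continuous fun x => χinf (Real.exp x) :=
    hχinf.comp_continuous Real.continuous_exp fun x => Real.exp_pos x
  have hlarge : ∀ x, 2 ≤ x → 4 ≤ Real.exp x := fun x hx =>
    exp_two_ge.trans (Real.exp_le_exp.2 hx)
  have hsmall : ∀ x, 2 ≤ x → Real.exp (-x) ≤ 1 / 4 := fun x hx => by
    rw [Real.exp_neg, one_div]; exact inv_anti₀ (by norm_num) (hlarge x hx)
  have v0 : ∀ x, 2 ≤ x → χ0 (Real.exp x) = 0 := fun x hx => hχ0zero _ (by linarith [hlarge x hx])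
  have v0' : ∀ x, 2 ≤ x → χ0 (Real.exp (-x)) = 1 := fun x hx =>
    hχ0one _ (Real.exp_pos _) (hsmall x hx)
  have vi : ∀ x, 2 ≤ x → χinf (Real.exp x) = 1 := fun x hx => hχinfone _ (hlarge x hx)
  have vi' : ∀ x, 2 ≤ x → χinf (Real.exp (-x)) = 0 := fun x hx =>
    hχinfzero _ (Real.exp_pos _) (by linarith [hsmall x hx])
  have habs : ∀ x : ℝ, 2 ≤ |x| → 2 ≤ x ∨ ∃ y, 2 ≤ y ∧ x = -y := fun x hx => by
    rcases le_abs.1 hx with h | h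
    · exact Or.inl h
    · exact Or.inr ⟨-x, h, (neg_neg x).symm⟩
  obtain ⟨D0, hD0, b0⟩ := exists_abs_le_of_eq_outside (C := 1) (R := 2) c0 fun x hx => by
    rcases habs x hx with h | ⟨y, h, rfl⟩
    · simp [v0 x h]
    · simp [v0' y h]
  obtain ⟨Di, hDi, bi⟩ := exists_abs_le_of_eq_outside (C := 1) (R := 2) cinf fun x hx => by
    rcases habs x hx with h | ⟨y, h, rfl⟩
    · simp [vi x h]
    · simp [vi' y h]
  refine ⟨?_, ⟨(|κinf| * D0 + |κ0| * Di) * 3 ^ α, by positivity, fun x => ?_⟩, fun b x hx => ?_⟩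
  · refine Measurable.aestronglyMeasurable ?_
    have m0 := c0.measurable
    have mi := cinf.measurable
    have mp : Measurable fun x : ℝ => |x| ^ (-α) := measurable_id.abs.pow_const _
    exact ((mp.const_mul _).mul m0).add ((mp.const_mul _).mul mi)
  · by_cases h : Real.exp x ≤ 1 / 2 ∨ 2 ≤ Real.exp x
    · have hx := abs_rpow_neg_le hα (log_two_le_abs h)
      have hp : 0 ≤ |x| ^ (-α) := by positivity
      calc _ ≤ |κinf| * |x| ^ (-α) * |χ0 (Real.exp x)| + |κ0| * |x| ^ (-α) * |χinf (Real.exp x)| := by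
            refine (abs_add_le _ _).trans (le_of_eq ?_)
            simp only [abs_mul, abs_of_nonneg hp]
        _ ≤ |κinf| * |x| ^ (-α) * D0 + |κ0| * |x| ^ (-α) * Di := by
            gcongr
            · exact b0 x
            · exact bi x
        _ = (|κinf| * D0 + |κ0| * Di) * |x| ^ (-α) := by ring
        _ ≤ (|κinf| * D0 + |κ0| * Di) * (3 ^ α * (1 + |x|) ^ (-α)) := by gcongr
        _ = _ := by ring
    · push Not at h
      rw [hχ0zero _ h.1.le, hχinfzero _ (Real.exp_pos x) h.2.le]
      simp only [mul_zero, add_zero, abs_zero]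
      positivity
  · have hx0 : 0 ≤ x := by linarith
    cases b
    · simp [v0' x hx, vi' x hx, abs_of_nonneg hx0]
    · simp [v0 x hx, vi x hx, abs_of_nonneg hx0]

end ModelSymbol

/-- Lemma `lma.c0` of the paper.  The model Hankel operator `H_*` with
kernel `h_*(t) = ∫₀^∞ e^{-tλ} σ_*(λ) dλ`, where
`σ_*(λ) = κ_∞|log λ|^{-α}χ₀(λ) + κ₀|log λ|^{-α}χ_∞(λ)`, has eigenvalue asymptotics
`λₙ^±(H_*) = a^± n^{-α} + o(n^{-α})` with `a^± = τ(α)((κ₀)_±^{1/α} + (κ_∞)_±^{1/α})^α`. -/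
theorem statement10 (α : ℝ) (hα : 0 < α) (κ0 κinf : ℝ)
    (χ0 χinf : ℝ → ℝ)
    (hχ0sm : ContDiffOn ℝ (⊤ : ℕ∞) χ0 (Set.Ioi 0)) (hχinfsm : ContDiffOn ℝ (⊤ : ℕ∞) χinf (Set.Ioi 0))
    (hχ0one : ∀ t : ℝ, 0 < t → t ≤ 1/4 → χ0 t = 1)
    (hχ0zero : ∀ t : ℝ, 1/2 ≤ t → χ0 t = 0)
    (hχinfzero : ∀ t : ℝ, 0 < t → t ≤ 2 → χinf t = 0)
    (hχinfone : ∀ t : ℝ, 4 ≤ t → χinf t = 1)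
    (σs : ℝ → ℝ)
    (hσs : ∀ l : ℝ, 0 < l →
      σs l = κinf * |Real.log l| ^ (-α) * χ0 l + κ0 * |Real.log l| ^ (-α) * χinf l)
    (hstar : ℝ → ℝ)
    (hhstar : ∀ t : ℝ, 0 < t → hstar t = ∫ l in Set.Ioi (0:ℝ), Real.exp (-(t * l)) * σs l)
    (H : HSp →L[ℂ] HSp) (hH : IsHankel (fun t => ((hstar t : ℝ) : ℂ)) H)
    (aP aM : ℝ)
    (haP : aP = tauC α * ((max κ0 0) ^ (1/α) + (max κinf 0) ^ (1/α)) ^ α)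
    (haM : aM = tauC α * ((max (-κ0) 0) ^ (1/α) + (max (-κinf) 0) ^ (1/α)) ^ α) :
    ((fun nn : ℕ => posEig H nn - aP * (nn:ℝ) ^ (-α)) =o[atTop] fun nn : ℕ => (nn:ℝ) ^ (-α)) ∧
    ((fun nn : ℕ => negEig H nn - aM * (nn:ℝ) ^ (-α)) =o[atTop] fun nn : ℕ => (nn:ℝ) ^ (-α)) := by
  have hs := tailSymbol_model (κ0 := κ0) (κinf := κinf) hα hχ0sm.continuousOn hχinfsm.continuousOn
    hχ0one hχ0zero hχinfzero hχinfone
  have hh : ∀ t, 0 < t → hstar t = ∫ x, (κinf * |x| ^ (-α) * χ0 (Real.exp x) +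
      κ0 * |x| ^ (-α) * χinf (Real.exp x)) * (Real.exp x * Real.exp (-(t * Real.exp x))) := by
    intro t ht
    rw [hhstar t ht, integral_Ioi_eq_integral_comp_exp]
    refine integral_congr_ae (Eventually.of_forall fun x => ?_)
    simp only [hσs _ (Real.exp_pos x), Real.log_exp]
    ring
  have hK := re_inner_eq_symbolForm hs hα hh hH
  have hP := laplaceFrame_lapVec.isLittleO_posEig hs hα H hK
  have hM := laplaceFrame_lapVec.isLittleO_negEig hs hα H hK
  have sP : sideSum α (fun b => if b then κ0 else κinf) =
      (max κ0 0) ^ (1/α) + (max κinf 0) ^ (1/α) := by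
    simp [sideSum]
  have sM : sideSum α (fun b => -(if b then κ0 else κinf)) =
      (max (-κ0) 0) ^ (1/α) + (max (-κinf) 0) ^ (1/α) := by
    simp [sideSum]
  rw [sP, ← haP] at hP
  rw [sM, ← haM] at hM
  exact ⟨hP, hM⟩
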